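/- arXiv:0909.1867 — 7 statements merged into one kernel-verified Lean document; each statement's English description precedes it below -/
import Mathlib

section
/- The map B from the space 𝒟(A(𝔻)) of bounded derivations from the disc algebra A(𝔻) to its dual into A(𝔻)*, defined by B(D)(f) = D(f)(1) for f ∈ A(𝔻) (where 1 is the constant function 1), is a linear, contractive (‖B(D)‖ ≤ ‖D‖) and injective map: if D(f)(1) = 0 for all f ∈ A(𝔻) then D = 0. -/
open Complex MeasureTheory Metric Real

set_option synthInstance.maxHeartbeats 400000
set_option maxHeartbeats 1000000

noncomputable section

/-- The closed unit disc `Δ ⊆ ℂ`. -/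
abbrev closedDisc : Set ℂ := Metric.closedBall 0 1

instance : CompactSpace closedDisc := isCompact_iff_compactSpace.mp (isCompact_closedBall 0 1)

/-- The disc algebra `A(𝔻)`: continuous functions on the closed unit disc which are
holomorphic on the open unit disc, viewed as a closed subalgebra of `C(Δ, ℂ)` with the
supremum norm. -/
def discAlgebra : Subalgebra ℂ C(closedDisc, ℂ) where
  carrier := {f | ∃ F : ℂ → ℂ, DifferentiableOn ℂ F (Metric.ball 0 1) ∧ ∀ z : closedDisc, f z = F z}
  mul_mem' := by
    rintro f g ⟨F, hF, hf⟩ ⟨G, hG, hg⟩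
    exact ⟨F * G, hF.mul hG, fun z => by simp [hf z, hg z]⟩
  one_mem' := ⟨fun _ => 1, differentiableOn_const 1, fun z => rfl⟩
  add_mem' := by
    rintro f g ⟨F, hF, hf⟩ ⟨G, hG, hg⟩
    exact ⟨F + G, hF.add hG, fun z => by simp [hf z, hg z]⟩
  zero_mem' := ⟨fun _ => 0, differentiableOn_const 0, fun z => rfl⟩
  algebraMap_mem' := fun c => ⟨fun _ => c, differentiableOn_const c, fun z => rfl⟩

instance : NormedRing ↥discAlgebra := inferInstance
instance : NormedAlgebra ℂ ↥discAlgebra := inferInstance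
instance : NormedSpace ℂ ↥discAlgebra := (inferInstance : NormedAlgebra ℂ ↥discAlgebra).toNormedSpace

/-- The dual space `A(𝔻)*` of the disc algebra. -/
abbrev DADual := ↥discAlgebra →L[ℂ] ℂ

/-- `D : A(𝔻) → A(𝔻)*` is a derivation into the dual bimodule `A(𝔻)*`, where the
bimodule actions are `(f·φ)(u) = φ(fu) = (φ·f)(u)`: the derivation identity
`D(fg) = f·D(g) + g·D(f)` reads `D(fg)(u) = D(g)(fu) + D(f)(gu)`. -/
def IsDerivation (D : ↥discAlgebra →L[ℂ] DADual) : Prop :=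
  ∀ f g u : ↥discAlgebra, D (f * g) u = D g (f * u) + D f (g * u)

/-- The space `𝒟(A(𝔻))` of bounded derivations from the disc algebra to its dual. -/
def Derivations : Submodule ℂ (↥discAlgebra →L[ℂ] DADual) where
  carrier := {D | IsDerivation D}
  add_mem' := by
    intro D D' hD hD' f g u
    simp only [ContinuousLinearMap.add_apply]
    rw [hD f g u, hD' f g u]; ring
  zero_mem' := by intro f g u; simp
  smul_mem' := by
    intro c D hD f g u
    simp only [ContinuousLinearMap.coe_smul', Pi.smul_apply, ContinuousLinearMap.smul_apply,
      smul_eq_mul]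
    rw [hD f g u]; ring

/-- The identity function `z` as an element of the disc algebra. -/
def discAlgebraId : ↥discAlgebra :=
  ⟨⟨fun z => (z : ℂ), continuous_subtype_val⟩, id, differentiableOn_id, fun _ => rfl⟩

theorem aeval_discAlgebraId_apply (p : Polynomial ℂ) (z : closedDisc) :
    (Polynomial.aeval discAlgebraId p : ↥discAlgebra).1 z = p.eval (z : ℂ) := by
  induction p using Polynomial.induction_on' with
  | add p q hp hq => simp only [map_add, Polynomial.eval_add, ← hp, ← hq]; rfl
  | monomial n a =>
    rw [Polynomial.aeval_monomial, Polynomial.eval_monomial, ← Algebra.smul_def]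
    change a • (((discAlgebraId : ↥discAlgebra) ^ n : ↥discAlgebra) : C(closedDisc, ℂ)) z = _
    rw [SubmonoidClass.coe_pow, ContinuousMap.pow_apply]
    rfl

/-- A function holomorphic on a neighbourhood of the closed unit disc is there a uniform limit
of polynomials. -/
theorem exists_polynomial_near_of_differentiableOn {G : ℂ → ℂ} {R : ℝ} (hR : 1 < R)
    (hG : DifferentiableOn ℂ G (Metric.closedBall 0 R)) {ε : ℝ} (hε : 0 < ε) :
    ∃ p : Polynomial ℂ, ∀ z ∈ closedDisc, dist (G z) (p.eval z) < ε := by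
  lift R to NNReal using by linarith
  have hR' : (1 : NNReal) < R := by exact_mod_cast hR
  obtain ⟨s, hs1, hsR⟩ := exists_between hR'
  have h := hG.hasFPowerSeriesOnBall (by positivity)
  have ht := h.tendstoUniformlyOn (r' := s) (by exact_mod_cast hsR)
  obtain ⟨n, hn⟩ := (Metric.tendstoUniformlyOn_iff.1 ht ε hε).exists
  refine ⟨∑ k ∈ Finset.range n,
    Polynomial.monomial k ((cauchyPowerSeries G 0 R).coeff k), fun z hz => ?_⟩
  have hz' : ‖z‖ ≤ 1 := by simpa using hz
  have := hn z (by
    have : (1 : ℝ) < s := by exact_mod_cast hs1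
    simpa using hz'.trans_lt this)
  rw [zero_add] at this
  convert this using 2
  simp only [Polynomial.eval_finsetSum, Polynomial.eval_monomial, FormalMultilinearSeries.partialSum,
    FormalMultilinearSeries.apply_eq_pow_smul_coeff, smul_eq_mul, mul_comm]

/-- Dilations `z ↦ f (r z)` with `r < 1` approximate `f` uniformly on the closed disc. -/
theorem exists_dilation_near (f : C(closedDisc, ℂ)) {F : ℂ → ℂ} (hf : ∀ z : closedDisc, f z = F z)
    {ε : ℝ} (hε : 0 < ε) :
    ∃ r : ℝ, 0 < r ∧ r < 1 ∧ ∀ z : closedDisc, dist (f z) (F (r * z)) < ε := by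
  obtain ⟨δ, hδ, h⟩ := Metric.uniformContinuous_iff.1
    (CompactSpace.uniformContinuous_of_continuous f.continuous) ε hε
  obtain ⟨r, hr, hr1⟩ := exists_between (show max 0 (1 - δ) < 1 by simp [hδ])
  obtain ⟨hr0, hrδ⟩ := max_lt_iff.1 hr
  refine ⟨r, hr0, hr1, fun z => ?_⟩
  have hz : ‖(z : ℂ)‖ ≤ 1 := mem_closedBall_zero_iff.1 z.2
  have hmem : (r : ℂ) * z ∈ closedDisc := by
    simp only [mem_closedBall, dist_zero_right, norm_mul, Complex.norm_real, Real.norm_eq_abs,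
      abs_of_pos hr0]
    nlinarith [norm_nonneg (z : ℂ)]
  rw [← hf ⟨r * z, hmem⟩]
  apply h
  rw [Subtype.dist_eq, dist_eq_norm]
  have : (z : ℂ) - r * z = ((1 - r : ℝ) : ℂ) * z := by push_cast; ring
  rw [this, norm_mul, Complex.norm_real, Real.norm_eq_abs, abs_of_pos (by linarith)]
  nlinarith [norm_nonneg (z : ℂ)]

/-- Polynomials are dense in the disc algebra. -/
theorem denseRange_aeval_discAlgebraId :
    DenseRange (fun p : Polynomial ℂ => (Polynomial.aeval discAlgebraId p : ↥discAlgebra)) := by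
  intro f
  obtain ⟨F, hF, hf⟩ := f.2
  rw [Metric.mem_closure_range_iff]
  intro ε hε
  obtain ⟨r, hr0, hr1, hr⟩ := exists_dilation_near f.1 hf (half_pos hε)
  obtain ⟨R, hR1, hR⟩ := exists_between ((one_lt_inv₀ hr0).2 hr1)
  have hG : DifferentiableOn ℂ (fun z : ℂ => F (r * z)) (Metric.closedBall 0 R) := by
    refine hF.comp (by fun_prop) fun z hz => ?_
    have hz' : ‖z‖ ≤ R := by simpa using hz
    simp only [mem_ball, dist_zero_right, norm_mul, Complex.norm_real, Real.norm_eq_abs,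
      abs_of_pos hr0]
    calc r * ‖z‖ ≤ r * R := by gcongr
      _ < r * r⁻¹ := by gcongr
      _ = 1 := mul_inv_cancel₀ hr0.ne'
  obtain ⟨p, hp⟩ := exists_polynomial_near_of_differentiableOn hR1 hG (half_pos hε)
  refine ⟨p, ?_⟩
  rw [Subtype.dist_eq, ContinuousMap.dist_lt_iff hε]
  intro z
  rw [aeval_discAlgebraId_apply]
  linarith [dist_triangle (f.1 z) (F (r * z)) (p.eval (z : ℂ)), hr z, hp z z.2]

theorem IsDerivation.sub {D D' : ↥discAlgebra →L[ℂ] DADual} (hD : IsDerivation D)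
    (hD' : IsDerivation D') : IsDerivation (D - D') := by
  intro f g u
  change D (f * g) u - D' (f * g) u = (D g (f * u) - D' g (f * u)) + (D f (g * u) - D' f (g * u))
  rw [hD, hD']
  ring

theorem IsDerivation.apply_one {D : ↥discAlgebra →L[ℂ] DADual} (hD : IsDerivation D)
    (u : ↥discAlgebra) : D 1 u = 0 := by
  simpa using hD 1 1 u

theorem IsDerivation.apply_pow_succ {D : ↥discAlgebra →L[ℂ] DADual} (hD : IsDerivation D)
    (f u : ↥discAlgebra) (n : ℕ) : D (f ^ (n + 1)) u = (n + 1) * D f (f ^ n * u) := by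
  induction n generalizing u with
  | zero => simp
  | succ n ih =>
    rw [pow_succ, hD, ih, ← mul_assoc, ← pow_succ]
    push_cast
    ring

/-- A continuous linear map on the disc algebra is determined by its values on powers of `z`. -/
theorem eq_zero_of_apply_discAlgebraId_pow {E : Type*} [NormedAddCommGroup E] [NormedSpace ℂ E]
    {T : ↥discAlgebra →L[ℂ] E} (h : ∀ n : ℕ, T (discAlgebraId ^ n) = 0) : T = 0 := by
  refine DFunLike.coe_injective
    (denseRange_aeval_discAlgebraId.equalizer T.continuous continuous_const ?_)
  funext p
  change T (Polynomial.aeval discAlgebraId p) = 0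
  induction p using Polynomial.induction_on' with
  | add p q hp hq => simp_all
  | monomial n a =>
    rw [Polynomial.aeval_monomial, ← Algebra.smul_def, map_smul, h, smul_zero]

theorem IsDerivation.eq_zero {D : ↥discAlgebra →L[ℂ] DADual} (hD : IsDerivation D)
    (h : ∀ f : ↥discAlgebra, D f 1 = 0) : D = 0 := by
  have hZ : D discAlgebraId = 0 := eq_zero_of_apply_discAlgebraId_pow fun n => by
    have := hD.apply_pow_succ discAlgebraId 1 n
    rw [h, mul_one] at this
    exact (mul_eq_zero.1 this.symm).resolve_left n.cast_add_one_ne_zero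
  refine eq_zero_of_apply_discAlgebraId_pow fun n => ContinuousLinearMap.ext fun u => ?_
  cases n with
  | zero => simpa using hD.apply_one u
  | succ n => simp [hD.apply_pow_succ, hZ]

/-- The map `B : 𝒟(A(𝔻)) → A(𝔻)*`, `B(D)(f) = D(f)(1)`, is linear,
contractive and injective. -/
theorem exists_linear_contractive_injective_B :
    ∃ B : Derivations →ₗ[ℂ] DADual,
      (∀ (D : Derivations) (f : ↥discAlgebra), B D f = (D : ↥discAlgebra →L[ℂ] DADual) f 1) ∧
      (∀ D : Derivations, ‖B D‖ ≤ ‖(D : ↥discAlgebra →L[ℂ] DADual)‖) ∧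
      Function.Injective B := by
  refine ⟨{ toFun := fun D => (D : ↥discAlgebra →L[ℂ] DADual).flip 1
            map_add' := fun _ _ => rfl
            map_smul' := fun _ _ => rfl }, fun _ _ => rfl, fun D => ?_, ?_⟩
  · refine ContinuousLinearMap.opNorm_le_bound _
      (norm_nonneg (D : ↥discAlgebra →L[ℂ] DADual)) fun f => ?_
    have h := (D : ↥discAlgebra →L[ℂ] DADual).le_opNorm₂ f 1
    have h1 : ‖(1 : ↥discAlgebra)‖ ≤ 1 :=
      (ContinuousMap.norm_le (1 : C(closedDisc, ℂ)) zero_le_one).2 fun z => by simp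
    exact h.trans (mul_le_of_le_one_right (by positivity) h1)
  · intro D D' h
    have hsub : IsDerivation (D.1 - D'.1) := D.2.sub D'.2
    exact Subtype.ext (sub_eq_zero.1 (hsub.eq_zero fun f => sub_eq_zero.2 (DFunLike.congr_fun h f)))

end
end

section
/- Let X be a compact Hausdorff space, A a unital uniform algebra on X, M a symmetric contractive Banach A-bimodule, and D : A → M a bounded derivation. If f ∈ A is such that its complex conjugate f̄ also belongs to A, then D(f) = 0. -/
open Complex MeasureTheory Metric Real

set_option synthInstance.maxHeartbeats 400000
set_option maxHeartbeats 1000000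

noncomputable section

/-- A uniform algebra on a compact Hausdorff space is in particular a normed space over `ℂ`. -/
instance subalgebraNormedSpace {X : Type*} [TopologicalSpace X] [CompactSpace X]
    (A : Subalgebra ℂ C(X, ℂ)) : NormedSpace ℂ ↥A :=
  (inferInstance : NormedAlgebra ℂ ↥A).toNormedSpace

/-- A bounded derivation into a contractive module vanishes at every contraction that has a
contractive inverse. -/
theorem Derivation.apply_eq_zero_of_norm_le_one {A M : Type*} [NormedCommRing A]
    [NormedAlgebra ℂ A] [NormedAddCommGroup M] [NormedSpace ℂ M] [Module A M]
    (hM : ∀ (a : A) (m : M), ‖a • m‖ ≤ ‖a‖ * ‖m‖) (D : Derivation ℂ A M)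
    {C : ℝ} (hC : ∀ a, ‖D a‖ ≤ C * ‖a‖) {v w : A} (hwv : w * v = 1)
    (hv : ‖v‖ ≤ 1) (hw : ‖w‖ ≤ 1) : D v = 0 := by
  have contract (n : ℕ) (m : M) : ‖w ^ n • m‖ ≤ ‖m‖ := by
    induction n with
    | zero => simp
    | succ n ih =>
      rw [pow_succ', mul_smul]
      exact (hM _ _).trans ((mul_le_of_le_one_left (norm_nonneg _) hw).trans ih)
  have bound (n : ℕ) : (n + 1 : ℝ) * ‖D v‖ ≤ |C| := by
    have key : w ^ n • D (v ^ (n + 1)) = (n + 1) • D v := by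
      rw [D.leibniz_pow, smul_comm, ← mul_smul, Nat.add_sub_cancel, ← mul_pow, hwv, one_pow,
        one_smul]
    have hpow : ‖v ^ (n + 1)‖ ≤ 1 :=
      (norm_pow_le' v n.succ_pos).trans (pow_le_one₀ (norm_nonneg v) hv)
    calc (n + 1 : ℝ) * ‖D v‖ = ‖(n + 1) • D v‖ := by
          rw [← Nat.cast_smul_eq_nsmul ℂ, norm_smul, Complex.norm_natCast]
          push_cast
          rfl
      _ ≤ ‖D (v ^ (n + 1))‖ := key ▸ contract n _
      _ ≤ C * ‖v ^ (n + 1)‖ := hC _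
      _ ≤ |C| * ‖v ^ (n + 1)‖ := by gcongr; exact le_abs_self C
      _ ≤ |C| := mul_le_of_le_one_right (abs_nonneg C) hpow
  by_contra h
  obtain ⟨n, hn⟩ := exists_nat_gt (|C| / ‖D v‖)
  rw [div_lt_iff₀ (norm_pos_iff.mpr h)] at hn
  linarith [bound n, norm_nonneg (D v)]

/-- The largest star subalgebra contained in a subalgebra. -/
def Subalgebra.starCore {B : Type*} [CommRing B] [StarRing B] [Algebra ℂ B] [StarModule ℂ B]
    (A : Subalgebra ℂ B) : StarSubalgebra ℂ B where
  toSubalgebra := A ⊓ star A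
  star_mem' {a} ha := ⟨ha.2, by simpa [Subalgebra.mem_star_iff] using ha.1⟩

theorem Subalgebra.isClosed_starCore {B : Type*} [CommRing B] [StarRing B] [Algebra ℂ B]
    [StarModule ℂ B] [TopologicalSpace B] [ContinuousStar B] {A : Subalgebra ℂ B}
    (hA : IsClosed (A : Set B)) : IsClosed (A.starCore : Set B) :=
  hA.inter (hA.preimage continuous_star)

theorem CStarRing.norm_le_one_of_mem_unitary {B : Type*} [NormedRing B] [StarRing B]
    [CStarRing B] {u : B} (hu : u ∈ unitary B) : ‖u‖ ≤ 1 := by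
  cases subsingleton_or_nontrivial B
  · simp [Subsingleton.elim u 0]
  · exact (CStarRing.norm_of_mem_unitary hu).le

/-- Let `A` be a unital uniform algebra on a compact Hausdorff space `X`
(a closed subalgebra of `C(X, ℂ)` containing the constants), `M` a symmetric contractive
Banach `A`-bimodule (encoded as a single contractive `A`-module action) and `D : A → M` a
bounded derivation.  If `f ∈ A` and its complex conjugate `f̄ = star f` also lies in `A`,
then `D f = 0`. -/
theorem derivation_apply_eq_zero_of_star_mem
    {X : Type*} [TopologicalSpace X] [CompactSpace X] [T2Space X]
    (A : Subalgebra ℂ C(X, ℂ)) (hA : IsClosed (A : Set C(X, ℂ)))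
    {M : Type*} [NormedAddCommGroup M] [NormedSpace ℂ M] [CompleteSpace M]
    [Module ↥A M] [IsScalarTower ℂ ↥A M]
    (hM : ∀ (a : ↥A) (m : M), ‖a • m‖ ≤ ‖a‖ * ‖m‖)
    (D : ↥A →L[ℂ] M) (hD : ∀ f g : ↥A, D (f * g) = f • D g + g • D f)
    (f : ↥A) (hf : star (f : C(X, ℂ)) ∈ A) :
    D f = 0 := by
  let S := A.starCore
  have : IsClosed (S : Set C(X, ℂ)) := Subalgebra.isClosed_starCore hA
  let _ : CStarAlgebra S := StarSubalgebra.cstarAlgebra S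
  let incl : S →ₗ[ℂ] A := (Subalgebra.inclusion (inf_le_left : A ⊓ star A ≤ A)).toLinearMap
  have hspan := CStarAlgebra.span_unitary (A := S)
  have hzero : (D : A →ₗ[ℂ] M) ∘ₗ incl = 0 := by
    refine LinearMap.ext_on hspan fun u hu => ?_
    have hu' : (u : C(X, ℂ)) ∈ unitary C(X, ℂ) :=
      ⟨congrArg (Subtype.val : S → C(X, ℂ)) hu.1, congrArg (Subtype.val : S → C(X, ℂ)) hu.2⟩
    have hv : ‖incl u‖ ≤ 1 := CStarRing.norm_le_one_of_mem_unitary (B := C(X, ℂ)) hu'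
    have hw : ‖incl (star u)‖ ≤ 1 :=
      CStarRing.norm_le_one_of_mem_unitary (B := C(X, ℂ)) (Unitary.star_mem hu')
    have hwv : incl (star u) * incl u = 1 := Subtype.ext hu'.1
    exact Derivation.apply_eq_zero_of_norm_le_one hM (Derivation.mk' (D : A →ₗ[ℂ] M) hD)
      D.le_opNorm hwv hv hw
  exact LinearMap.congr_fun hzero (⟨f, f.2, hf⟩ : S)

end
end

section
/- Let X be a compact Hausdorff space, A a unital uniform algebra on X, M a symmetric contractive Banach A-bimodule, and D : A → M a bounded derivation. Then for every h ∈ A one has ‖D(h)‖ ≤ 2e‖D‖·‖Re h‖_∞, where Re h denotes the real part of h and ‖D‖ is the operator norm of D. -/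
open Complex MeasureTheory Metric Real

set_option synthInstance.maxHeartbeats 400000
set_option maxHeartbeats 1000000

noncomputable section

/-- Left multiplication on a fixed element of a contractive module, as a continuous map. -/
def smulRightCLM {B M : Type*} [NormedRing B] [NormedAlgebra ℂ B] [NormedAddCommGroup M]
    [NormedSpace ℂ M] [Module B M] [IsScalarTower ℂ B M]
    (hM : ∀ (a : B) (m : M), ‖a • m‖ ≤ ‖a‖ * ‖m‖) (m : M) : B →L[ℂ] M :=
  LinearMap.mkContinuous
    { toFun := fun a => a • m
      map_add' := fun a b => add_smul a b m
      map_smul' := fun c a => smul_assoc c a m } ‖m‖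
    fun a => (hM a m).trans_eq (mul_comm _ _)

/-- The power rule for derivations into a symmetric bimodule. -/
theorem derivation_pow_succ {B M : Type*} [CommRing B] [Algebra ℂ B] [AddCommGroup M]
    [Module ℂ M] [Module B M] [IsScalarTower ℂ B M] (D : B → M)
    (hD : ∀ f g, D (f * g) = f • D g + g • D f) (a : B) (n : ℕ) :
    D (a ^ (n + 1)) = ((n + 1 : ℕ) : ℂ) • (a ^ n • D a) := by
  induction n with
  | zero => simp
  | succ n ih =>
    have hcomm : a • ((n + 1 : ℕ) : ℂ) • (a ^ n • D a) =
        ((n + 1 : ℕ) : ℂ) • (a ^ (n + 1) • D a) := by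
      rw [← smul_comm, smul_smul, pow_succ']
    rw [pow_succ' a (n + 1), hD, ih, hcomm]
    push_cast
    module

/-- A bounded derivation satisfies the chain rule for the exponential. -/
theorem derivation_exp {B M : Type*} [NormedCommRing B] [NormedAlgebra ℂ B] [CompleteSpace B]
    [NormedAddCommGroup M] [NormedSpace ℂ M] [Module B M] [IsScalarTower ℂ B M]
    (hM : ∀ (a : B) (m : M), ‖a • m‖ ≤ ‖a‖ * ‖m‖) (D : B →L[ℂ] M)
    (hD : ∀ f g, D (f * g) = f • D g + g • D f) (a : B) :
    D (NormedSpace.exp a) = NormedSpace.exp a • D a := by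
  have hsum := NormedSpace.exp_series_hasSum_exp' (𝕂 := ℂ) a
  have h₁ := (smulRightCLM hM (D a)).hasSum hsum
  have h₂ := D.hasSum hsum
  have hone : D 1 = 0 := by simpa using hD 1 1
  rw [← hasSum_nat_add_iff' 1] at h₂
  have hterm : ∀ n : ℕ, D (((n + 1).factorial⁻¹ : ℂ) • a ^ (n + 1)) =
      smulRightCLM hM (D a) ((n.factorial⁻¹ : ℂ) • a ^ n) := fun n => by
    have hn : ((n : ℂ) + 1) ≠ 0 := by exact_mod_cast n.succ_ne_zero
    rw [map_smul, map_smul, derivation_pow_succ D hD, smul_smul]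
    congr 1
    rw [Nat.factorial_succ]
    push_cast
    field_simp
  have h₃ := h₂.unique (by simpa only [hterm] using h₁)
  simp only [Finset.sum_range_one, pow_zero, map_smul, hone, smul_zero, sub_zero] at h₃
  exact h₃

/-- `exp (-a)` is a left inverse of `exp a` in a complex Banach algebra. -/
theorem exp_neg_mul_exp {B : Type*} [NormedRing B] [NormedAlgebra ℂ B] [CompleteSpace B]
    (a : B) : NormedSpace.exp (-a) * NormedSpace.exp a = 1 := by
  let : NormedAlgebra ℚ B := NormedAlgebra.restrictScalars ℚ ℂ B
  rw [← NormedSpace.exp_add_of_commute (Commute.refl a).neg_left, neg_add_cancel,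
    NormedSpace.exp_zero]

/-- Continuous complex characters commute with the exponential. -/
theorem character_exp {B : Type*} [NormedRing B] [NormedAlgebra ℂ B] [CompleteSpace B]
    (φ : B →ₐ[ℂ] ℂ) (hφ : Continuous φ) (a : B) :
    φ (NormedSpace.exp a) = Complex.exp (φ a) := by
  let : NormedAlgebra ℚ B := NormedAlgebra.restrictScalars ℚ ℂ B
  rw [Complex.exp_eq_exp_ℂ]
  exact NormedSpace.map_exp φ hφ a

/-- The exponential in a uniform algebra is bounded by the exponential of any bound on the
real part. -/
theorem norm_exp_le_of_re_le {X : Type*} [TopologicalSpace X] [CompactSpace X]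
    (A : Subalgebra ℂ C(X, ℂ)) [CompleteSpace A] (a : A) (r : ℝ)
    (ha : ∀ x, ((a : C(X, ℂ)) x).re ≤ r) : ‖NormedSpace.exp a‖ ≤ Real.exp r := by
  change ‖((NormedSpace.exp a : A) : C(X, ℂ))‖ ≤ _
  refine (ContinuousMap.norm_le _ (Real.exp_pos r).le).2 fun x => ?_
  have he : ((NormedSpace.exp a : A) : C(X, ℂ)) x = Complex.exp ((a : C(X, ℂ)) x) :=
    character_exp ((ContinuousMap.evalAlgHom ℂ ℂ x).comp A.val)
      ((continuous_eval_const x).comp continuous_subtype_val) a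
  rw [he, Complex.norm_exp]
  exact Real.exp_le_exp.2 (ha x)

/-- If `t * c ≤ exp (2 * t * r) * d` for all `t > 0`, then `c ≤ 2 * e * d * r`. -/
theorem le_of_forall_mul_le_exp_mul {c d r : ℝ} (hr : 0 ≤ r)
    (H : ∀ t : ℝ, 0 < t → t * c ≤ Real.exp (2 * t * r) * d) :
    c ≤ 2 * Real.exp 1 * d * r := by
  rcases hr.eq_or_lt with rfl | hr
  · simp only [mul_zero, Real.exp_zero, one_mul] at H ⊢
    by_contra! hc
    have h₁ := H (|d| / c + 1) (by positivity)
    rw [add_mul, div_mul_cancel₀ _ hc.ne'] at h₁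
    linarith [le_abs_self d]
  · have h₁ := H (1 / (2 * r)) (by positivity)
    rw [show 2 * (1 / (2 * r)) * r = 1 by field_simp, one_div, inv_mul_le_iff₀ (by positivity)]
      at h₁
    linarith

/-- Let `A` be a unital uniform algebra on a compact Hausdorff space `X`,
`M` a symmetric contractive Banach `A`-bimodule and `D : A → M` a bounded derivation.  Then
`‖D h‖ ≤ 2e‖D‖·‖Re h‖_∞` for every `h ∈ A`. -/
theorem norm_derivation_apply_le_re
    {X : Type*} [TopologicalSpace X] [CompactSpace X] [T2Space X]
    (A : Subalgebra ℂ C(X, ℂ)) (hA : IsClosed (A : Set C(X, ℂ)))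
    {M : Type*} [NormedAddCommGroup M] [NormedSpace ℂ M] [CompleteSpace M]
    [Module ↥A M] [IsScalarTower ℂ ↥A M]
    (hM : ∀ (a : ↥A) (m : M), ‖a • m‖ ≤ ‖a‖ * ‖m‖)
    (D : ↥A →L[ℂ] M) (hD : ∀ f g : ↥A, D (f * g) = f • D g + g • D f)
    (h : ↥A) :
    ‖D h‖ ≤ 2 * Real.exp 1 * ‖D‖ *
      ‖(⟨Complex.re, Complex.continuous_re⟩ : C(ℂ, ℝ)).comp (h : C(X, ℂ))‖ := by
  have : CompleteSpace ↥A := hA.completeSpace_coe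
  have hre (x : X) : |((h : C(X, ℂ)) x).re| ≤
      ‖(⟨Complex.re, Complex.continuous_re⟩ : C(ℂ, ℝ)).comp (h : C(X, ℂ))‖ :=
    ContinuousMap.norm_coe_le_norm
      ((⟨Complex.re, Complex.continuous_re⟩ : C(ℂ, ℝ)).comp (h : C(X, ℂ))) x
  refine le_of_forall_mul_le_exp_mul (norm_nonneg _) fun t ht => ?_
  set r := ‖(⟨Complex.re, Complex.continuous_re⟩ : C(ℂ, ℝ)).comp (h : C(X, ℂ))‖
  set a : ↥A := (t : ℂ) • h with ha
  have hval (x : X) : ((a : C(X, ℂ)) x).re = t * ((h : C(X, ℂ)) x).re := by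
    simp [ha]
  have hpos : ‖NormedSpace.exp a‖ ≤ Real.exp (t * r) := norm_exp_le_of_re_le A a _ fun x => by
    rw [hval]
    exact mul_le_mul_of_nonneg_left ((le_abs_self _).trans (hre x)) ht.le
  have hneg : ‖NormedSpace.exp (-a)‖ ≤ Real.exp (t * r) := norm_exp_le_of_re_le A (-a) _ fun x => by
    have h₁ : (((-a : ↥A) : C(X, ℂ)) x).re = t * -((h : C(X, ℂ)) x).re := by
      rw [mul_neg, ← hval]
      rfl
    rw [h₁]
    exact mul_le_mul_of_nonneg_left ((neg_le_abs _).trans (hre x)) ht.le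
  have hinv : NormedSpace.exp (-a) * NormedSpace.exp a = 1 := exp_neg_mul_exp a
  have hDa : D a = NormedSpace.exp (-a) • D (NormedSpace.exp a) := by
    rw [derivation_exp hM D hD, smul_smul, hinv, one_smul]
  calc t * ‖D h‖ = ‖D a‖ := by
        rw [ha, map_smul, norm_smul, Complex.norm_of_nonneg ht.le]
    _ ≤ ‖NormedSpace.exp (-a)‖ * (‖D‖ * ‖NormedSpace.exp a‖) := by
        rw [hDa]
        exact (hM _ _).trans (mul_le_mul_of_nonneg_left (D.le_opNorm _) (norm_nonneg _))
    _ ≤ Real.exp (t * r) * (‖D‖ * Real.exp (t * r)) := by gcongr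
    _ = Real.exp (2 * t * r) * ‖D‖ := by
        rw [show 2 * t * r = t * r + t * r by ring, Real.exp_add]
        ring

end
end

section
/- Let X be a compact Hausdorff space, A a unital uniform algebra on X, M a symmetric contractive Banach A-bimodule, and D : A → M a bounded derivation. Then for all f, g ∈ A one has ‖D(f)‖ ≤ 2e‖D‖·‖f − ḡ‖_∞, where ḡ is the complex conjugate of g and ‖D‖ is the operator norm of D. -/
open Complex MeasureTheory Metric Real

set_option synthInstance.maxHeartbeats 400000
set_option maxHeartbeats 1000000

noncomputable section

/-- A continuous character of a complex Banach algebra intertwines the exponentials. -/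
theorem map_exp_of_algHom {B : Type*} [NormedCommRing B] [NormedAlgebra ℂ B] [CompleteSpace B]
    (φ : B →ₐ[ℂ] ℂ) (hφ : Continuous φ) (v : B) :
    φ (NormedSpace.exp v) = Complex.exp (φ v) := by
  rw [Complex.exp_eq_exp_ℂ]
  exact NormedSpace.map_exp_of_mem_ball (𝕂 := ℂ) φ hφ v
    ((NormedSpace.expSeries_radius_eq_top ℂ B).symm ▸ edist_lt_top _ _)

/-- A bounded derivation on a Banach algebra satisfies the chain rule for the exponential. -/
theorem derivation_apply_exp {B M : Type*}
    [NormedCommRing B] [NormedAlgebra ℂ B] [CompleteSpace B]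
    [NormedAddCommGroup M] [NormedSpace ℂ M] [Module B M] [IsScalarTower ℂ B M]
    (hM : ∀ (a : B) (m : M), ‖a • m‖ ≤ ‖a‖ * ‖m‖)
    (D : B →L[ℂ] M) (hD : ∀ f g : B, D (f * g) = f • D g + g • D f) (u : B) :
    D (NormedSpace.exp u) = NormedSpace.exp u • D u := by
  let δ : Derivation ℂ B M := Derivation.mk' D.toLinearMap hD
  let S : B →L[ℂ] M := ((LinearMap.toSpanSingleton B M (D u)).restrictScalars ℂ).mkContinuous
    ‖D u‖ fun a => (hM a (D u)).trans_eq (mul_comm _ _)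
  have hS : ∀ a, S a = a • D u := fun a => rfl
  have hsum := NormedSpace.exp_series_hasSum_exp' (𝕂 := ℂ) u
  have hleft := D.hasSum hsum
  have hright := S.hasSum hsum
  have hterm : ∀ n : ℕ, D (((n + 1).factorial⁻¹ : ℂ) • u ^ (n + 1)) =
      S ((n.factorial⁻¹ : ℂ) • u ^ n) := by
    intro n
    have hpow : D (u ^ (n + 1)) = (n + 1) • u ^ n • D u := δ.leibniz_pow u (n + 1)
    rw [map_smul, map_smul, hpow, hS, ← Nat.cast_smul_eq_nsmul ℂ, smul_smul]
    congr 1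
    rw [Nat.factorial_succ]
    push_cast
    have h₁ : (n : ℂ) + 1 ≠ 0 := Nat.cast_add_one_ne_zero n
    have h₂ : (n.factorial : ℂ) ≠ 0 := by exact_mod_cast n.factorial_ne_zero
    field_simp
  have hone : D 1 = 0 := δ.map_one_eq_zero
  have hshift := (hasSum_nat_add_iff' 1).2 hleft
  simp only [Finset.range_one, Finset.sum_singleton, pow_zero, map_smul D _ (1 : B),
    hone, smul_zero, sub_zero, hterm] at hshift
  exact hshift.unique hright

/-- If `|Re u| ≤ s` then `u` is sent by a bounded derivation to an element of norm at most
`‖D‖ e^{2s}`. -/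
theorem norm_derivation_apply_le_of_abs_re_le
    {X : Type*} [TopologicalSpace X] [CompactSpace X]
    (A : Subalgebra ℂ C(X, ℂ)) (hA : IsClosed (A : Set C(X, ℂ)))
    {M : Type*} [NormedAddCommGroup M] [NormedSpace ℂ M]
    [Module ↥A M] [IsScalarTower ℂ ↥A M]
    (hM : ∀ (a : ↥A) (m : M), ‖a • m‖ ≤ ‖a‖ * ‖m‖)
    (D : ↥A →L[ℂ] M) (hD : ∀ f g : ↥A, D (f * g) = f • D g + g • D f)
    (u : ↥A) (s : ℝ) (hu : ∀ x, |((u : C(X, ℂ)) x).re| ≤ s) :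
    ‖D u‖ ≤ ‖D‖ * Real.exp (2 * s) := by
  have : CompleteSpace ↥A := hA.isComplete.completeSpace_coe
  have hexp : ∀ (v : ↥A) (x : X),
      ((NormedSpace.exp v : ↥A) : C(X, ℂ)) x = Complex.exp ((v : C(X, ℂ)) x) := by
    intro v x
    exact map_exp_of_algHom ((ContinuousMap.evalAlgHom ℂ ℂ x).comp A.val)
      ((continuous_eval_const x).comp continuous_subtype_val) v
  have hnorm : ∀ v : ↥A, (∀ x, ((v : C(X, ℂ)) x).re ≤ s) →
      ‖NormedSpace.exp v‖ ≤ Real.exp s := by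
    intro v hv
    refine (ContinuousMap.norm_le _ (Real.exp_pos s).le).2 fun x => ?_
    exact ((congrArg norm (hexp v x)).trans (Complex.norm_exp _)).trans_le
      (Real.exp_le_exp.2 (hv x))
  have hpos : ‖NormedSpace.exp u‖ ≤ Real.exp s := hnorm u fun x => (abs_le.1 (hu x)).2
  have hneg : ‖NormedSpace.exp (-u)‖ ≤ Real.exp s := hnorm (-u) fun x => by
    simpa using neg_le.1 (abs_le.1 (hu x)).1
  have hinv : NormedSpace.exp (-u) * NormedSpace.exp u = 1 := by
    ext x
    simp [hexp, ← Complex.exp_add]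
  have hDu : D u = NormedSpace.exp (-u) • D (NormedSpace.exp u) := by
    rw [derivation_apply_exp hM D hD u, smul_smul, hinv, one_smul]
  calc ‖D u‖ ≤ ‖NormedSpace.exp (-u)‖ * ‖D (NormedSpace.exp u)‖ := hDu ▸ hM _ _
    _ ≤ Real.exp s * (‖D‖ * Real.exp s) := by
        gcongr
        exact D.le_opNorm_of_le hpos
    _ = ‖D‖ * Real.exp (2 * s) := by rw [two_mul, Real.exp_add]; ring

/-- Let `A` be a unital uniform algebra on a compact Hausdorff space `X`,
`M` a symmetric contractive Banach `A`-bimodule and `D : A → M` a bounded derivation.  Then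
`‖D f‖ ≤ 2e‖D‖·‖f − ḡ‖_∞` for all `f, g ∈ A`. -/
theorem norm_derivation_apply_le_dist_conj
    {X : Type*} [TopologicalSpace X] [CompactSpace X] [T2Space X]
    (A : Subalgebra ℂ C(X, ℂ)) (hA : IsClosed (A : Set C(X, ℂ)))
    {M : Type*} [NormedAddCommGroup M] [NormedSpace ℂ M] [CompleteSpace M]
    [Module ↥A M] [IsScalarTower ℂ ↥A M]
    (hM : ∀ (a : ↥A) (m : M), ‖a • m‖ ≤ ‖a‖ * ‖m‖)
    (D : ↥A →L[ℂ] M) (hD : ∀ f g : ↥A, D (f * g) = f • D g + g • D f)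
    (f g : ↥A) :
    ‖D f‖ ≤ 2 * Real.exp 1 * ‖D‖ * ‖(f : C(X, ℂ)) - star (g : C(X, ℂ))‖ := by
  have key : ∀ ε : ℝ, ‖(f : C(X, ℂ)) - star (g : C(X, ℂ))‖ < ε →
      ‖D f‖ ≤ 2 * Real.exp 1 * ‖D‖ * ε := by
    intro ε hε
    have hε0 : 0 < ε := (norm_nonneg _).trans_lt hε
    have hx : ∀ x, ‖(f : C(X, ℂ)) x - star ((g : C(X, ℂ)) x)‖ ≤ ε := fun x =>
      (ContinuousMap.norm_coe_le_norm ((f : C(X, ℂ)) - star (g : C(X, ℂ))) x).trans hε.le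
    set r : ℝ := (2 * ε)⁻¹ with hr
    have hr0 : 0 < r := by positivity
    have hrε : r * ε = 1 / 2 := by rw [hr]; field_simp
    have hminus : ‖D ((r : ℂ) • (f - g))‖ ≤ ‖D‖ * Real.exp (2 * (1 / 2)) := by
      refine norm_derivation_apply_le_of_abs_re_le A hA hM D hD _ _ fun x => ?_
      have h := (Complex.abs_re_le_norm _).trans (hx x)
      have h' : (((((r : ℂ) • (f - g) : ↥A) : C(X, ℂ)) x).re) =
          r * ((f : C(X, ℂ)) x - star ((g : C(X, ℂ)) x)).re := by simp
      rw [h', abs_mul, abs_of_pos hr0, ← hrε]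
      gcongr
    have hplus : ‖D ((r * Complex.I : ℂ) • (f + g))‖ ≤ ‖D‖ * Real.exp (2 * (1 / 2)) := by
      refine norm_derivation_apply_le_of_abs_re_le A hA hM D hD _ _ fun x => ?_
      have h := (Complex.abs_im_le_norm _).trans (hx x)
      have h' : (((((r * Complex.I : ℂ) • (f + g) : ↥A) : C(X, ℂ)) x).re) =
          -(r * ((f : C(X, ℂ)) x - star ((g : C(X, ℂ)) x)).im) := by simp; ring
      rw [h', abs_neg, abs_mul, abs_of_pos hr0, ← hrε]
      gcongr
    rw [map_smul, norm_smul] at hminus hplus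
    simp only [norm_mul, Complex.norm_real, Complex.norm_I, mul_one, Real.norm_of_nonneg hr0.le]
      at hminus hplus
    norm_num at hminus hplus
    have htwo : 2 * ‖D f‖ ≤ ‖D f - D g‖ + ‖D f + D g‖ := by
      have h : (2 : ℂ) • D f = (D f - D g) + (D f + D g) := by rw [two_smul]; abel
      calc 2 * ‖D f‖ = ‖(2 : ℂ) • D f‖ := by rw [norm_smul]; norm_num
        _ ≤ _ := h ▸ norm_add_le _ _
    have hrD : r * ‖D f‖ ≤ ‖D‖ * Real.exp 1 := by
      nlinarith [mul_le_mul_of_nonneg_left htwo hr0.le]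
    calc ‖D f‖ = 2 * ε * (r * ‖D f‖) := by rw [hr]; field_simp
      _ ≤ 2 * ε * (‖D‖ * Real.exp 1) := by gcongr
      _ = 2 * Real.exp 1 * ‖D‖ * ε := by ring
  have hlim := (continuous_const_mul (2 * Real.exp 1 * ‖D‖)).continuousWithinAt.tendsto
    (x := ‖(f : C(X, ℂ)) - star (g : C(X, ℂ))‖)
    (s := Set.Ioi ‖(f : C(X, ℂ)) - star (g : C(X, ℂ))‖)
  exact ge_of_tendsto hlim (Filter.eventually_of_mem self_mem_nhdsWithin key)

end
end

section
/- Let h ∈ L¹(𝕋) satisfy ĥ(n) = 0 for all integers n ≤ 0 (i.e., h ∈ H¹_0). Then there exists a constant K > 0 such that for all functions f, g, u holomorphic on some open set containing the closed unit disc Δ, with u(0) = 0 and u'(z) = f'(z)g(z) for all z in that open set, one has |∫_𝕋 u(z) conj(h(z)) |dz|| ≤ K ‖f‖_∞ ‖g‖_∞, where ‖·‖_∞ is the supremum norm over Δ and conj denotes complex conjugation. -/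
open Complex MeasureTheory Metric Real

set_option synthInstance.maxHeartbeats 400000
set_option maxHeartbeats 1000000

noncomputable section

/-- The circle `𝕋`, parametrised as `ℝ/2πℤ`; its Haar measure `volume` has total mass `2π`,
corresponding to normalised arc length measure `|dz|`. -/
abbrev Circ := AddCircle (2 * Real.pi)

instance : Fact (0 < 2 * Real.pi) := ⟨by positivity⟩


namespace HardyBound

open Filter Topology Set
open scoped ComplexConjugate

/-- The point of the unit circle with argument `θ`. -/
def circPt (θ : Circ) : ℂ := fourier 1 θ

lemma continuous_circPt : Continuous circPt := (fourier 1).continuous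

lemma norm_circPt (θ : Circ) : ‖circPt θ‖ = 1 := Circle.norm_coe _

lemma circPt_pow (θ : Circ) (n : ℕ) : circPt θ ^ n = fourier (n : ℤ) θ := by
  induction n with
  | zero => simp
  | succ k ih => rw [pow_succ, ih, circPt, Nat.cast_succ, fourier_add]

lemma integrable_of_continuous {E : Type*} [NormedAddCommGroup E] {F : Circ → E}
    (hF : Continuous F) : Integrable F :=
  hF.integrable_of_hasCompactSupport (HasCompactSupport.of_compactSpace F)

lemma integral_fourier (n : ℤ) :
    ∫ θ : Circ, (fourier n θ : ℂ) = if n = 0 then 2 * (π : ℂ) else 0 := by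
  split_ifs with hn
  · subst hn
    simp only [fourier_zero, integral_const]
    rw [measureReal_def, AddCircle.measure_univ, ENNReal.toReal_ofReal (by positivity)]
    simp
  · exact integral_eq_zero_of_add_right_eq_neg
      (fourier_add_half_inv_index (T := 2 * π) hn (by positivity))

/-- Term-by-term integration of an absolutely convergent power series against an integrable
function on the circle. -/
lemma hasSum_integral_mul {a : ℕ → ℂ} (ha : Summable fun n => ‖a n‖) {A : Circ → ℂ}
    (hA : ∀ θ, HasSum (fun n => a n * circPt θ ^ n) (A θ)) {k : Circ → ℂ} (hk : Integrable k) :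
    HasSum (fun n => a n * ∫ θ, circPt θ ^ n * k θ) (∫ θ, A θ * k θ) := by
  have hint (n : ℕ) : Integrable fun θ => a n * (circPt θ ^ n * k θ) := by
    refine (hk.bdd_mul (c := 1) ?_ ?_).const_mul _
    · exact (continuous_circPt.pow n).aestronglyMeasurable
    · exact Eventually.of_forall fun θ => by simp [norm_circPt]
  have hsum : Summable fun n => ∫ θ, ‖a n * (circPt θ ^ n * k θ)‖ := by
    simpa [norm_circPt, integral_const_mul] using ha.mul_right (∫ θ, ‖k θ‖)
  have := hasSum_integral_of_summable_integral_norm hint hsum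
  simp only [integral_const_mul] at this
  have heq : ∫ θ, A θ * k θ = ∫ θ, ∑' n, a n * (circPt θ ^ n * k θ) := by
    congr 1 with θ
    rw [← ((hA θ).mul_right (k θ)).tsum_eq]
    simp only [mul_assoc]
  rw [heq]
  exact this

lemma integral_mul_fourier_neg {a : ℕ → ℂ} (ha : Summable fun n => ‖a n‖) {A : Circ → ℂ}
    (hA : ∀ θ, HasSum (fun n => a n * circPt θ ^ n) (A θ)) (n : ℕ) :
    ∫ θ, A θ * fourier (-n : ℤ) θ = 2 * π * a n := by
  have h1 := hasSum_integral_mul ha hA (k := fun θ => fourier (-n : ℤ) θ)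
    (integrable_of_continuous (fourier (-n : ℤ)).continuous)
  have h2 (m : ℕ) : ∫ θ, circPt θ ^ m * fourier (-n : ℤ) θ = if m = n then 2 * (π : ℂ) else 0 := by
    simp only [circPt_pow, ← fourier_add, integral_fourier, ← sub_eq_add_neg, sub_eq_zero,
      Nat.cast_inj]
  simp only [h2, mul_ite, mul_zero] at h1
  rw [← h1.tsum_eq, tsum_ite_eq, mul_comm]

lemma integral_circPt_pow_mul_conj (B : Circ → ℂ) (n : ℕ) :
    ∫ θ, circPt θ ^ n * conj (B θ) = conj (∫ θ, B θ * fourier (-n : ℤ) θ) := by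
  rw [← integral_conj]
  simp only [map_mul, fourier_neg, Complex.conj_conj, circPt_pow, mul_comm]

/-- Parseval's identity for absolutely convergent power series. -/
lemma hasSum_integral_mul_conj {a b : ℕ → ℂ} (ha : Summable fun n => ‖a n‖)
    (hb : Summable fun n => ‖b n‖) {A B : Circ → ℂ}
    (hA : ∀ θ, HasSum (fun n => a n * circPt θ ^ n) (A θ))
    (hB : ∀ θ, HasSum (fun n => b n * circPt θ ^ n) (B θ)) (hBc : Continuous B) :
    HasSum (fun n => 2 * π * (a n * conj (b n))) (∫ θ, A θ * conj (B θ)) := by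
  convert hasSum_integral_mul ha hA (k := fun θ => conj (B θ))
    (integrable_of_continuous (by fun_prop)) using 2 with n
  rw [integral_circPt_pow_mul_conj, integral_mul_fourier_neg hb hB]
  simp only [map_mul, Complex.conj_ofReal, map_ofNat]
  ring

/-- Power series expansions of a function holomorphic near the closed disc and of its
derivative. -/
lemma exists_coeff {R : ℝ} (hR : 1 < R) {f : ℂ → ℂ} (hf : DifferentiableOn ℂ f (ball 0 R)) :
    ∃ a : ℕ → ℂ, Summable (fun n : ℕ => (n : ℝ) ^ 2 * ‖a n‖) ∧ Summable (fun n => ‖a n‖) ∧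
      (∀ z, ‖z‖ ≤ 1 → HasSum (fun n => a n * z ^ n) (f z)) ∧
      (∀ z, ‖z‖ ≤ 1 → HasSum (fun n => n * a n * z ^ n) (z * deriv f z)) ∧ a 0 = f 0 := by
  obtain ⟨ρ, hρ1, hρR⟩ := exists_between hR
  have hρ0 : 0 < ρ := by linarith
  let a : ℕ → ℂ := fun n => (n.factorial : ℂ)⁻¹ * iteratedDeriv n f 0
  have hs (z : ℂ) (hz : ‖z‖ < R) : HasSum (fun n => a n * z ^ n) (f z) := by
    have := Complex.hasSum_taylorSeries_on_ball hf (z := z) (by simpa using hz)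
    convert! this using 2 with n
    simp [a]; ring
  have hbd : ∃ C, ∀ n, ‖a n‖ * ρ ^ n ≤ C := by
    have h1 := (hs ρ (by simpa [abs_of_pos hρ0] using hρR)).summable.norm.tendsto_atTop_zero
    obtain ⟨C, hC⟩ := h1.bddAbove_range
    refine ⟨C, fun n => ?_⟩
    have := hC ⟨n, rfl⟩
    simpa [abs_of_pos hρ0] using this
  obtain ⟨C, hC⟩ := hbd
  have hle (n : ℕ) : ‖a n‖ ≤ C * (ρ⁻¹) ^ n := by
    rw [inv_pow, ← div_eq_mul_inv, le_div_iff₀ (by positivity)]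
    exact hC n
  have hρi : ‖ρ⁻¹‖ < 1 := by
    rw [norm_inv, Real.norm_of_nonneg hρ0.le]; exact inv_lt_one_of_one_lt₀ hρ1
  refine ⟨a, ?_, ?_, fun z hz => hs z (by linarith), fun z hz => ?_, by simp [a]⟩
  · refine Summable.of_nonneg_of_le (fun n => by positivity) (fun n => ?_)
      ((summable_pow_mul_geometric_of_norm_lt_one 2 hρi).mul_left C)
    calc (n : ℝ) ^ 2 * ‖a n‖ ≤ (n : ℝ) ^ 2 * (C * (ρ⁻¹) ^ n) := by gcongr; exact hle n
      _ = _ := by ring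
  · exact Summable.of_nonneg_of_le (fun n => by positivity) hle
      ((summable_geometric_of_norm_lt_one hρi).mul_left C)
  · have hd := Complex.hasSum_taylorSeries_on_ball (hf.deriv isOpen_ball) (z := z)
      (by simpa using hz.trans_lt hR)
    rw [← hasSum_nat_add_iff' 1]
    simp only [Finset.range_one, Finset.sum_singleton, Nat.cast_zero, zero_mul, sub_zero]
    convert! hd.mul_left z using 2 with n
    simp only [a, iteratedDeriv_succ', sub_zero, smul_eq_mul, Nat.factorial_succ, Nat.cast_mul,
      pow_succ]
    have : ((n + 1 : ℕ) : ℂ) ≠ 0 := Nat.cast_ne_zero.2 n.succ_ne_zero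
    field_simp

lemma integrable_of_hasSum {α : Type*} [MeasurableSpace α] {μ : Measure α} {F : ℕ → α → ℂ}
    {G : α → ℂ} (hF : ∀ n, Integrable (F n) μ) (hs : Summable fun n => ∫ x, ‖F n x‖ ∂μ)
    (hG : ∀ᵐ x ∂μ, HasSum (fun n => F n x) (G x)) : Integrable G μ := by
  refine ⟨aestronglyMeasurable_of_tendsto_ae atTop
    (f := fun N x => ∑ i ∈ Finset.range N, F i x)
    (fun N => (integrable_finsetSum _ fun i _ => hF i).aestronglyMeasurable)
    (hG.mono fun x hx => hx.tendsto_sum_nat), ?_⟩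
  calc ∫⁻ x, ‖G x‖ₑ ∂μ ≤ ∫⁻ x, ∑' n, ‖F n x‖ₑ ∂μ :=
        lintegral_mono_ae (hG.mono fun x hx => hx.tsum_eq ▸ enorm_tsum_le_tsum_enorm)
    _ = ∑' n, ∫⁻ x, ‖F n x‖ₑ ∂μ := lintegral_tsum fun n => (hF n).1.enorm
    _ = ∑' n, ENNReal.ofReal (∫ x, ‖F n x‖ ∂μ) := by
        simp only [ofReal_integral_norm_eq_lintegral_enorm (hF _)]
    _ = ENNReal.ofReal (∑' n, ∫ x, ‖F n x‖ ∂μ) :=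
        (ENNReal.ofReal_tsum_of_nonneg (fun n => by positivity) hs).symm
    _ < ⊤ := ENNReal.ofReal_lt_top

/-- The radial weight `4 n² t e^{-2nt}`, whose integral over `(0, ∞)` is `1` for `n ≠ 0`. -/
def radialWeight (n : ℕ) (t : ℝ) : ℝ := 4 * n ^ 2 * (t * Real.exp (-(2 * n * t)))

lemma integral_radialWeight (n : ℕ) :
    ∫ t in Ioi (0 : ℝ), radialWeight n t = if n = 0 then 0 else 1 := by
  unfold radialWeight
  split_ifs with hn
  · simp [hn]
  · have hn' : (0 : ℝ) < n := by positivity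
    have h := Real.integral_rpow_mul_exp_neg_mul_Ioi (a := 2) (r := 2 * n) two_pos (by positivity)
    norm_num at h
    rw [integral_const_mul, h]
    field_simp
    norm_num

lemma integrableOn_radialWeight (n : ℕ) : IntegrableOn (radialWeight n) (Ioi 0) := by
  by_cases hn : n = 0
  · have : radialWeight n = 0 := by ext; simp [radialWeight, hn]
    rw [this]
    exact integrableOn_zero
  · refine Integrable.of_integral_ne_zero ?_
    rw [integral_radialWeight]
    simp [hn]

lemma radialWeight_nonneg (n : ℕ) {t : ℝ} (ht : 0 ≤ t) : 0 ≤ radialWeight n t := by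
  unfold radialWeight
  positivity

/-- The Euler derivative `z f'(z)`. -/
def eulerDeriv (f : ℂ → ℂ) (z : ℂ) : ℂ := z * deriv f z

lemma continuousOn_eulerDeriv {R : ℝ} {f : ℂ → ℂ} (hf : DifferentiableOn ℂ f (ball 0 R)) :
    ContinuousOn (eulerDeriv f) (ball 0 R) :=
  continuousOn_id.mul (hf.deriv isOpen_ball).continuousOn

lemma exp_neg_mul_circPt_norm {t : ℝ} (ht : 0 ≤ t) (θ : Circ) :
    ‖(Real.exp (-t) : ℂ) * circPt θ‖ ≤ 1 := by
  rw [norm_mul, norm_circPt, mul_one, Complex.norm_real, Real.norm_of_nonneg (by positivity)]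
  simpa using ht

lemma continuous_comp_mul_circPt {R : ℝ} (hR : 1 < R) {F : ℂ → ℂ}
    (hF : ContinuousOn F (ball 0 R)) {t : ℝ} (ht : 0 ≤ t) :
    Continuous fun θ => F ((Real.exp (-t) : ℂ) * circPt θ) := by
  refine hF.comp_continuous (continuous_const.mul continuous_circPt) fun θ => ?_
  simpa using (exp_neg_mul_circPt_norm ht θ).trans_lt hR

lemma continuous_comp_circPt {R : ℝ} (hR : 1 < R) {F : ℂ → ℂ}
    (hF : ContinuousOn F (ball 0 R)) : Continuous fun θ => F (circPt θ) := by
  simpa using continuous_comp_mul_circPt hR hF le_rfl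

/-- The integral of `D A · conj (D B)` over the circle of radius `e^{-t}`. -/
def energyPairing (A B : ℂ → ℂ) (t : ℝ) : ℂ :=
  ∫ θ, eulerDeriv A ((Real.exp (-t) : ℂ) * circPt θ) *
    conj (eulerDeriv B ((Real.exp (-t) : ℂ) * circPt θ))

/-- The Littlewood-Paley identity. -/
lemma littlewoodPaley {R : ℝ} (hR : 1 < R) {A B : ℂ → ℂ} (hA : DifferentiableOn ℂ A (ball 0 R))
    (hB : DifferentiableOn ℂ B (ball 0 R)) :
    IntegrableOn (fun t : ℝ => 4 * t * energyPairing A B t) (Ioi 0) ∧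
    ∫ t : ℝ in Ioi 0, 4 * t * energyPairing A B t =
      (∫ θ, A (circPt θ) * conj (B (circPt θ))) - 2 * π * (A 0 * conj (B 0)) := by
  obtain ⟨a, ha2, ha, hAs, hDA, ha0⟩ := exists_coeff hR hA
  obtain ⟨b, hb2, hb, hBs, hDB, hb0⟩ := exists_coeff hR hB
  have hsq {c : ℕ → ℂ} (hc : Summable fun n : ℕ => (n : ℝ) ^ 2 * ‖c n‖) {s : ℝ} (hs : 0 ≤ s)
      (hs1 : s ≤ 1) : Summable fun n : ℕ => ‖n * c n * (s : ℂ) ^ n‖ := by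
    refine Summable.of_nonneg_of_le (fun n => by positivity) (fun n => ?_) hc
    rw [norm_mul, norm_mul, norm_pow, Complex.norm_natCast, Complex.norm_real,
      Real.norm_of_nonneg hs]
    calc (n : ℝ) * ‖c n‖ * s ^ n ≤ n * ‖c n‖ * 1 := by gcongr; exact pow_le_one₀ hs hs1
      _ ≤ (n : ℝ) ^ 2 * ‖c n‖ := by
        rw [mul_one]; gcongr; exact_mod_cast Nat.le_self_pow two_ne_zero n
  have hc : HasSum (fun n => 2 * π * (a n * conj (b n))) (∫ θ, A (circPt θ) * conj (B (circPt θ))) :=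
    hasSum_integral_mul_conj ha hb (fun θ => hAs _ (norm_circPt θ).le)
      (fun θ => hBs _ (norm_circPt θ).le) (continuous_comp_circPt hR hB.continuousOn)
  set c : ℕ → ℂ := fun n => 2 * π * (a n * conj (b n)) with hcdef
  have hJ : ∀ t : ℝ, 0 ≤ t →
      HasSum (fun n => c n * radialWeight n t) (4 * t * energyPairing A B t) := by
    intro t ht
    have hexp : Real.exp (-t) ≤ 1 := by simpa using ht
    have := (hasSum_integral_mul_conj (hsq ha2 (Real.exp_pos (-t)).le hexp)
      (hsq hb2 (Real.exp_pos (-t)).le hexp)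
      (A := fun θ => eulerDeriv A ((Real.exp (-t) : ℂ) * circPt θ))
      (B := fun θ => eulerDeriv B ((Real.exp (-t) : ℂ) * circPt θ))
      (fun θ => by simpa [eulerDeriv, mul_pow, mul_assoc] using hDA _ (exp_neg_mul_circPt_norm ht θ))
      (fun θ => by simpa [eulerDeriv, mul_pow, mul_assoc] using hDB _ (exp_neg_mul_circPt_norm ht θ))
      (continuous_comp_mul_circPt hR (continuousOn_eulerDeriv hB) ht)).mul_left (4 * (t : ℂ))
    convert! this using 2 with n
    have h2 : Real.exp (-(2 * n * t)) = Real.exp (-t) ^ n * Real.exp (-t) ^ n := by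
      rw [← Real.exp_nat_mul, ← Real.exp_add]; congr 1; ring
    simp only [hcdef, radialWeight, h2, map_mul, map_pow, Complex.conj_ofReal, map_natCast]
    push_cast
    ring
  have hint (n : ℕ) : Integrable (fun t => c n * radialWeight n t) (volume.restrict (Ioi 0)) :=
    (integrableOn_radialWeight n).ofReal.const_mul _
  have hnorm (n : ℕ) : ∫ t in Ioi (0 : ℝ), ‖c n * radialWeight n t‖ =
      ‖c n‖ * if n = 0 then 0 else 1 := by
    rw [← integral_radialWeight, ← integral_const_mul]
    refine setIntegral_congr_fun measurableSet_Ioi fun t ht => ?_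
    simp [abs_of_nonneg (radialWeight_nonneg n (le_of_lt ht))]
  have hsum : Summable fun n => ∫ t in Ioi (0 : ℝ), ‖c n * radialWeight n t‖ := by
    simp only [hnorm]
    refine Summable.of_nonneg_of_le (fun n => by positivity) (fun n => ?_) hc.summable.norm
    split_ifs <;> simp
  have hae : ∀ᵐ t ∂volume.restrict (Ioi (0 : ℝ)),
      HasSum (fun n => c n * radialWeight n t) (4 * t * energyPairing A B t) :=
    (ae_restrict_iff' measurableSet_Ioi).2 (Eventually.of_forall fun t ht => hJ t (le_of_lt ht))
  refine ⟨integrable_of_hasSum hint hsum hae, ?_⟩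
  have h1 := hasSum_integral_of_summable_integral_norm hint hsum
  have h2 : ∫ t in Ioi (0 : ℝ), ∑' n, c n * radialWeight n t =
      ∫ t : ℝ in Ioi 0, 4 * t * energyPairing A B t :=
    integral_congr_ae (hae.mono fun t ht => ht.tsum_eq)
  rw [h2] at h1
  have h3 := hc.sub h1
  have h4 : ∀ n, c n - ∫ t in Ioi (0 : ℝ), c n * (radialWeight n t : ℂ) =
      if n = 0 then c 0 else 0 := by
    intro n
    rw [integral_const_mul, integral_complex_ofReal, integral_radialWeight]
    split_ifs with hn <;> simp [hn]
  simp only [h4] at h3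
  have h5 := h3.unique (hasSum_ite_eq 0 (c 0))
  rw [← ha0, ← hb0]
  linear_combination -h5

lemma integral_linear_combination {α : Type*} [MeasurableSpace α] {μ : Measure α}
    {F₁ F₂ F₃ F₄ : α → ℝ} (h₁ : Integrable F₁ μ) (h₂ : Integrable F₂ μ) (h₃ : Integrable F₃ μ)
    (h₄ : Integrable F₄ μ) :
    Integrable (fun x => F₁ x + F₂ x + 3 / 2 * F₃ x + 3 / 2 * F₄ x) μ ∧
    ∫ x, F₁ x + F₂ x + 3 / 2 * F₃ x + 3 / 2 * F₄ x ∂μ =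
      (∫ x, F₁ x ∂μ) + (∫ x, F₂ x ∂μ) + 3 / 2 * (∫ x, F₃ x ∂μ) + 3 / 2 * ∫ x, F₄ x ∂μ := by
  have h12 : Integrable (fun x => F₁ x + F₂ x) μ := h₁.add h₂
  have h123 : Integrable (fun x => F₁ x + F₂ x + 3 / 2 * F₃ x) μ := h12.add (h₃.const_mul _)
  refine ⟨h123.add (h₄.const_mul _), ?_⟩
  rw [integral_add h123 (h₄.const_mul _), integral_add h12 (h₃.const_mul _), integral_add h₁ h₂,
    integral_const_mul, integral_const_mul]

/-- The integral of `|D A|²` over the circle of radius `e^{-t}`. -/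
def energy (A : ℂ → ℂ) (t : ℝ) : ℝ :=
  ∫ θ, ‖eulerDeriv A ((Real.exp (-t) : ℂ) * circPt θ)‖ ^ 2

lemma energyPairing_self (A : ℂ → ℂ) (t : ℝ) : energyPairing A A t = energy A t := by
  simp only [energyPairing, energy, Complex.mul_conj']
  rw [← integral_complex_ofReal]
  simp

lemma energy_bound {R : ℝ} (hR : 1 < R) {A : ℂ → ℂ} (hA : DifferentiableOn ℂ A (ball 0 R)) :
    IntegrableOn (fun t : ℝ => 4 * t * energy A t) (Ioi 0) ∧
    ∫ t : ℝ in Ioi 0, 4 * t * energy A t ≤ ∫ θ, ‖A (circPt θ)‖ ^ 2 := by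
  obtain ⟨h1, h2⟩ := littlewoodPaley hR hA hA
  simp only [energyPairing_self, Complex.mul_conj'] at h1 h2
  have h3 : IntegrableOn (fun t : ℝ => 4 * t * energy A t) (Ioi 0) := by
    simpa [IntegrableOn] using h1.re
  refine ⟨h3, ?_⟩
  have h4 : ((∫ t : ℝ in Ioi 0, 4 * t * energy A t : ℝ) : ℂ) =
      (((∫ θ, ‖A (circPt θ)‖ ^ 2) - 2 * π * ‖A 0‖ ^ 2 : ℝ) : ℂ) := by
    push_cast [← integral_complex_ofReal]
    exact h2
  rw [Complex.ofReal_injective h4]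
  have : 0 ≤ 2 * π * ‖A 0‖ ^ 2 := by positivity
  linarith

lemma eulerDeriv_mul {f g : ℂ → ℂ} {z : ℂ} (hf : DifferentiableAt ℂ f z)
    (hg : DifferentiableAt ℂ g z) :
    eulerDeriv (fun x => f x * g x) z = eulerDeriv f z * g z + f z * eulerDeriv g z := by
  simp only [eulerDeriv, deriv_fun_mul hf hg]
  ring

lemma norm_eulerDeriv_mul_sq_le {f p : ℂ → ℂ} {z : ℂ} (hf : DifferentiableAt ℂ f z)
    (hp : DifferentiableAt ℂ p z) (hf1 : ‖f z‖ ≤ 1) :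
    (‖eulerDeriv f z‖ * ‖p z‖) ^ 2 ≤
      2 * ‖eulerDeriv (fun x => f x * p x) z‖ ^ 2 + 2 * ‖eulerDeriv p z‖ ^ 2 := by
  have h1 : eulerDeriv f z * p z = eulerDeriv (fun x => f x * p x) z - f z * eulerDeriv p z := by
    rw [eulerDeriv_mul hf hp]; ring
  have h2 : ‖eulerDeriv f z‖ * ‖p z‖ ≤
      ‖eulerDeriv (fun x => f x * p x) z‖ + ‖eulerDeriv p z‖ := by
    rw [← norm_mul, h1]
    refine (norm_sub_le _ _).trans (add_le_add_right ?_ _)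
    rw [norm_mul]
    exact mul_le_of_le_one_left (norm_nonneg _) hf1
  calc _ ≤ (‖eulerDeriv (fun x => f x * p x) z‖ + ‖eulerDeriv p z‖) ^ 2 := by gcongr
    _ ≤ _ := by
      nlinarith [sq_nonneg (‖eulerDeriv (fun x => f x * p x) z‖ - ‖eulerDeriv p z‖)]

lemma norm_integral_mul_conj_le {R : ℝ} (hR : 1 < R) {f g u p q : ℂ → ℂ}
    (hf : DifferentiableOn ℂ f (ball 0 R)) (hp : DifferentiableOn ℂ p (ball 0 R))
    (hq : DifferentiableOn ℂ q (ball 0 R)) (hu0 : u 0 = 0)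
    (hu : ∀ z ∈ ball (0 : ℂ) R, HasDerivAt u (deriv f z * g z) z)
    (hf1 : ∀ z, ‖z‖ ≤ 1 → ‖f z‖ ≤ 1) (hg1 : ∀ z, ‖z‖ ≤ 1 → ‖g z‖ ≤ 1) :
    ‖∫ θ, u (circPt θ) * conj (p (circPt θ) * q (circPt θ))‖ ≤
      5 / 2 * ((∫ θ, ‖p (circPt θ)‖ ^ 2) + ∫ θ, ‖q (circPt θ)‖ ^ 2) := by
  have hud : DifferentiableOn ℂ u (ball 0 R) := fun z hz =>
    (hu z hz).differentiableAt.differentiableWithinAt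
  obtain ⟨-, hLP⟩ := littlewoodPaley hR hud (hp.mul hq)
  simp only [Pi.mul_apply, hu0, zero_mul, mul_zero, sub_zero] at hLP
  rw [← hLP]
  have hfp : DifferentiableOn ℂ (fun z => f z * p z) (ball 0 R) := hf.mul hp
  have hfq : DifferentiableOn ℂ (fun z => f z * q z) (ball 0 R) := hf.mul hq
  obtain ⟨ip, bp⟩ := energy_bound hR hp
  obtain ⟨iq, bq⟩ := energy_bound hR hq
  obtain ⟨ifp, bfp⟩ := energy_bound hR hfp
  obtain ⟨ifq, bfq⟩ := energy_bound hR hfq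
  have hmulle {v : ℂ → ℂ} (hv : DifferentiableOn ℂ v (ball 0 R)) :
      ∫ θ, ‖f (circPt θ) * v (circPt θ)‖ ^ 2 ≤ ∫ θ, ‖v (circPt θ)‖ ^ 2 := by
    have c1 := continuous_comp_circPt hR hf.continuousOn
    have c2 := continuous_comp_circPt hR hv.continuousOn
    refine integral_mono (integrable_of_continuous ((c1.mul c2).norm.pow 2))
      (integrable_of_continuous (c2.norm.pow 2)) fun θ => ?_
    simp only [norm_mul]
    gcongr
    exact mul_le_of_le_one_left (norm_nonneg _) (hf1 _ (norm_circPt θ).le)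
  have key : ∀ t : ℝ, 0 < t → ‖energyPairing u (p * q) t‖ ≤
      energy (fun z => f z * p z) t + energy (fun z => f z * q z) t +
        3 / 2 * energy p t + 3 / 2 * energy q t := by
    intro t ht
    have hi {v : ℂ → ℂ} (hv : DifferentiableOn ℂ v (ball 0 R)) :
        Integrable fun θ => ‖eulerDeriv v ((Real.exp (-t) : ℂ) * circPt θ)‖ ^ 2 :=
      integrable_of_continuous
        ((continuous_comp_mul_circPt hR (continuousOn_eulerDeriv hv) ht.le).norm.pow 2)
    unfold energy energyPairing
    obtain ⟨hint, heq⟩ := integral_linear_combination (hi hfp) (hi hfq) (hi hp) (hi hq)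
    rw [← heq]
    refine norm_integral_le_of_norm_le hint
      (Eventually.of_forall fun θ => ?_)
    have hz1 := exp_neg_mul_circPt_norm ht.le θ
    set z : ℂ := (Real.exp (-t) : ℂ) * circPt θ
    have hz : z ∈ ball (0 : ℂ) R := by simpa using hz1.trans_lt hR
    have hfz := hf.differentiableAt (isOpen_ball.mem_nhds hz)
    have hpz := hp.differentiableAt (isOpen_ball.mem_nhds hz)
    have hqz := hq.differentiableAt (isOpen_ball.mem_nhds hz)
    have e1 : ‖eulerDeriv u z‖ ≤ ‖eulerDeriv f z‖ := by
      simp only [eulerDeriv, (hu z hz).deriv, norm_mul, ← mul_assoc]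
      exact mul_le_of_le_one_right (by positivity) (hg1 z hz1)
    have e2 : ‖eulerDeriv (p * q) z‖ ≤ ‖eulerDeriv p z‖ * ‖q z‖ + ‖p z‖ * ‖eulerDeriv q z‖ := by
      rw [← norm_mul, ← norm_mul]
      exact (eulerDeriv_mul hpz hqz) ▸ norm_add_le _ _
    have e3 := norm_eulerDeriv_mul_sq_le hfz hpz (hf1 z hz1)
    have e4 := norm_eulerDeriv_mul_sq_le hfz hqz (hf1 z hz1)
    rw [norm_mul, RCLike.norm_conj]
    calc ‖eulerDeriv u z‖ * ‖eulerDeriv (p * q) z‖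
        ≤ ‖eulerDeriv f z‖ * (‖eulerDeriv p z‖ * ‖q z‖ + ‖p z‖ * ‖eulerDeriv q z‖) := by
          gcongr
      _ ≤ _ := by
          nlinarith [sq_nonneg (‖eulerDeriv f z‖ * ‖q z‖ - ‖eulerDeriv p z‖),
            sq_nonneg (‖eulerDeriv f z‖ * ‖p z‖ - ‖eulerDeriv q z‖)]
  obtain ⟨hint, heq⟩ := integral_linear_combination ifp ifq ip iq
  calc ‖∫ t : ℝ in Ioi 0, 4 * t * energyPairing u (p * q) t‖
      ≤ ∫ t : ℝ in Ioi 0, (4 * t * energy (fun z => f z * p z) t +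
          4 * t * energy (fun z => f z * q z) t + 3 / 2 * (4 * t * energy p t) +
          3 / 2 * (4 * t * energy q t)) := by
        refine norm_integral_le_of_norm_le hint ?_
        refine (ae_restrict_iff' measurableSet_Ioi).2 (Eventually.of_forall fun t ht => ?_)
        have ht' : (0 : ℝ) < t := ht
        rw [norm_mul, norm_mul, Complex.norm_real, Real.norm_of_nonneg ht'.le]
        norm_num
        have := mul_le_mul_of_nonneg_left (key t ht') (by positivity : 0 ≤ 4 * t)
        linarith
    _ = (∫ t : ℝ in Ioi 0, 4 * t * energy (fun z => f z * p z) t) +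
          (∫ t : ℝ in Ioi 0, 4 * t * energy (fun z => f z * q z) t) +
          3 / 2 * (∫ t : ℝ in Ioi 0, 4 * t * energy p t) +
          3 / 2 * (∫ t : ℝ in Ioi 0, 4 * t * energy q t) := heq
    _ ≤ _ := by
        have := hmulle hp
        have := hmulle hq
        linarith

/-- `P` factors on the unit circle as a product of two functions holomorphic near the closed disc
which have equal moduli on the circle. -/
def IsBalanced (P : ℂ → ℂ) : Prop :=
  ∃ R : ℝ, 1 < R ∧ ∃ p q : ℂ → ℂ, DifferentiableOn ℂ p (ball 0 R) ∧
    DifferentiableOn ℂ q (ball 0 R) ∧ ∀ z, ‖z‖ = 1 →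
      P z = p z * q z ∧ ‖p z‖ ^ 2 = ‖P z‖ ∧ ‖q z‖ ^ 2 = ‖P z‖

lemma IsBalanced.mul {P Q : ℂ → ℂ} (hP : IsBalanced P) (hQ : IsBalanced Q) :
    IsBalanced (fun z => P z * Q z) := by
  obtain ⟨R, hR, p, q, hp, hq, h⟩ := hP
  obtain ⟨R', hR', p', q', hp', hq', h'⟩ := hQ
  have s1 : ball (0 : ℂ) (min R R') ⊆ ball 0 R := ball_subset_ball (min_le_left _ _)
  have s2 : ball (0 : ℂ) (min R R') ⊆ ball 0 R' := ball_subset_ball (min_le_right _ _)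
  refine ⟨min R R', lt_min hR hR', fun z => p z * p' z, fun z => q z * q' z,
    (hp.mono s1).mul (hp'.mono s2), (hq.mono s1).mul (hq'.mono s2), fun z hz => ?_⟩
  obtain ⟨h1, h2, h3⟩ := h z hz
  obtain ⟨h1', h2', h3'⟩ := h' z hz
  refine ⟨by beta_reduce; rw [h1, h1']; ring, ?_, ?_⟩
  · rw [norm_mul, mul_pow, h2, h2', norm_mul]
  · rw [norm_mul, mul_pow, h3, h3', norm_mul]

lemma sqrt_mul_self (x : ℂ) : x ^ (2⁻¹ : ℂ) * x ^ (2⁻¹ : ℂ) = x := by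
  simpa [sq] using Complex.cpow_nat_inv_pow x two_ne_zero

lemma norm_sqrt_sq (x : ℂ) : ‖x ^ (2⁻¹ : ℂ)‖ ^ 2 = ‖x‖ := by
  rw [← norm_pow, sq, sqrt_mul_self]

lemma isBalanced_const (c : ℂ) : IsBalanced (fun _ => c) :=
  ⟨2, one_lt_two, fun _ => c ^ (2⁻¹ : ℂ), fun _ => c ^ (2⁻¹ : ℂ), by fun_prop, by fun_prop,
    fun _ _ => ⟨(sqrt_mul_self c).symm, norm_sqrt_sq c, norm_sqrt_sq c⟩⟩

lemma one_sub_mem_slitPlane {w : ℂ} (hw : ‖w‖ < 1) : 1 - w ∈ Complex.slitPlane := by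
  left
  have := (Complex.re_le_norm w).trans_lt hw
  simp only [Complex.sub_re, Complex.one_re]
  linarith

lemma differentiableOn_sqrt_one_sub {R : ℝ} {b : ℂ} (hb : ∀ z ∈ ball (0 : ℂ) R, ‖b * z‖ < 1) :
    DifferentiableOn ℂ (fun z => (1 - b * z) ^ (2⁻¹ : ℂ)) (ball 0 R) := fun z hz =>
  (DifferentiableAt.cpow_const (f := fun z => 1 - b * z) (by fun_prop)
    (one_sub_mem_slitPlane (hb z hz))).differentiableWithinAt

lemma isBalanced_linear {a : ℂ} (ha : ‖a‖ ≠ 1) : IsBalanced (fun z => z - a) := by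
  rcases ha.lt_or_gt with ha | ha
  · have hR : 1 < 2 / (1 + ‖a‖) := by
      rw [lt_div_iff₀ (by positivity)]; linarith
    have hb : ∀ z ∈ ball (0 : ℂ) (2 / (1 + ‖a‖)), ‖conj a * z‖ < 1 := by
      intro z hz
      rw [mem_ball_zero_iff, lt_div_iff₀ (by positivity)] at hz
      rw [norm_mul, RCLike.norm_conj]
      by_contra! h
      nlinarith [norm_nonneg a, norm_nonneg z]
    have hd := differentiableOn_sqrt_one_sub hb
    have hne : ∀ z ∈ ball (0 : ℂ) (2 / (1 + ‖a‖)), (1 - conj a * z) ^ (2⁻¹ : ℂ) ≠ 0 := by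
      intro z hz h0
      refine Complex.slitPlane_ne_zero (one_sub_mem_slitPlane (hb z hz)) ?_
      rw [← sqrt_mul_self (1 - conj a * z), h0, zero_mul]
    refine ⟨_, hR, fun z => (z - a) / (1 - conj a * z) ^ (2⁻¹ : ℂ),
      fun z => (1 - conj a * z) ^ (2⁻¹ : ℂ),
      (by fun_prop : DifferentiableOn ℂ (fun z => z - a) _).div hd hne, hd, fun z hz => ?_⟩
    have hne' := hne z (by simpa [hz] using hR)
    have hn : ‖1 - conj a * z‖ = ‖z - a‖ := by
      have h1 : z * conj z = 1 := by rw [Complex.mul_conj', hz]; simp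
      have h2 : z - a = z * conj (1 - conj a * z) := by
        simp only [map_sub, map_one, map_mul, Complex.conj_conj]
        linear_combination a * h1
      rw [h2, norm_mul, hz, one_mul, RCLike.norm_conj]
    refine ⟨(div_mul_cancel₀ _ hne').symm, ?_, ?_⟩
    · rw [norm_div, div_pow, norm_sqrt_sq, hn]
      have : ‖z - a‖ ≠ 0 := by
        rw [← hn, ← norm_sqrt_sq]
        exact pow_ne_zero _ (norm_ne_zero_iff.2 hne')
      field_simp
    · rw [norm_sqrt_sq, hn]
  · have ha0 : a ≠ 0 := norm_pos_iff.1 (zero_lt_one.trans ha)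
    have hb : ∀ z ∈ ball (0 : ℂ) ‖a‖, ‖a⁻¹ * z‖ < 1 := by
      intro z hz
      rw [norm_mul, norm_inv, inv_mul_lt_one₀ (by positivity)]
      simpa using hz
    have hd := (differentiableOn_sqrt_one_sub hb).const_mul ((-a) ^ (2⁻¹ : ℂ))
    have hsq (z : ℂ) : (-a) ^ (2⁻¹ : ℂ) * (1 - a⁻¹ * z) ^ (2⁻¹ : ℂ) *
        ((-a) ^ (2⁻¹ : ℂ) * (1 - a⁻¹ * z) ^ (2⁻¹ : ℂ)) = z - a := by
      rw [mul_mul_mul_comm, sqrt_mul_self, sqrt_mul_self]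
      field_simp
      ring
    exact ⟨_, ha, _, _, hd, hd, fun z _ => ⟨(hsq z).symm, by rw [← norm_pow, sq, hsq],
      by rw [← norm_pow, sq, hsq]⟩⟩

lemma isBalanced_polynomial {P : Polynomial ℂ} (hP : ∀ z, ‖z‖ = 1 → P.eval z ≠ 0) :
    IsBalanced (fun z => P.eval z) := by
  have hm : ∀ m : Multiset ℂ, (∀ a ∈ m, ‖a‖ ≠ 1) →
      IsBalanced (fun z => (m.map (fun a => z - a)).prod) := by
    intro m
    induction m using Multiset.induction_on with
    | empty => exact fun _ => by simpa using isBalanced_const 1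
    | cons a m ih =>
      intro h
      simp only [Multiset.map_cons, Multiset.prod_cons]
      exact (isBalanced_linear (h a (Multiset.mem_cons_self a m))).mul
        (ih fun b hb => h b (Multiset.mem_cons_of_mem hb))
  have h := (isBalanced_const P.leadingCoeff).mul
    (hm P.roots fun a ha h1 => hP a h1 (Polynomial.isRoot_of_mem_roots ha))
  convert h using 2 with z
  conv_lhs => rw [(IsAlgClosed.splits P).eq_prod_roots]
  rw [Polynomial.eval_mul, Polynomial.eval_C, Polynomial.eval_multiset_prod, Multiset.map_map]
  simp

lemma norm_integral_mul_conj_polynomial_le {R : ℝ} (hR : 1 < R) {f g u : ℂ → ℂ}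
    (hf : DifferentiableOn ℂ f (ball 0 R)) (hu0 : u 0 = 0)
    (hu : ∀ z ∈ ball (0 : ℂ) R, HasDerivAt u (deriv f z * g z) z)
    (hf1 : ∀ z, ‖z‖ ≤ 1 → ‖f z‖ ≤ 1) (hg1 : ∀ z, ‖z‖ ≤ 1 → ‖g z‖ ≤ 1) (P : Polynomial ℂ) :
    ‖∫ θ, u (circPt θ) * conj (P.eval (circPt θ))‖ ≤ 5 * ∫ θ, ‖P.eval (circPt θ)‖ := by
  have main : ∀ Q : Polynomial ℂ, (∀ z, ‖z‖ = 1 → Q.eval z ≠ 0) →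
      ‖∫ θ, u (circPt θ) * conj (Q.eval (circPt θ))‖ ≤ 5 * ∫ θ, ‖Q.eval (circPt θ)‖ := by
    intro Q hQ
    obtain ⟨R', hR', p, q, hp, hq, h⟩ := isBalanced_polynomial hQ
    have s1 : ball (0 : ℂ) (min R R') ⊆ ball 0 R := ball_subset_ball (min_le_left _ _)
    have s2 : ball (0 : ℂ) (min R R') ⊆ ball 0 R' := ball_subset_ball (min_le_right _ _)
    have := norm_integral_mul_conj_le (lt_min hR hR') (hf.mono s1) (hp.mono s2) (hq.mono s2) hu0
      (fun z hz => hu z (s1 hz)) hf1 hg1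
    simp only [(h _ (norm_circPt _)).2.1, (h _ (norm_circPt _)).2.2,
      ← (h _ (norm_circPt _)).1] at this
    linarith
  rcases eq_or_ne P 0 with rfl | hP0
  · simp
  have hucont : Continuous fun θ => u (circPt θ) := continuous_comp_circPt hR
    fun z hz => (hu z hz).continuousAt.continuousWithinAt
  have hc1 : Continuous fun s : ℝ => ∫ θ, u (circPt θ) * conj (P.eval (s * circPt θ)) := by
    have := continuous_circPt
    simpa using continuous_parametric_integral_of_continuous (μ := (volume : Measure Circ))
      (f := fun (s : ℝ) θ => u (circPt θ) * conj (P.eval (s * circPt θ)))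
      ((hucont.comp continuous_snd).mul (by fun_prop)) isCompact_univ
  have hc2 : Continuous fun s : ℝ => ∫ θ, ‖P.eval (s * circPt θ)‖ := by
    have := continuous_circPt
    simpa using continuous_parametric_integral_of_continuous (μ := (volume : Measure Circ))
      (f := fun (s : ℝ) θ => ‖P.eval (s * circPt θ)‖)
      (by unfold Function.uncurry; fun_prop) isCompact_univ
  have hfin : (((fun z : ℂ => ‖z‖) '' (P.rootSet ℂ)) \ {1}).Finite :=
    ((P.rootSet_finite ℂ).image _).sdiff
  have hev : ∀ᶠ s : ℝ in 𝓝[≠] 1, ‖∫ θ, u (circPt θ) * conj (P.eval (s * circPt θ))‖ ≤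
      5 * ∫ θ, ‖P.eval (s * circPt θ)‖ := by
    have h1 : ∀ᶠ s : ℝ in 𝓝[≠] 1, s ∉ ((fun z : ℂ => ‖z‖) '' (P.rootSet ℂ)) \ {1} :=
      nhdsWithin_le_nhds (hfin.isClosed.isOpen_compl.mem_nhds (by simp))
    have h2 : ∀ᶠ s : ℝ in 𝓝[≠] 1, 0 < s := nhdsWithin_le_nhds (lt_mem_nhds one_pos)
    filter_upwards [h1, h2, self_mem_nhdsWithin] with s hs hs0 hs1
    have := main (P.comp (Polynomial.C (s : ℂ) * Polynomial.X)) fun z hz h0 => by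
      refine hs ⟨⟨s * z, ?_, ?_⟩, hs1⟩
      · rw [Polynomial.mem_rootSet_of_ne hP0]
        simpa using h0
      · simp [hz, abs_of_pos hs0]
    simpa using this
  have := le_of_tendsto_of_tendsto (hc1.norm.tendsto 1 |>.mono_left nhdsWithin_le_nhds)
    ((hc2.const_mul 5).tendsto 1 |>.mono_left nhdsWithin_le_nhds) hev
  simpa using this

/-- The Fourier coefficients of a function on the circle. -/
def coeffC (h : Circ → ℂ) (n : ℤ) : ℂ := (2 * π : ℂ)⁻¹ * ∫ φ, h φ * fourier (-n) φ

/-- The Fejér kernel. -/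
def fejerKernel (N : ℕ) (θ : Circ) : ℝ :=
  (N : ℝ)⁻¹ * ‖∑ k ∈ Finset.range N, (fourier (k : ℤ) θ : ℂ)‖ ^ 2

/-- The analytic part of the Fejér mean of a function on the circle. -/
def fejerPoly (h : Circ → ℂ) (N : ℕ) : Polynomial ℂ :=
  Polynomial.C (N : ℂ)⁻¹ * ∑ j ∈ Finset.range N, ∑ n ∈ Finset.range (j + 1),
    Polynomial.C (coeffC h n) * Polynomial.X ^ n

lemma fejerPoly_eval (h : Circ → ℂ) (N : ℕ) (z : ℂ) : (fejerPoly h N).eval z =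
    (N : ℂ)⁻¹ * ∑ j ∈ Finset.range N, ∑ n ∈ Finset.range (j + 1), coeffC h n * z ^ n := by
  simp [fejerPoly, Polynomial.eval_finsetSum]

lemma fejerKernel_nonneg (N : ℕ) (θ : Circ) : 0 ≤ fejerKernel N θ := by
  unfold fejerKernel
  positivity

lemma continuous_fejerKernel (N : ℕ) : Continuous (fejerKernel N) := by
  have (k : ℕ) : Continuous fun θ : Circ => (fourier (k : ℤ) θ : ℂ) := (fourier (k : ℤ)).continuous
  unfold fejerKernel
  fun_prop

lemma fejerKernel_eq_sum (N : ℕ) (θ : Circ) : (fejerKernel N θ : ℂ) =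
    (N : ℂ)⁻¹ * ∑ j ∈ Finset.range N, ∑ k ∈ Finset.range N, fourier ((j : ℤ) - k) θ := by
  simp only [fejerKernel, Complex.ofReal_mul, Complex.ofReal_inv, Complex.ofReal_natCast,
    Complex.ofReal_pow, ← Complex.mul_conj', map_sum, Finset.sum_mul_sum, ← fourier_neg,
    ← fourier_add, ← sub_eq_add_neg]

lemma integral_fejerKernel_le (N : ℕ) : ∫ θ, fejerKernel N θ ≤ 2 * π := by
  rcases Nat.eq_zero_or_pos N with rfl | hN
  · simp [fejerKernel, Real.pi_nonneg]
  refine le_of_eq (Complex.ofReal_injective ?_)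
  rw [← integral_complex_ofReal]
  simp only [fejerKernel_eq_sum]
  have hint (n : ℤ) : Integrable fun θ : Circ => (fourier n θ : ℂ) :=
    integrable_of_continuous (fourier n).continuous
  rw [integral_const_mul, integral_finsetSum _ fun j _ => integrable_finsetSum _ fun k _ => hint _]
  have hj : ∀ j ∈ Finset.range N, ∫ θ : Circ, ∑ k ∈ Finset.range N, (fourier ((j : ℤ) - k) θ : ℂ) =
      2 * π := by
    intro j hj
    rw [integral_finsetSum _ fun k _ => hint _]
    simp only [integral_fourier, sub_eq_zero, Nat.cast_inj]
    rw [Finset.sum_ite_eq, if_pos hj]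
  rw [Finset.sum_congr rfl hj]
  have : (N : ℂ) ≠ 0 := Nat.cast_ne_zero.2 hN.ne'
  simp [this]

lemma fourier_sub_apply (n : ℤ) (θ φ : Circ) :
    (fourier n (θ - φ) : ℂ) = fourier n θ * fourier (-n) φ := by
  rw [fourier_apply, fourier_apply, fourier_apply, ← Circle.coe_mul, ← AddCircle.toCircle_add,
    smul_sub, neg_smul, sub_eq_add_neg]

lemma fejerPoly_eq_integral {h : Circ → ℂ} (hi : Integrable h)
    (hh : ∀ n : ℤ, n ≤ 0 → ∫ θ, h θ * fourier (-n) θ = 0) (N : ℕ) (θ : Circ) :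
    (fejerPoly h N).eval (circPt θ) =
      (2 * π : ℂ)⁻¹ * ∫ φ, h φ * (fejerKernel N (θ - φ) : ℂ) := by
  have hint (n : ℤ) : Integrable fun φ => h φ * (fourier n θ * fourier (-n) φ : ℂ) := by
    refine hi.mul_bdd (c := 1) (by fun_prop) (Eventually.of_forall fun φ => ?_)
    rw [← fourier_sub_apply]
    exact (Circle.norm_coe _).le
  have h1 : ∫ φ, h φ * (fejerKernel N (θ - φ) : ℂ) = (N : ℂ)⁻¹ * ∑ j ∈ Finset.range N,
      ∑ k ∈ Finset.range N, ∫ φ, h φ * (fourier ((j : ℤ) - k) θ * fourier (-((j : ℤ) - k)) φ) := by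
    have h0 (φ : Circ) : h φ * (fejerKernel N (θ - φ) : ℂ) = (N : ℂ)⁻¹ * ∑ j ∈ Finset.range N,
        ∑ k ∈ Finset.range N, h φ * (fourier ((j : ℤ) - k) θ * fourier (-((j : ℤ) - k)) φ) := by
      rw [fejerKernel_eq_sum, mul_left_comm]
      simp only [fourier_sub_apply, ← Finset.mul_sum]
    simp only [h0]
    rw [integral_const_mul, integral_finsetSum _ fun j _ => integrable_finsetSum _ fun k _ => hint _]
    congr 1
    exact Finset.sum_congr rfl fun j _ => integral_finsetSum _ fun k _ => hint _
  have h2 (n : ℤ) : ∫ φ, h φ * (fourier n θ * fourier (-n) φ : ℂ) =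
      2 * π * (coeffC h n * fourier n θ) := by
    have : (2 * π : ℂ) ≠ 0 := by simp [Real.pi_ne_zero]
    simp only [mul_left_comm (h _), integral_const_mul, coeffC]
    field_simp
  have h3 : ∀ j ∈ Finset.range N, ∑ k ∈ Finset.range N,
      coeffC h ((j : ℤ) - k) * (fourier ((j : ℤ) - k) θ : ℂ) =
      ∑ n ∈ Finset.range (j + 1), coeffC h n * circPt θ ^ n := by
    intro j hj
    rw [← Finset.sum_subset (Finset.range_subset_range.2 (Finset.mem_range.1 hj)),
      ← Finset.sum_range_reflect]
    · refine Finset.sum_congr rfl fun k hk => ?_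
      have hk' : k ≤ j := Nat.lt_succ_iff.1 (Finset.mem_range.1 hk)
      have : ((j : ℤ) - ((j + 1 - 1 - k : ℕ) : ℤ)) = k := by omega
      rw [this, circPt_pow]
    · intro k _ hk
      have : (j : ℤ) - k ≤ 0 := by
        have := Finset.mem_range.not.1 hk
        omega
      rw [coeffC, hh _ this, mul_zero, zero_mul]
  have : (2 * π : ℂ) ≠ 0 := by simp [Real.pi_ne_zero]
  rw [h1, fejerPoly_eval, ← Finset.sum_congr rfl h3]
  simp only [h2, ← Finset.mul_sum]
  field_simp

lemma integral_norm_fejerPoly_le {h : Circ → ℂ} (hi : Integrable h)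
    (hh : ∀ n : ℤ, n ≤ 0 → ∫ θ, h θ * fourier (-n) θ = 0) (N : ℕ) :
    ∫ θ, ‖(fejerPoly h N).eval (circPt θ)‖ ≤ ∫ θ, ‖h θ‖ := by
  obtain ⟨C, hC⟩ := (isCompact_range (continuous_fejerKernel N)).isBounded.exists_norm_le
  have hprod : Integrable (Function.uncurry fun θ φ : Circ => ‖h φ‖ * fejerKernel N (θ - φ))
      (volume.prod volume) := by
    refine Integrable.mul_bdd (c := C) ?_ ?_ (Eventually.of_forall fun p => hC _ ⟨_, rfl⟩)
    · exact hi.norm.comp_snd _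
    · exact ((continuous_fejerKernel N).comp
        (continuous_fst.sub continuous_snd)).aestronglyMeasurable
  have hpt (θ : Circ) : ‖(fejerPoly h N).eval (circPt θ)‖ ≤
      (2 * π)⁻¹ * ∫ φ, ‖h φ‖ * fejerKernel N (θ - φ) := by
    rw [fejerPoly_eq_integral hi hh, norm_mul, norm_inv]
    have : ‖(2 * π : ℂ)‖ = 2 * π := by simp [abs_of_pos Real.pi_pos]
    rw [this]
    gcongr
    refine (norm_integral_le_integral_norm _).trans_eq ?_
    simp [abs_of_nonneg (fejerKernel_nonneg _ _)]
  calc ∫ θ, ‖(fejerPoly h N).eval (circPt θ)‖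
      ≤ ∫ θ, (2 * π)⁻¹ * ∫ φ, ‖h φ‖ * fejerKernel N (θ - φ) := by
        have := continuous_circPt
        exact integral_mono (integrable_of_continuous (by fun_prop))
          (hprod.integral_prod_left.const_mul _) hpt
    _ = (2 * π)⁻¹ * ∫ φ, ‖h φ‖ * ∫ θ, fejerKernel N θ := by
        rw [integral_const_mul, integral_integral_swap hprod]
        simp only [integral_const_mul, integral_sub_right_eq_self (fejerKernel N)]
    _ ≤ (2 * π)⁻¹ * ((∫ φ, ‖h φ‖) * (2 * π)) := by
        rw [integral_mul_const]
        gcongr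
        exact integral_fejerKernel_le N
    _ = _ := by field_simp

lemma tendsto_integral_mul_conj_fejerPoly {R : ℝ} (hR : 1 < R) {u : ℂ → ℂ}
    (hu : DifferentiableOn ℂ u (ball 0 R)) {h : Circ → ℂ} (hi : Integrable h) :
    Tendsto (fun N => ∫ θ, u (circPt θ) * conj ((fejerPoly h N).eval (circPt θ))) atTop
      (𝓝 (∫ θ, u (circPt θ) * conj (h θ))) := by
  obtain ⟨a, -, ha, has, -, -⟩ := exists_coeff hR hu
  have hA (θ : Circ) := has (circPt θ) (norm_circPt θ).le
  have hi' : Integrable fun θ => conj (h θ) :=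
    Complex.conjLIE.toContinuousLinearEquiv.toContinuousLinearMap.integrable_comp hi
  have hpi : (2 * π : ℂ) ≠ 0 := by simp [Real.pi_ne_zero]
  have h1 : HasSum (fun n : ℕ => 2 * π * a n * conj (coeffC h n))
      (∫ θ, u (circPt θ) * conj (h θ)) := by
    convert hasSum_integral_mul ha hA hi' using 2 with n
    rw [integral_circPt_pow_mul_conj, coeffC]
    simp only [map_mul, map_inv₀, Complex.conj_ofReal, map_ofNat]
    field_simp
  have hcu : Continuous fun θ => u (circPt θ) := continuous_comp_circPt hR hu.continuousOn
  have hint (n : ℕ) : Integrable fun θ =>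
      conj (coeffC h n) * (u (circPt θ) * fourier (-n : ℤ) θ) :=
    integrable_of_continuous (continuous_const.mul (hcu.mul (fourier (-n : ℤ)).continuous))
  have h2 (N : ℕ) : ∫ θ, u (circPt θ) * conj ((fejerPoly h N).eval (circPt θ)) =
      (N⁻¹ : ℝ) • ∑ j ∈ Finset.range N, ∑ n ∈ Finset.range (j + 1),
        2 * π * a n * conj (coeffC h n) := by
    have h3 (θ : Circ) : u (circPt θ) * conj ((fejerPoly h N).eval (circPt θ)) =
        (N : ℂ)⁻¹ * ∑ j ∈ Finset.range N, ∑ n ∈ Finset.range (j + 1),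
          conj (coeffC h n) * (u (circPt θ) * fourier (-n : ℤ) θ) := by
      simp only [fejerPoly_eval, map_mul, map_inv₀, map_natCast, map_sum, circPt_pow, fourier_neg,
        mul_left_comm (u _), Finset.mul_sum]
    simp only [h3]
    rw [integral_const_mul,
      integral_finsetSum _ fun j _ => integrable_finsetSum _ fun n _ => hint n, Complex.real_smul]
    push_cast
    congr 1
    refine Finset.sum_congr rfl fun j _ => ?_
    rw [integral_finsetSum _ fun n _ => hint n]
    refine Finset.sum_congr rfl fun n _ => ?_
    rw [integral_const_mul, integral_mul_fourier_neg ha hA, mul_comm]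
  simp only [h2]
  exact (h1.tendsto_sum_nat.comp (tendsto_add_atTop_nat 1)).cesaro_smul

lemma norm_integral_mul_conj_le_of_norm_le_one {R : ℝ} (hR : 1 < R) {f g u : ℂ → ℂ}
    (hf : DifferentiableOn ℂ f (ball 0 R)) (hu0 : u 0 = 0)
    (hu : ∀ z ∈ ball (0 : ℂ) R, HasDerivAt u (deriv f z * g z) z)
    (hf1 : ∀ z, ‖z‖ ≤ 1 → ‖f z‖ ≤ 1) (hg1 : ∀ z, ‖z‖ ≤ 1 → ‖g z‖ ≤ 1) {h : Circ → ℂ}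
    (hi : Integrable h) (hh : ∀ n : ℤ, n ≤ 0 → ∫ θ, h θ * fourier (-n) θ = 0) :
    ‖∫ θ, u (circPt θ) * conj (h θ)‖ ≤ 5 * ∫ θ, ‖h θ‖ := by
  have hud : DifferentiableOn ℂ u (ball 0 R) := fun z hz =>
    (hu z hz).differentiableAt.differentiableWithinAt
  refine le_of_tendsto (tendsto_integral_mul_conj_fejerPoly hR hud hi).norm
    (Eventually.of_forall fun N => ?_)
  have := norm_integral_mul_conj_polynomial_le hR hf hu0 hu hf1 hg1 (fejerPoly h N)
  have := integral_norm_fejerPoly_le hi hh N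
  linarith

lemma norm_integral_mul_conj_le_of_norm_le {R : ℝ} (hR : 1 < R) {f g u : ℂ → ℂ} {F G : ℝ}
    (hF : 0 < F) (hG : 0 < G)
    (hf : DifferentiableOn ℂ f (ball 0 R)) (hu0 : u 0 = 0)
    (hu : ∀ z ∈ ball (0 : ℂ) R, HasDerivAt u (deriv f z * g z) z)
    (hfF : ∀ z, ‖z‖ ≤ 1 → ‖f z‖ ≤ F) (hgG : ∀ z, ‖z‖ ≤ 1 → ‖g z‖ ≤ G) {h : Circ → ℂ}
    (hi : Integrable h) (hh : ∀ n : ℤ, n ≤ 0 → ∫ θ, h θ * fourier (-n) θ = 0) :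
    ‖∫ θ, u (circPt θ) * conj (h θ)‖ ≤ 5 * (∫ θ, ‖h θ‖) * F * G := by
  have := norm_integral_mul_conj_le_of_norm_le_one hR (f := fun z => (F : ℂ)⁻¹ * f z)
    (g := fun z => (G : ℂ)⁻¹ * g z) (u := fun z => (F : ℂ)⁻¹ * (G : ℂ)⁻¹ * u z)
    (hf.const_mul _) (by simp [hu0])
    (fun z hz => by
      convert! (hu z hz).const_mul ((F : ℂ)⁻¹ * (G : ℂ)⁻¹) using 1
      rw [deriv_const_mul_field]
      ring)
    (fun z hz => by
      rw [norm_mul, norm_inv, Complex.norm_real, Real.norm_of_nonneg hF.le,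
        inv_mul_le_one₀ hF]
      exact hfF z hz)
    (fun z hz => by
      rw [norm_mul, norm_inv, Complex.norm_real, Real.norm_of_nonneg hG.le,
        inv_mul_le_one₀ hG]
      exact hgG z hz) hi hh
  simp only [mul_assoc, integral_const_mul] at this
  rw [norm_mul, norm_mul, norm_inv, norm_inv, Complex.norm_real, Complex.norm_real,
    Real.norm_of_nonneg hF.le, Real.norm_of_nonneg hG.le, ← mul_assoc, ← mul_inv,
    inv_mul_le_iff₀ (by positivity)] at this
  linarith

lemma exists_ball_subset {s : Set ℂ} (hs : IsOpen s) (h : closedDisc ⊆ s) :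
    ∃ R : ℝ, 1 < R ∧ ball (0 : ℂ) R ⊆ s := by
  obtain ⟨δ, hδ, hsub⟩ := (isCompact_closedBall (0 : ℂ) 1).exists_thickening_subset_open hs h
  rw [thickening_closedBall hδ zero_le_one] at hsub
  exact ⟨δ + 1, by linarith, hsub⟩

lemma norm_le_iSup_closedDisc {f : ℂ → ℂ} (hf : ContinuousOn f closedDisc) {z : ℂ}
    (hz : ‖z‖ ≤ 1) : ‖f z‖ ≤ ⨆ z : closedDisc, ‖f z‖ := by
  have hc : Continuous fun z : closedDisc => ‖f z‖ :=
    (continuousOn_iff_continuous_domRestrict.1 hf).norm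
  exact le_ciSup (f := fun z : closedDisc => ‖f z‖) (isCompact_range hc).bddAbove
    ⟨z, by simpa using hz⟩

end HardyBound

/-- Let `h ∈ H¹₀ ⊆ L¹(𝕋)`, i.e. `ĥ(n) = 0` for all `n ≤ 0`.  Then there is a
constant `K > 0` such that for all `f, g, u` holomorphic on an open neighbourhood of the
closed unit disc with `u(0) = 0` and `u' = f'g`,
`|∫_𝕋 u(z) conj(h(z)) |dz|| ≤ K ‖f‖_∞ ‖g‖_∞`. -/
theorem exists_keybound (h : Lp ℂ 1 (volume : Measure Circ))
    (hh : ∀ n : ℤ, n ≤ 0 → ∫ θ : Circ, h θ * fourier (-n) θ = 0) :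
    ∃ K : ℝ, 0 < K ∧ ∀ (s : Set ℂ), IsOpen s → closedDisc ⊆ s →
      ∀ f g u : ℂ → ℂ, DifferentiableOn ℂ f s → DifferentiableOn ℂ g s →
        u 0 = 0 → (∀ z ∈ s, HasDerivAt u (deriv f z * g z) z) →
        ‖∫ θ in (0:ℝ)..(2 * Real.pi),
            u (Complex.exp (θ * Complex.I)) * (starRingEnd ℂ) (h (θ : Circ))‖ ≤
          K * (⨆ z : closedDisc, ‖f (z : ℂ)‖) * (⨆ z : closedDisc, ‖g (z : ℂ)‖) := by
  have hi : Integrable h := L1.integrable_coeFn h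
  have hI : 0 ≤ ∫ θ, ‖h θ‖ := integral_nonneg fun _ => norm_nonneg _
  refine ⟨5 * (∫ θ, ‖h θ‖) + 1, by positivity, fun s hs hsub f g u hf hg hu0 hu => ?_⟩
  obtain ⟨R, hR, hRs⟩ := HardyBound.exists_ball_subset hs hsub
  set F := ⨆ z : closedDisc, ‖f (z : ℂ)‖
  set G := ⨆ z : closedDisc, ‖g (z : ℂ)‖
  have hF : ∀ z, ‖z‖ ≤ 1 → ‖f z‖ ≤ F := fun z hz =>
    HardyBound.norm_le_iSup_closedDisc (hf.continuousOn.mono hsub) hz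
  have hG : ∀ z, ‖z‖ ≤ 1 → ‖g z‖ ≤ G := fun z hz =>
    HardyBound.norm_le_iSup_closedDisc (hg.continuousOn.mono hsub) hz
  have hF0 : 0 ≤ F := (norm_nonneg _).trans (hF 0 (by simp))
  have hG0 : 0 ≤ G := (norm_nonneg _).trans (hG 0 (by simp))
  have hcirc : ∫ θ in (0:ℝ)..(2 * Real.pi),
      u (Complex.exp (θ * Complex.I)) * (starRingEnd ℂ) (h (θ : Circ)) =
      ∫ θ : Circ, u (HardyBound.circPt θ) * (starRingEnd ℂ) (h θ) := by
    rw [← AddCircle.intervalIntegral_preimage (2 * Real.pi) 0, zero_add]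
    refine intervalIntegral.integral_congr fun θ _ => ?_
    have hpt : HardyBound.circPt (θ : Circ) = Complex.exp (θ * Complex.I) := by
      have : (Real.pi : ℂ) ≠ 0 := by simp [Real.pi_ne_zero]
      rw [HardyBound.circPt, fourier_coe_apply]
      congr 1
      push_cast
      field_simp
    simp only [hpt]
  rw [hcirc]
  have hε : ∀ ε : ℝ, 0 < ε → ‖∫ θ : Circ, u (HardyBound.circPt θ) * (starRingEnd ℂ) (h θ)‖ ≤
      5 * (∫ θ, ‖h θ‖) * (F + ε) * (G + ε) := fun ε hε =>
    HardyBound.norm_integral_mul_conj_le_of_norm_le hR (by positivity) (by positivity)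
      (hf.mono hRs) hu0 (fun z hz => hu z (hRs hz)) (fun z hz => by linarith [hF z hz])
      (fun z hz => by linarith [hG z hz]) hi hh
  have hlim : Filter.Tendsto (fun ε : ℝ => 5 * (∫ θ, ‖h θ‖) * (F + ε) * (G + ε))
      (nhdsWithin 0 (Set.Ioi 0)) (nhds (5 * (∫ θ, ‖h θ‖) * (F + 0) * (G + 0))) :=
    (Continuous.tendsto (by fun_prop) 0).mono_left nhdsWithin_le_nhds
  have hle := ge_of_tendsto hlim (eventually_nhdsWithin_of_forall hε)
  simp only [add_zero] at hle
  nlinarith [mul_nonneg hF0 hG0]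

end
end

section
/- Fix an integer n ≥ 1, and let D be a bounded derivation from the disc algebra A(𝔻) to its dual satisfying D(f)(g) = ∫_𝕋 f'(z) g(z) z^{-n} |dz| for all analytic polynomials f and g. Then D(f) = 0 for every f in the subspace z^{n+2}·A(𝔻) = {z^{n+2}·u : u ∈ A(𝔻)} of A(𝔻); in particular D has finite rank. -/
open Complex MeasureTheory Metric Real

set_option synthInstance.maxHeartbeats 400000
set_option maxHeartbeats 1000000

noncomputable section

/-- An analytic polynomial, regarded as an element of the disc algebra. -/
def polyDA (p : Polynomial ℂ) : ↥discAlgebra :=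
  ⟨⟨fun z : closedDisc => p.eval (z : ℂ), p.continuous.comp continuous_subtype_val⟩,
    ⟨fun z => p.eval z, p.differentiable.differentiableOn, fun _ => rfl⟩⟩

theorem polyDA_mul (p q : Polynomial ℂ) : polyDA (p * q) = polyDA p * polyDA q := by
  apply Subtype.ext
  ext z
  exact Polynomial.eval_mul

theorem polyDA_add (p q : Polynomial ℂ) : polyDA (p + q) = polyDA p + polyDA q := by
  apply Subtype.ext
  ext z
  exact Polynomial.eval_add

theorem polyDA_smul (c : ℂ) (p : Polynomial ℂ) : polyDA (c • p) = c • polyDA p := by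
  apply Subtype.ext
  ext z
  simp [polyDA]

/-- `polyDA` as a linear map. -/
def polyDALinearMap : Polynomial ℂ →ₗ[ℂ] ↥discAlgebra where
  toFun := polyDA
  map_add' := polyDA_add
  map_smul' := polyDA_smul

/-- A function holomorphic on the open unit disc is, on any smaller disc, a uniform limit of
polynomials. -/
theorem exists_polynomial_norm_sub_lt {F : ℂ → ℂ} (hF : DifferentiableOn ℂ F (ball 0 1))
    {r : ℝ} (hr : r < 1) {ε : ℝ} (hε : 0 < ε) :
    ∃ p : Polynomial ℂ, ∀ z ∈ ball (0 : ℂ) r, ‖F z - p.eval z‖ < ε := by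
  rcases le_or_gt r 0 with h0 | h0
  · exact ⟨0, fun z hz => by simp [ball_eq_empty.2 h0] at hz⟩
  obtain ⟨R, hrR, hR1⟩ := exists_between hr
  lift r to NNReal using h0.le
  lift R to NNReal using (h0.trans hrR).le
  have hps := (hF.mono (closedBall_subset_ball hR1)).hasFPowerSeriesOnBall
    (by exact_mod_cast h0.trans hrR)
  have hu := hps.tendstoUniformlyOn (r' := r) (by exact_mod_cast hrR)
  obtain ⟨N, hN⟩ := (Metric.tendstoUniformlyOn_iff.1 hu ε hε).exists
  refine ⟨∑ k ∈ Finset.range N,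
    Polynomial.monomial k ((cauchyPowerSeries F 0 R).coeff k), fun z hz => ?_⟩
  have hsum : (∑ k ∈ Finset.range N,
      Polynomial.monomial k ((cauchyPowerSeries F 0 R).coeff k)).eval z
      = (cauchyPowerSeries F 0 R).partialSum N z := by
    simp only [Polynomial.eval_finsetSum, Polynomial.eval_monomial,
      FormalMultilinearSeries.partialSum, FormalMultilinearSeries.apply_eq_pow_smul_coeff,
      smul_eq_mul, mul_comm]
  simpa only [hsum, dist_eq_norm, zero_add] using hN z hz

/-- The analytic polynomials are dense in the disc algebra. -/
theorem denseRange_polyDA : DenseRange polyDA := by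
  rw [Metric.denseRange_iff]
  rintro ⟨f, F, hF, hfF⟩ ε hε
  obtain ⟨δ, hδ, hfδ⟩ := Metric.uniformContinuous_iff.1
    (CompactSpace.uniformContinuous_of_continuous f.continuous) (ε / 2) (half_pos hε)
  obtain ⟨r, hr, hr1⟩ := exists_between (max_lt zero_lt_one (sub_lt_self 1 hδ))
  obtain ⟨hr0, hrδ⟩ := max_lt_iff.1 hr
  obtain ⟨s, hrs, hs1⟩ := exists_between hr1
  obtain ⟨p, hp⟩ := exists_polynomial_norm_sub_lt hF hs1 (half_pos hε)
  refine ⟨p.comp (Polynomial.C (r : ℂ) * Polynomial.X), ?_⟩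
  rw [Subtype.dist_eq, ContinuousMap.dist_lt_iff hε]
  intro z
  have hz : ‖(z : ℂ)‖ ≤ 1 := mem_closedBall_zero_iff.1 z.2
  have hnorm : ‖(r : ℂ) * z‖ ≤ r := by
    rw [norm_mul, Complex.norm_of_nonneg hr0.le]
    exact mul_le_of_le_one_right hr0.le hz
  let w : closedDisc := ⟨r * z, by simpa using hnorm.trans hr1.le⟩
  have hzw : dist z w < δ := by
    have h : (z : ℂ) - r * z = ((1 - r : ℝ) : ℂ) * z := by push_cast; ring
    rw [Subtype.dist_eq, dist_eq_norm, h, norm_mul, Complex.norm_of_nonneg (by linarith)]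
    nlinarith [norm_nonneg (z : ℂ)]
  have h1 := hfδ hzw
  have h2 := hp (r * z) (by simpa using hnorm.trans_lt hrs)
  have h3 : dist (f w) (p.eval (r * z : ℂ)) < ε / 2 := by
    rw [hfF w, dist_eq_norm]
    exact h2
  have h4 : (polyDA (p.comp (Polynomial.C (r : ℂ) * Polynomial.X)) : C(closedDisc, ℂ)) z
      = p.eval (r * z : ℂ) := by
    simp [polyDA]
  rw [h4]
  linarith [dist_triangle (f z) (f w) (p.eval (r * z : ℂ))]

/-- A polynomial without constant term has zero mean over the unit circle. -/
theorem integral_exp_mul_eval_exp (p : Polynomial ℂ) :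
    ∫ θ in (0 : ℝ)..(2 * Real.pi),
      Complex.exp (θ * Complex.I) * p.eval (Complex.exp (θ * Complex.I)) = 0 := by
  have h := (p.differentiable.diffContOnCl (s := ball 0 1)).circleIntegral_eq_zero zero_le_one
  simp only [circleIntegral, deriv_circleMap, smul_eq_mul, circleMap_zero, ofReal_one, one_mul]
    at h
  rw [← mul_right_inj' Complex.I_ne_zero, mul_zero, ← h, ← intervalIntegral.integral_const_mul]
  congr 1
  ext θ
  ring

/-- The pairing `∫ p' q z⁻ⁿ |dz|` vanishes when `z ^ (n + 2)` divides `p`. -/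
theorem integral_derivative_X_pow_mul (n : ℕ) (p q : Polynomial ℂ) :
    ∫ θ in (0 : ℝ)..(2 * Real.pi),
      ((Polynomial.X ^ (n + 2) * p).derivative.eval (Complex.exp (θ * Complex.I))) *
        (q.eval (Complex.exp (θ * Complex.I))) *
        Complex.exp (-((n : ℂ) * (θ : ℂ) * Complex.I)) = 0 := by
  rw [← integral_exp_mul_eval_exp
    ((Polynomial.C ((n : ℂ) + 2) * p + Polynomial.X * p.derivative) * q)]
  congr 1
  ext θ
  have h : Complex.exp (-((n : ℂ) * θ * Complex.I)) * Complex.exp (θ * Complex.I) ^ n = 1 := by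
    rw [← Complex.exp_nat_mul, ← Complex.exp_add, mul_assoc, neg_add_cancel, Complex.exp_zero]
  generalize Complex.exp (-((n : ℂ) * θ * Complex.I)) = a at h ⊢
  generalize Complex.exp (θ * Complex.I) = z at h ⊢
  simp only [Polynomial.derivative_mul, Polynomial.derivative_X_pow, Polynomial.eval_add,
    Polynomial.eval_mul, Polynomial.eval_C, Polynomial.eval_pow, Polynomial.eval_X,
    Nat.add_succ_sub_one]
  push_cast
  linear_combination (z * ((n + 2) * p.eval z + z * p.derivative.eval z) * q.eval z) * h

/-- Fix `n ≥ 1` and let `D` be a bounded derivation from the disc algebra to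
its dual with `D(f)(g) = ∫_𝕋 f'(z) g(z) z^{-n} |dz|` for all analytic polynomials `f, g`
(parametrising the circle by `z = e^{iθ}`).  Then `D` vanishes on the subspace
`z^{n+2}·A(𝔻)`, and in particular `D` has finite rank. -/
theorem derivation_with_polynomial_symbol_finite_rank
    (n : ℕ) (hn : 1 ≤ n) (D : ↥discAlgebra →L[ℂ] DADual) (hD : IsDerivation D)
    (hform : ∀ p q : Polynomial ℂ,
      D (polyDA p) (polyDA q) = ∫ θ in (0:ℝ)..(2 * Real.pi),
        (p.derivative.eval (Complex.exp (θ * Complex.I))) *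
          (q.eval (Complex.exp (θ * Complex.I))) *
          Complex.exp (-((n : ℂ) * (θ : ℂ) * Complex.I))) :
    (∀ u : ↥discAlgebra, D (polyDA (Polynomial.X ^ (n + 2)) * u) = 0) ∧
    FiniteDimensional ℂ (LinearMap.range (D : ↥discAlgebra →ₗ[ℂ] DADual)) := by
  have hvanish : ∀ u : ↥discAlgebra, D (polyDA (Polynomial.X ^ (n + 2)) * u) = 0 := by
    intro u
    refine denseRange_polyDA.induction_on
      (p := fun u => D (polyDA (Polynomial.X ^ (n + 2)) * u) = 0) u
      (isClosed_eq (D.continuous.comp (continuous_const.mul continuous_id)) continuous_const)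
      fun p => ?_
    ext v
    refine denseRange_polyDA.induction_on
      (p := fun v => D (polyDA (Polynomial.X ^ (n + 2)) * polyDA p) v = 0) v
      (isClosed_eq (ContinuousLinearMap.continuous _) continuous_const) fun q => ?_
    rw [← polyDA_mul, hform]
    exact integral_derivative_X_pow_mul n p q
  refine ⟨hvanish, ?_⟩
  let S : Submodule ℂ DADual := (Polynomial.degreeLT ℂ (n + 2)).map
    ((D : ↥discAlgebra →ₗ[ℂ] DADual) ∘ₗ polyDALinearMap)
  have : FiniteDimensional ℂ (Polynomial.degreeLT ℂ (n + 2)) :=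
    (Polynomial.degreeLTEquiv ℂ (n + 2)).symm.finiteDimensional
  have hS : IsClosed (S : Set DADual) := S.closed_of_finiteDimensional
  refine Submodule.finiteDimensional_of_le (S₂ := S) ?_
  rintro _ ⟨f, rfl⟩
  refine denseRange_polyDA.induction_on (p := fun f => D f ∈ S) f
    (hS.preimage D.continuous) fun p => ?_
  have hmonic := Polynomial.monic_X_pow (R := ℂ) (n + 2)
  refine ⟨p %ₘ Polynomial.X ^ (n + 2), ?_, ?_⟩
  · rw [SetLike.mem_coe, Polynomial.mem_degreeLT]
    simpa using Polynomial.degree_modByMonic_lt p hmonic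
  · conv_rhs => rw [← Polynomial.modByMonic_add_div p (Polynomial.X ^ (n + 2)),
      polyDA_add, polyDA_mul, map_add, hvanish, add_zero]
    rfl

end
end

section
/- For every bounded derivation D from the disc algebra A(𝔻) to its dual A(𝔻)* and every ε > 0, there exists a bounded derivation D' from A(𝔻) to A(𝔻)* of finite rank such that ‖D − D'‖ < ε in operator norm. -/
open Complex MeasureTheory Metric Real

set_option synthInstance.maxHeartbeats 400000
set_option maxHeartbeats 1000000

noncomputable section

open Polynomial unitInterval ComplexConjugate

/-- Cauchy–Schwarz for continuous functions on a compact space. -/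
lemma norm_integral_mul_conj_le {Ω : Type*} [TopologicalSpace Ω] [CompactSpace Ω]
    [MeasurableSpace Ω] [OpensMeasurableSpace Ω] (μ : Measure Ω) [IsFiniteMeasure μ]
    {a b : Ω → ℂ} (ha : Continuous a) (hb : Continuous b) :
    ‖∫ x, a x * conj (b x) ∂μ‖ ≤ √(∫ x, ‖a x‖ ^ 2 ∂μ) * √(∫ x, ‖b x‖ ^ 2 ∂μ) := by
  have hm : ∀ f : Ω → ℂ, Continuous f → MemLp (fun x => ‖f x‖) (ENNReal.ofReal 2) μ := by
    intro f hf
    have h2 : Continuous fun x => ‖f x‖ := hf.norm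
    exact h2.memLp_of_hasCompactSupport (HasCompactSupport.of_compactSpace _)
  have h := integral_mul_le_Lp_mul_Lq_of_nonneg (μ := μ) Real.HolderConjugate.two_two
    (Filter.Eventually.of_forall fun x => norm_nonneg (a x))
    (Filter.Eventually.of_forall fun x => norm_nonneg (b x)) (hm a ha) (hm b hb)
  simp only [Real.rpow_ofNat, ← Real.sqrt_eq_rpow] at h
  refine (norm_integral_le_integral_norm _).trans (le_of_eq_of_le ?_ h)
  simp

/-- The sum of the squares of the moduli of the coefficients of a polynomial. -/
def coeffSqSum (K : ℂ[X]) : ℝ := ∑ i ∈ K.support, ‖K.coeff i‖ ^ 2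

lemma coeffSqSum_eq_sum_range {K : ℂ[X]} {n : ℕ} (h : K.natDegree < n) :
    coeffSqSum K = ∑ i ∈ Finset.range n, ‖K.coeff i‖ ^ 2 := by
  refine Finset.sum_subset (fun i hi => ?_) fun i _ hi => ?_
  · exact Finset.mem_range.2 ((le_natDegree_of_mem_supp i hi).trans_lt h)
  · simp [notMem_support_iff.1 hi]

lemma coeffSqSum_nonneg (K : ℂ[X]) : 0 ≤ coeffSqSum K :=
  Finset.sum_nonneg fun _ _ => by positivity

/-- If the moments of the distribution of `Z` are diagonal, then monomials are orthogonal. -/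
lemma integral_eval_mul_conj_eval {Ω : Type*} [TopologicalSpace Ω] [CompactSpace Ω]
    [MeasurableSpace Ω] [OpensMeasurableSpace Ω] {μ : Measure Ω} [IsFiniteMeasure μ]
    {Z : Ω → ℂ} (hZ : Continuous Z) {w : ℕ → ℂ}
    (hw : ∀ i j, ∫ x, Z x ^ i * conj (Z x) ^ j ∂μ = if i = j then w i else 0)
    {u v : ℂ[X]} {n : ℕ} (hu : u.natDegree < n) (hv : v.natDegree < n) :
    ∫ x, u.eval (Z x) * conj (v.eval (Z x)) ∂μ =
      ∑ i ∈ Finset.range n, u.coeff i * conj (v.coeff i) * w i := by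
  have hint : ∀ f : Ω → ℂ, Continuous f → Integrable f μ := fun f hf =>
    hf.integrable_of_hasCompactSupport (HasCompactSupport.of_compactSpace _)
  have h1 : ∀ x, u.eval (Z x) * conj (v.eval (Z x)) = ∑ i ∈ Finset.range n,
      ∑ j ∈ Finset.range n, u.coeff i * conj (v.coeff j) * (Z x ^ i * conj (Z x) ^ j) := by
    intro x
    rw [eval_eq_sum_range' hu, eval_eq_sum_range' hv, map_sum, Finset.sum_mul_sum]
    refine Finset.sum_congr rfl fun i _ => Finset.sum_congr rfl fun j _ => ?_
    simp only [map_mul, map_pow]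
    ring
  simp_rw [h1]
  rw [integral_finsetSum _ fun i _ => hint _ (by fun_prop)]
  refine Finset.sum_congr rfl fun i hi => ?_
  rw [integral_finsetSum _ fun j _ => hint _ (by fun_prop)]
  simp_rw [integral_const_mul, hw]
  simp only [mul_ite, mul_zero, Finset.sum_ite_eq, hi, if_true]

lemma integral_norm_eval_sq {Ω : Type*} [TopologicalSpace Ω] [CompactSpace Ω]
    [MeasurableSpace Ω] [OpensMeasurableSpace Ω] {μ : Measure Ω} [IsFiniteMeasure μ]
    {Z : Ω → ℂ} (hZ : Continuous Z) {w : ℕ → ℝ}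
    (hw : ∀ i j, ∫ x, Z x ^ i * conj (Z x) ^ j ∂μ = if i = j then (w i : ℂ) else 0)
    {u : ℂ[X]} {n : ℕ} (hu : u.natDegree < n) :
    ∫ x, ‖u.eval (Z x)‖ ^ 2 ∂μ = ∑ i ∈ Finset.range n, ‖u.coeff i‖ ^ 2 * w i := by
  have h := integral_eval_mul_conj_eval hZ hw hu hu
  simp only [mul_conj'] at h
  exact_mod_cast h

lemma integral_unitInterval (f : ℝ → ℂ) : ∫ x : I, f x = ∫ x in (0 : ℝ)..1, f x := by
  rw [intervalIntegral.integral_of_le zero_le_one, ← MeasureTheory.integral_Icc_eq_integral_Ioc]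
  exact unitInterval.measurePreserving_coe.integral_comp unitInterval.measurableEmbedding_coe f

/-- The parametrisation `t ↦ exp (2πit)` of the unit circle. -/
def circlePt (t : I) : ℂ := Complex.exp (2 * π * Complex.I * (t : ℝ))

lemma continuous_circlePt : Continuous circlePt := by unfold circlePt; fun_prop

lemma norm_circlePt (t : I) : ‖circlePt t‖ = 1 := by
  rw [circlePt, mul_right_comm, ← ofReal_ofNat, ← ofReal_mul, ← ofReal_mul, norm_exp_ofReal_mul_I]

lemma integral_circlePt (i j : ℕ) :
    ∫ t, circlePt t ^ i * conj (circlePt t) ^ j = if i = j then (1 : ℂ) else 0 := by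
  have h : ∀ t, circlePt t ^ i * conj (circlePt t) ^ j =
      Complex.exp ((((i : ℤ) - (j : ℤ) : ℤ) : ℂ) * (2 * π * Complex.I) * (t : ℝ)) := by
    intro t
    rw [circlePt, ← Complex.exp_conj, ← Complex.exp_nat_mul, ← Complex.exp_nat_mul,
      ← Complex.exp_add]
    congr 1
    simp only [map_mul, conj_ofReal, conj_I, map_ofNat]
    push_cast
    ring
  simp_rw [h]
  rw [integral_unitInterval (fun t => Complex.exp (_ * (t : ℂ)))]
  split_ifs with hij
  · simp [hij]
  · have hne : ((((i : ℤ) - (j : ℤ) : ℤ) : ℂ) * (2 * π * Complex.I)) ≠ 0 :=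
      mul_ne_zero (Int.cast_ne_zero.2 (by lia)) two_pi_I_ne_zero
    rw [integral_exp_mul_complex hne]
    rw [ofReal_one, mul_one, Complex.exp_int_mul_two_pi_mul_I]
    simp

/-- A random point of the unit disc with squared modulus `x * y` and argument `2 * π * t`. -/
def discPt (x : I × I × I) : ℂ := (√(x.1 : ℝ) : ℂ) * ((√(x.2.1 : ℝ) : ℂ) * circlePt x.2.2)

lemma continuous_discPt : Continuous discPt := by
  have := continuous_circlePt
  unfold discPt
  fun_prop

lemma norm_discPt_le (x : I × I × I) : ‖discPt x‖ ≤ 1 := by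
  have h : ∀ y : I, √(y : ℝ) ≤ 1 := fun y => Real.sqrt_le_one.2 y.2.2
  simp only [discPt, norm_mul, norm_circlePt, mul_one, norm_real, Real.norm_eq_abs,
    abs_of_nonneg (Real.sqrt_nonneg _)]
  exact mul_le_one₀ (h _) (Real.sqrt_nonneg _) (h _)

lemma integral_discPt (i j : ℕ) :
    ∫ x, discPt x ^ i * conj (discPt x) ^ j =
      if i = j then (((((i : ℝ) + 1) ^ 2)⁻¹ : ℝ) : ℂ) else 0 := by
  have h : ∀ x, discPt x ^ i * conj (discPt x) ^ j = (√(x.1 : ℝ) : ℂ) ^ (i + j) *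
      ((√(x.2.1 : ℝ) : ℂ) ^ (i + j) * (circlePt x.2.2 ^ i * conj (circlePt x.2.2) ^ j)) := by
    intro x
    simp only [discPt, map_mul, conj_ofReal]
    ring
  simp_rw [h]
  rw [Measure.volume_eq_prod, integral_prod_mul (fun a : I => (√(a : ℝ) : ℂ) ^ (i + j))
    (fun b : I × I => (√(b.1 : ℝ) : ℂ) ^ (i + j) * (circlePt b.2 ^ i * conj (circlePt b.2) ^ j)),
    Measure.volume_eq_prod, integral_prod_mul (fun a : I => (√(a : ℝ) : ℂ) ^ (i + j))
    (fun b : I => (circlePt b ^ i * conj (circlePt b) ^ j)), integral_circlePt]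
  split_ifs with hij
  · subst hij
    have h1 : ∀ a : I, (√(a : ℝ) : ℂ) ^ (i + i) = ((a : ℝ) : ℂ) ^ i := by
      intro a
      rw [← two_mul, pow_mul]
      congr 1
      exact_mod_cast Real.sq_sqrt a.2.1
    simp_rw [h1]
    rw [integral_unitInterval fun x => (x : ℂ) ^ i]
    have h2 : ∫ x in (0 : ℝ)..1, (x : ℂ) ^ i = ((i : ℂ) + 1)⁻¹ := by
      have := integral_pow (a := 0) (b := 1) i
      have h3 := intervalIntegral.integral_ofReal (a := 0) (b := 1) (μ := volume)
        (f := fun x => x ^ i)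
      push_cast at h3
      rw [h3, this]
      simp
    rw [h2, mul_one, ← sq, ← inv_pow]
    push_cast
    rfl
  · simp

lemma integral_norm_eval_circlePt_sq (u : ℂ[X]) :
    ∫ t, ‖u.eval (circlePt t)‖ ^ 2 = coeffSqSum u := by
  rw [integral_norm_eval_sq continuous_circlePt (w := fun _ => 1)
    (by simpa using integral_circlePt) u.natDegree.lt_succ_self,
    coeffSqSum_eq_sum_range u.natDegree.lt_succ_self]
  simp

lemma integral_norm_eval_derivative_discPt_sq_le (u : ℂ[X]) :
    ∫ x, ‖u.derivative.eval (discPt x)‖ ^ 2 ≤ coeffSqSum u := by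
  have h1 : u.derivative.natDegree < u.natDegree + 1 :=
    Nat.lt_succ_of_le ((natDegree_derivative_le u).trans (Nat.sub_le _ _))
  rw [integral_norm_eval_sq continuous_discPt integral_discPt h1,
    coeffSqSum_eq_sum_range (n := u.natDegree + 1 + 1) (by lia),
    Finset.sum_range_succ' (n := u.natDegree + 1)]
  refine le_trans ?_ (le_add_of_nonneg_right (by positivity))
  refine Finset.sum_le_sum fun i _ => le_of_eq ?_
  have h2 : ‖(i : ℂ) + 1‖ = (i : ℝ) + 1 := by exact_mod_cast Complex.norm_natCast (i + 1)
  rw [coeff_derivative, norm_mul, h2]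
  have : (i : ℝ) + 1 ≠ 0 := by positivity
  field_simp

/-- The pairing of `G` with the primitive-normalised coefficients of `h`: the coefficient of
`z ^ k` in `G` is multiplied by the coefficient of `z ^ (k + 1)` in `h` over `k + 1`. -/
def primitivePairing (h : ℕ → ℂ) (G : ℂ[X]) : ℂ :=
  ∑ k ∈ G.support, h (k + 1) / (k + 1) * G.coeff k

lemma primitivePairing_eq_sum_range (h : ℕ → ℂ) {G : ℂ[X]} {n : ℕ} (hn : G.natDegree < n) :
    primitivePairing h G = ∑ k ∈ Finset.range n, h (k + 1) / (k + 1) * G.coeff k := by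
  refine Finset.sum_subset (fun i hi => ?_) fun i _ hi => ?_
  · exact Finset.mem_range.2 ((le_natDegree_of_mem_supp i hi).trans_lt hn)
  · simp [notMem_support_iff.1 hi]

lemma coeffSqSum_map_conj (p : ℂ[X]) : coeffSqSum (p.map (starRingEnd ℂ)) = coeffSqSum p := by
  have h := p.natDegree.lt_succ_self
  rw [coeffSqSum_eq_sum_range h, coeffSqSum_eq_sum_range (natDegree_map_le.trans_lt h)]
  simp

lemma primitivePairing_eq_integral (h G : ℂ[X]) :
    primitivePairing h.coeff G =
      ∫ x, G.eval (discPt x) * conj ((h.map (starRingEnd ℂ)).derivative.eval (discPt x)) := by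
  set v := (h.map (starRingEnd ℂ)).derivative
  have h1 : G.natDegree < G.natDegree + v.natDegree + 1 := by lia
  rw [integral_eval_mul_conj_eval continuous_discPt integral_discPt h1 (v := v) (by lia),
    primitivePairing_eq_sum_range _ h1]
  refine Finset.sum_congr rfl fun k _ => ?_
  have hk : (k : ℂ) + 1 ≠ 0 := by exact_mod_cast k.succ_ne_zero
  simp only [v, coeff_derivative, coeff_map, map_mul, conj_conj, map_add, map_one, map_natCast]
  push_cast
  field_simp

lemma integrable_of_continuous {Ω E : Type*} [TopologicalSpace Ω] [CompactSpace Ω]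
    [MeasurableSpace Ω] [OpensMeasurableSpace Ω] [NormedAddCommGroup E] {μ : Measure Ω}
    [SecondCountableTopologyEither Ω E]
    [IsFiniteMeasure μ] {f : Ω → E} (hf : Continuous f) : Integrable f μ :=
  hf.integrable_of_hasCompactSupport (HasCompactSupport.of_compactSpace _)

lemma continuous_eval_discPt (p : ℂ[X]) : Continuous fun x => p.eval (discPt x) :=
  p.continuous.comp continuous_discPt

lemma integral_norm_mul_sq_le {a b : I × I × I → ℂ} (ha : Continuous a) (hb : Continuous b)
    {C : ℝ} (hC : ∀ x, ‖b x‖ ≤ C) :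
    ∫ x, ‖a x * b x‖ ^ 2 ≤ C ^ 2 * ∫ x, ‖a x‖ ^ 2 := by
  rw [← integral_const_mul]
  refine integral_mono (integrable_of_continuous (by fun_prop))
    (integrable_of_continuous (by fun_prop)) fun x => ?_
  simp only [norm_mul, mul_pow]
  rw [mul_comm]
  gcongr
  exact hC x

/-- The area-integral estimate for the product of `L` with the derivative of `p`. -/
lemma integral_norm_mul_derivative_sq_le (L p : ℂ[X]) {P : ℝ}
    (hP : ∀ z : ℂ, ‖z‖ ≤ 1 → ‖p.eval z‖ ≤ P) :
    ∫ x, ‖L.eval (discPt x) * p.derivative.eval (discPt x)‖ ^ 2 ≤ 4 * P ^ 2 * coeffSqSum L := by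
  have hc := continuous_eval_discPt
  have h1 : ∫ x, ‖(L * p).derivative.eval (discPt x)‖ ^ 2 ≤ P ^ 2 * coeffSqSum L := by
    refine (integral_norm_eval_derivative_discPt_sq_le _).trans ?_
    rw [← integral_norm_eval_circlePt_sq, ← integral_norm_eval_circlePt_sq, ← integral_const_mul]
    have hcc : ∀ q : ℂ[X], Continuous fun t => q.eval (circlePt t) := fun q =>
      q.continuous.comp continuous_circlePt
    refine integral_mono (integrable_of_continuous ((hcc _).norm.pow 2))
      (integrable_of_continuous (((hcc _).norm.pow 2).const_mul _)) fun t => ?_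
    simp only [eval_mul, norm_mul, mul_pow]
    rw [mul_comm]
    gcongr
    exact hP _ (norm_circlePt t).le
  have h2 : ∫ x, ‖L.derivative.eval (discPt x) * p.eval (discPt x)‖ ^ 2 ≤
      P ^ 2 * coeffSqSum L :=
    (integral_norm_mul_sq_le (hc _) (hc _) fun x => hP _ (norm_discPt_le x)).trans
      (by gcongr; exact integral_norm_eval_derivative_discPt_sq_le _)
  have h3 : ∫ x, ‖L.eval (discPt x) * p.derivative.eval (discPt x)‖ ^ 2 ≤
      ∫ x, (2 * ‖(L * p).derivative.eval (discPt x)‖ ^ 2 +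
        2 * ‖L.derivative.eval (discPt x) * p.eval (discPt x)‖ ^ 2) := by
    refine integral_mono (integrable_of_continuous (((hc _).mul (hc _)).norm.pow 2))
      (integrable_of_continuous ((((hc _).norm.pow 2).const_mul _).add
        ((((hc _).mul (hc _)).norm.pow 2).const_mul _))) fun x => ?_
    have h4 : L.eval (discPt x) * p.derivative.eval (discPt x) =
        (L * p).derivative.eval (discPt x) - L.derivative.eval (discPt x) * p.eval (discPt x) := by
      simp [derivative_mul]
    simp only
    rw [h4]
    have h5 := norm_sub_le ((L * p).derivative.eval (discPt x))
      (L.derivative.eval (discPt x) * p.eval (discPt x))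
    set a := ‖(L * p).derivative.eval (discPt x)‖
    set b := ‖L.derivative.eval (discPt x) * p.eval (discPt x)‖
    calc _ ≤ (a + b) ^ 2 := by gcongr
      _ ≤ _ := by nlinarith [sq_nonneg (a - b)]
  rw [integral_add, integral_const_mul, integral_const_mul] at h3
  · linarith
  · exact integrable_of_continuous (((hc _).norm.pow 2).const_mul _)
  · exact integrable_of_continuous ((((hc _).mul (hc _)).norm.pow 2).const_mul _)

/-- The pairing of a product of two polynomials with `p.derivative * q` is controlled by the `ℓ²`
norms of the coefficients of the factors and the supremum norms of `p` and `q`. -/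
lemma norm_primitivePairing_mul_le (K L p q : ℂ[X]) {P Q : ℝ}
    (hP : ∀ z : ℂ, ‖z‖ ≤ 1 → ‖p.eval z‖ ≤ P) (hQ : ∀ z : ℂ, ‖z‖ ≤ 1 → ‖q.eval z‖ ≤ Q) :
    ‖primitivePairing (K * L).coeff (p.derivative * q)‖ ≤
      4 * √(coeffSqSum K) * √(coeffSqSum L) * P * Q := by
  have hP0 : 0 ≤ P := (norm_nonneg _).trans (hP 0 (by simp))
  have hQ0 : 0 ≤ Q := (norm_nonneg _).trans (hQ 0 (by simp))
  have hc := continuous_eval_discPt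
  have key : ∀ M N : ℂ[X], ‖∫ x, (p.derivative * q).eval (discPt x) *
      conj (M.derivative.eval (discPt x) * N.eval (discPt x))‖ ≤
      2 * √(coeffSqSum M) * √(coeffSqSum N) * P * Q := by
    intro M N
    have h1 := norm_integral_mul_conj_le volume
      ((continuous_conj.comp (hc N)).mul (hc p.derivative))
      ((hc M.derivative).mul (continuous_conj.comp (hc q)))
    have h2 : ∫ x, ‖conj (N.eval (discPt x)) * p.derivative.eval (discPt x)‖ ^ 2 ≤
        (2 * P * √(coeffSqSum N)) ^ 2 := by
      rw [mul_pow, mul_pow, Real.sq_sqrt (coeffSqSum_nonneg N)]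
      convert integral_norm_mul_derivative_sq_le N p hP using 4
      · simp
      · norm_num
    have h3 : ∫ x, ‖M.derivative.eval (discPt x) * conj (q.eval (discPt x))‖ ^ 2 ≤
        (Q * √(coeffSqSum M)) ^ 2 := by
      rw [mul_pow, Real.sq_sqrt (coeffSqSum_nonneg M)]
      refine (integral_norm_mul_sq_le (hc _) (continuous_conj.comp (hc q)) (C := Q)
        fun x => ?_).trans ?_
      · simpa using hQ _ (norm_discPt_le x)
      · gcongr
        exact integral_norm_eval_derivative_discPt_sq_le _
    calc _ = _ := by
            congr 2 with x
            simp only [Function.comp_apply, Pi.mul_apply, eval_mul, map_mul, conj_conj]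
            ring
      _ ≤ _ := h1
      _ ≤ (2 * P * √(coeffSqSum N)) * (Q * √(coeffSqSum M)) := by
            gcongr
            · exact Real.sqrt_le_iff.2 ⟨by positivity, h2⟩
            · exact Real.sqrt_le_iff.2 ⟨by positivity, h3⟩
      _ = _ := by ring
  set K' := K.map (starRingEnd ℂ) with hK
  set L' := L.map (starRingEnd ℂ) with hL
  have h1 := key K' L'
  have h2 := key L' K'
  rw [hK, hL, coeffSqSum_map_conj, coeffSqSum_map_conj, ← hK, ← hL] at h1 h2
  have hi : ∀ M N : ℂ[X], Integrable fun x => (p.derivative * q).eval (discPt x) *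
      conj (M.derivative.eval (discPt x) * N.eval (discPt x)) := fun M N =>
    integrable_of_continuous ((hc _).mul (continuous_conj.comp ((hc _).mul (hc _))))
  rw [primitivePairing_eq_integral, Polynomial.map_mul, ← hK, ← hL]
  calc _ = ‖∫ x, ((p.derivative * q).eval (discPt x) *
        conj (K'.derivative.eval (discPt x) * L'.eval (discPt x)) +
        (p.derivative * q).eval (discPt x) *
        conj (L'.derivative.eval (discPt x) * K'.eval (discPt x)))‖ := by
          congr 2 with x
          simp only [derivative_mul, eval_add, eval_mul, map_add, map_mul]
          ring
    _ ≤ _ := by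
          rw [integral_add (hi _ _) (hi _ _)]
          refine (norm_add_le _ _).trans ((add_le_add h1 h2).trans (le_of_eq ?_))
          ring

namespace discAlgebra

instance : CoeFun ↥discAlgebra fun _ => closedDisc → ℂ := ⟨fun f => ⇑(f : C(closedDisc, ℂ))⟩

/-- An element of the disc algebra, from a function on the plane. -/
def ofFun (F : ℂ → ℂ) (hc : ContinuousOn F (closedBall 0 1))
    (hd : DifferentiableOn ℂ F (ball 0 1)) : ↥discAlgebra :=
  ⟨⟨fun z => F z, hc.domRestrict⟩, F, hd, fun _ => rfl⟩

/-- The coordinate function. -/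
def coord : ↥discAlgebra := ofFun id continuousOn_id differentiableOn_id

@[simp]
lemma mul_apply (f g : ↥discAlgebra) (z : closedDisc) : (f * g) z = f z * g z := rfl

lemma aeval_coord_apply (p : ℂ[X]) (z : closedDisc) : aeval coord p z = p.eval (z : ℂ) := by
  have h := aeval_algHom_apply ((ContinuousMap.evalAlgHom ℂ ℂ z).comp discAlgebra.val) coord p
  rw [coe_aeval_eq_eval] at h
  exact h.symm

lemma norm_apply_le (f : ↥discAlgebra) (z : closedDisc) : ‖f z‖ ≤ ‖f‖ :=
  (f : C(closedDisc, ℂ)).norm_coe_le_norm z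

lemma norm_eval_le (p : ℂ[X]) (z : ℂ) (hz : ‖z‖ ≤ 1) : ‖p.eval z‖ ≤ ‖aeval coord p‖ := by
  rw [← aeval_coord_apply p ⟨z, by simpa using hz⟩]
  exact norm_apply_le _ _

lemma norm_le {f : ↥discAlgebra} {C : ℝ} (hC : 0 ≤ C) (h : ∀ z, ‖f z‖ ≤ C) : ‖f‖ ≤ C :=
  ((f : C(closedDisc, ℂ)).norm_le hC).2 h

/-- Polynomials are dense in the disc algebra. -/
lemma denseRange_aeval_coord : DenseRange fun p : ℂ[X] => aeval coord p := by
  refine Metric.denseRange_iff.2 fun f ε hε => ?_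
  obtain ⟨F, hF, hf⟩ := f.2
  have hu : UniformContinuous (f : C(closedDisc, ℂ)) :=
    CompactSpace.uniformContinuous_of_continuous (f : C(closedDisc, ℂ)).continuous
  obtain ⟨δ, hδ, hfδ⟩ := Metric.uniformContinuous_iff.1 hu (ε / 4) (by positivity)
  obtain ⟨s, hs1, hs2⟩ := exists_between (show max (1 - δ) 0 < 1 by simp [hδ])
  obtain ⟨hsδ, hs0⟩ := max_lt_iff.1 hs1
  obtain ⟨R, hR1, hR2⟩ := exists_between hs2
  have hR0 : 0 < R := hs0.trans hR1
  lift R to NNReal using hR0.le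
  lift s to NNReal using hs0.le
  have hser := (hF.mono (closedBall_subset_ball hR2)).hasFPowerSeriesOnBall (by exact_mod_cast hR0)
  obtain ⟨s', hs1', hs2'⟩ := exists_between hR1
  lift s' to NNReal using s.2.trans hs1'.le
  have hunif := hser.tendstoUniformlyOn (r' := s') (by exact_mod_cast hs2')
  obtain ⟨n, hn⟩ := (Metric.tendstoUniformlyOn_iff.1 hunif (ε / 4) (by positivity)).exists
  set c := cauchyPowerSeries F 0 R
  refine ⟨∑ k ∈ Finset.range n, Polynomial.C (c.coeff k * (s : ℂ) ^ k) * X ^ k, ?_⟩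
  rw [dist_eq_norm]
  refine (norm_le (C := ε / 2) (by positivity) fun z => ?_).trans_lt (by linarith)
  have hz : ‖(z : ℂ)‖ ≤ 1 := mem_closedBall_zero_iff.1 z.2
  have hsz : ‖(s : ℂ) * z‖ ≤ s := by
    rw [norm_mul, norm_real, Real.norm_eq_abs, abs_of_nonneg s.coe_nonneg]
    exact mul_le_of_le_one_right s.2 hz
  have hsz1 : (s : ℂ) * z ∈ closedDisc := by
    simpa using hsz.trans hs2.le
  have h1 : dist (f z) (F (s * z)) < ε / 4 := by
    rw [← hf ⟨_, hsz1⟩]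
    refine hfδ ?_
    rw [Subtype.dist_eq, dist_eq_norm]
    have : (z : ℂ) - s * z = ((1 - s : ℝ) : ℂ) * z := by push_cast; ring
    rw [this, norm_mul, norm_real, Real.norm_eq_abs, abs_of_nonneg (by linarith)]
    exact (mul_le_of_le_one_right (by linarith) hz).trans_lt (by linarith)
  have h2 := hn (s * z) (by simpa using hsz.trans_lt hs1')
  have h3 : aeval coord (∑ k ∈ Finset.range n, Polynomial.C (c.coeff k * (s : ℂ) ^ k) * X ^ k) z =
      c.partialSum n (s * z) := by
    rw [aeval_coord_apply, eval_finsetSum, FormalMultilinearSeries.partialSum]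
    refine Finset.sum_congr rfl fun k _ => ?_
    rw [FormalMultilinearSeries.apply_eq_pow_smul_coeff, smul_eq_mul, mul_pow]
    simp only [eval_mul, eval_C, eval_pow, eval_X]
    ring
  rw [zero_add] at h2
  calc _ = dist (f z) (c.partialSum n (s * z)) := by rw [← h3, dist_eq_norm]; rfl
    _ ≤ _ := dist_triangle _ (F (s * z)) _
    _ ≤ _ := by linarith

/-- The points of the unit circle, as elements of the closed disc. -/
def circ (t : I) : closedDisc := ⟨circlePt t, by simp [norm_circlePt]⟩

lemma continuous_circ : Continuous circ := continuous_circlePt.subtype_mk _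

lemma continuous_apply_circ (f : ↥discAlgebra) : Continuous fun t => f (circ t) :=
  (f : C(closedDisc, ℂ)).continuous.comp continuous_circ

/-- The `n`-th Fourier coefficient of the restriction to the unit circle. -/
def fourierFunctional (n : ℕ) : C(closedDisc, ℂ) →L[ℂ] ℂ :=
  have hi (f : C(closedDisc, ℂ)) : Integrable fun t => f (circ t) * conj (circlePt t) ^ n :=
    integrable_of_continuous ((f.continuous.comp continuous_circ).mul
      ((continuous_conj.comp continuous_circlePt).pow n))
  LinearMap.mkContinuous
    { toFun := fun f => ∫ t, f (circ t) * conj (circlePt t) ^ n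
      map_add' := fun f g => by
        simp only [ContinuousMap.add_apply, add_mul, integral_add (hi f) (hi g)]
      map_smul' := fun c f => by
        simp only [ContinuousMap.smul_apply, smul_eq_mul, mul_assoc, integral_const_mul,
          RingHom.id_apply] } 1 fun f => by
    refine (norm_integral_le_of_norm_le_const (C := ‖f‖) (.of_forall fun t => ?_)).trans ?_
    · simpa [norm_circlePt] using f.norm_coe_le_norm (circ t)
    · simp

/-- The inclusion of the disc algebra into the continuous functions. -/
def inclusion : ↥discAlgebra →L[ℂ] C(closedDisc, ℂ) :=
  ⟨discAlgebra.val.toLinearMap, continuous_subtype_val⟩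

/-- The `n`-th Taylor coefficient at the origin, as a bounded functional on the disc algebra. -/
def taylorCoeff (n : ℕ) : DADual := (fourierFunctional n).comp inclusion

lemma taylorCoeff_apply (n : ℕ) (f : ↥discAlgebra) :
    taylorCoeff n f = ∫ t, f (circ t) * conj (circlePt t) ^ n := rfl

lemma taylorCoeff_aeval_coord (n : ℕ) (p : ℂ[X]) : taylorCoeff n (aeval coord p) = p.coeff n := by
  have h := integral_eval_mul_conj_eval (μ := volume) continuous_circlePt (w := fun _ => 1)
    (by simpa using integral_circlePt) (u := p) (v := X ^ n) (n := p.natDegree + n + 1)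
    (by lia) (by rw [natDegree_X_pow]; lia)
  simp only [eval_pow, eval_X, map_pow] at h
  rw [taylorCoeff_apply]
  simp_rw [aeval_coord_apply]
  refine h.trans ?_
  simp [coeff_X_pow]

lemma taylorCoeff_mul (n : ℕ) (f g : ↥discAlgebra) :
    taylorCoeff n (f * g) =
      ∑ x ∈ Finset.HasAntidiagonal.antidiagonal n, taylorCoeff x.1 f * taylorCoeff x.2 g := by
  refine isClosed_property2 denseRange_aeval_coord
    (p := fun f g => taylorCoeff n (f * g) =
      ∑ x ∈ Finset.HasAntidiagonal.antidiagonal n, taylorCoeff x.1 f * taylorCoeff x.2 g)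
    (isClosed_eq ((taylorCoeff n).continuous.comp continuous_mul)
      (continuous_finsetSum _ fun x _ => ((taylorCoeff x.1).continuous.comp continuous_fst).mul
        ((taylorCoeff x.2).continuous.comp continuous_snd))) (fun p q => ?_) f g
  simp only [← map_mul, taylorCoeff_aeval_coord, coeff_mul]

/-- Bessel's inequality for the Taylor coefficients. -/
lemma sum_norm_taylorCoeff_sq_le (n : ℕ) (f : ↥discAlgebra) :
    ∑ i ∈ Finset.range n, ‖taylorCoeff i f‖ ^ 2 ≤ ∫ t, ‖f (circ t)‖ ^ 2 := by
  have hcont : Continuous fun f : ↥discAlgebra => ∫ t, ‖f (circ t)‖ ^ 2 := by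
    refine continuous_iff_continuousAt.2 fun f₀ => ?_
    refine continuousAt_of_dominated (bound := fun _ => (‖f₀‖ + 1) ^ 2) ?_ ?_ ?_ ?_
    · exact .of_forall fun f =>
        ((continuous_apply_circ f).norm.pow 2).aestronglyMeasurable
    · filter_upwards [(continuous_norm.tendsto f₀).eventually_lt_const (lt_add_one _)] with f hf
      refine .of_forall fun t => ?_
      rw [norm_pow, norm_norm]
      gcongr
      exact (norm_apply_le f _).trans hf.le
    · exact integrable_const _
    · refine .of_forall fun t => ?_
      exact (((continuous_eval_const (circ t)).comp continuous_subtype_val).norm.pow 2).continuousAt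
  refine denseRange_aeval_coord.induction_on f (isClosed_le
    (continuous_finsetSum _ fun i _ => (taylorCoeff i).continuous.norm.pow 2) hcont) fun p => ?_
  simp only [taylorCoeff_aeval_coord, aeval_coord_apply]
  refine le_of_le_of_eq ?_ (integral_norm_eval_circlePt_sq p).symm
  rw [coeffSqSum_eq_sum_range (n := n + p.natDegree + 1) (by lia)]
  exact Finset.sum_le_sum_of_subset_of_nonneg (Finset.range_mono (by lia))
    fun _ _ _ => by positivity

lemma exp_coe_apply (f : C(closedDisc, ℂ)) (z : closedDisc) :
    NormedSpace.exp f z = Complex.exp (f z) := by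
  rw [Complex.exp_eq_exp_ℂ]
  exact NormedSpace.map_exp (ContinuousMap.evalAlgHom ℂ ℂ z) (continuous_eval_const z) f

/-- The exponential of an element of the disc algebra. -/
def exp (f : ↥discAlgebra) : ↥discAlgebra :=
  ⟨NormedSpace.exp (f : C(closedDisc, ℂ)), by
    obtain ⟨F, hF, hf⟩ := f.2
    exact ⟨fun z => Complex.exp (F z), hF.cexp, fun z => by rw [exp_coe_apply, hf]⟩⟩

lemma exp_apply (f : ↥discAlgebra) (z : closedDisc) : exp f z = Complex.exp (f z) :=
  exp_coe_apply _ z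

lemma exp_mul_exp_neg (f : ↥discAlgebra) : exp f * exp (-f) = 1 := by
  refine Subtype.ext (ContinuousMap.ext fun z => ?_)
  rw [mul_apply, exp_apply, exp_apply]
  change _ * Complex.exp (-f z) = 1
  rw [← Complex.exp_add, add_neg_cancel, Complex.exp_zero]

lemma norm_exp_le {f : ↥discAlgebra} {C : ℝ} (h : ∀ z, (f z).re ≤ C) : ‖exp f‖ ≤ Real.exp C :=
  norm_le (Real.exp_pos _).le fun z => by
    rw [exp_apply, Complex.norm_exp]
    exact Real.exp_le_exp.2 (h z)

/-- The truncated exponential series as a polynomial. -/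
def expPoly (n : ℕ) : ℂ[X] := ∑ k ∈ Finset.range n, C ((k.factorial : ℂ)⁻¹) * X ^ k

lemma derivative_expPoly_succ (n : ℕ) : (expPoly (n + 1)).derivative = expPoly n := by
  rw [expPoly, expPoly, Finset.sum_range_succ', derivative_add, derivative_sum]
  simp only [derivative_C_mul_X_pow, pow_zero, mul_one, derivative_C, add_zero]
  refine Finset.sum_congr rfl fun k _ => ?_
  rw [Nat.add_sub_cancel, Nat.factorial_succ]
  congr 2
  have : (k : ℂ) + 1 ≠ 0 := by exact_mod_cast k.succ_ne_zero
  push_cast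
  field_simp

lemma tendsto_aeval_expPoly (f : ↥discAlgebra) :
    Filter.Tendsto (fun n => aeval f (expPoly n)) Filter.atTop (nhds (exp f)) := by
  rw [tendsto_subtype_rng]
  have h := (NormedSpace.exp_series_hasSum_exp' (𝕂 := ℂ) (f : C(closedDisc, ℂ))).tendsto_sum_nat
  refine h.congr fun n => ?_
  have h2 := aeval_algHom_apply discAlgebra.val f (expPoly n)
  refine Eq.trans ?_ h2
  rw [expPoly, map_sum]
  refine Finset.sum_congr rfl fun k _ => ?_
  simp [Algebra.smul_def]

end discAlgebra

namespace IsDerivation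

open discAlgebra

variable {D : ↥discAlgebra →L[ℂ] DADual}

lemma map_one (hD : IsDerivation D) : D 1 = 0 := by
  ext u
  have h := hD 1 1 u
  simp only [one_mul] at h
  simpa using h

lemma map_aeval (hD : IsDerivation D) (f g : ↥discAlgebra) (p : ℂ[X]) :
    D (aeval f p) g = D f (aeval f p.derivative * g) := by
  induction p using Polynomial.induction_on' generalizing g with
  | add p q hp hq =>
    simp only [_root_.map_add, add_mul, _root_.add_apply, hp, hq]
  | monomial n a =>
    have hpow : ∀ (n : ℕ) (g : ↥discAlgebra), D (f ^ n) g = n * D f (f ^ (n - 1) * g) := by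
      intro n
      induction n with
      | zero => intro g; simp [hD.map_one]
      | succ n ih =>
        intro g
        rw [pow_succ, hD, ih]
        rcases n with _ | n
        · simp
        · have : f ^ n * (f * g) = f ^ (n + 1) * g := by ring
          simp only [Nat.add_sub_cancel, this]
          push_cast
          ring
    have h1 : aeval f (monomial n a) = a • f ^ n := by
      rw [aeval_monomial, Algebra.smul_def]
    have h2 : aeval f (derivative (monomial n a)) * g = (a * n) • (f ^ (n - 1) * g) := by
      rw [derivative_monomial, aeval_monomial, Algebra.smul_def, mul_assoc]
    rw [h1, h2, map_smul, map_smul, _root_.smul_apply, hpow, smul_eq_mul, smul_eq_mul,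
      mul_assoc]

lemma map_exp (hD : IsDerivation D) (f g : ↥discAlgebra) :
    D (exp f) g = D f (exp f * g) := by
  have h1 : Filter.Tendsto (fun n => D (aeval f (expPoly (n + 1))) g) Filter.atTop
      (nhds (D (exp f) g)) :=
    (((ContinuousLinearMap.apply ℂ ℂ g).continuous.comp D.continuous).tendsto _).comp
      ((tendsto_aeval_expPoly f).comp (Filter.tendsto_add_atTop_nat 1))
  have h2 : Filter.Tendsto (fun n => D f (aeval f (expPoly n) * g)) Filter.atTop
      (nhds (D f (exp f * g))) :=
    ((D f).continuous.tendsto _).comp ((tendsto_aeval_expPoly f).mul_const g)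
  refine tendsto_nhds_unique h1 (h2.congr fun n => ?_)
  rw [hD.map_aeval, derivative_expPoly_succ]

/-- A bounded derivation is controlled by the real part of its argument. -/
lemma norm_map_apply_one_le (hD : IsDerivation D) {f : ↥discAlgebra} (hf : ∀ z, |(f z).re| ≤ 1) :
    ‖D f 1‖ ≤ ‖D‖ * Real.exp 1 ^ 2 := by
  rw [← exp_mul_exp_neg f, ← hD.map_exp]
  have h1 := norm_exp_le fun z => (abs_le.1 (hf z)).2
  have h2 : ‖exp (-f)‖ ≤ Real.exp 1 := norm_exp_le fun z => by
    change (-f z).re ≤ 1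
    rw [neg_re]
    linarith [(abs_le.1 (hf z)).1]
  calc _ ≤ ‖D‖ * ‖exp f‖ * ‖exp (-f)‖ := ContinuousLinearMap.le_opNorm₂ D _ _
    _ ≤ ‖D‖ * Real.exp 1 * Real.exp 1 := by gcongr
    _ = _ := by ring

end IsDerivation

namespace discAlgebra

lemma one_add_mul_re_nonneg {b z : ℂ} (hb : ‖b‖ ≤ 1) (hz : ‖z‖ ≤ 1) : 0 ≤ (1 + b * z).re := by
  have h1 : ‖b * z‖ ≤ 1 := by rw [norm_mul]; exact mul_le_one₀ hb (norm_nonneg z) hz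
  have h2 := (abs_le.1 ((abs_re_le_norm (b * z)).trans h1)).1
  rw [add_re, one_re]
  linarith

lemma one_add_mul_re_pos {b z : ℂ} (hbz : ‖b‖ * ‖z‖ < 1) : 0 < (1 + b * z).re := by
  have h1 : ‖b * z‖ < 1 := by rwa [norm_mul]
  have h2 := (abs_lt.1 ((abs_re_le_norm (b * z)).trans_lt h1)).1
  rw [add_re, one_re]
  linarith

/-- The principal square root of `1 + b * z`. -/
def sqrtOneAdd (b : ℂ) (hb : ‖b‖ ≤ 1) : ↥discAlgebra :=
  ofFun (fun z => (1 + b * z) ^ ((2 : ℕ) : ℂ)⁻¹)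
    (fun z hz => by
      have h := one_add_mul_re_nonneg hb (mem_closedBall_zero_iff.1 hz)
      have h2 : ContinuousAt (fun z : ℂ => (1 + b * z, ((2 : ℕ) : ℂ)⁻¹)) z := by fun_prop
      exact (ContinuousAt.comp (f := fun z : ℂ => (1 + b * z, ((2 : ℕ) : ℂ)⁻¹))
        (continuousAt_cpow_of_re_pos (Or.inl h) (by norm_num)) h2).continuousWithinAt)
    (fun z hz => by
      have hz' := mem_ball_zero_iff.1 hz
      have h : 0 < (1 + b * z).re := one_add_mul_re_pos
        ((mul_le_of_le_one_left (norm_nonneg z) hb).trans_lt hz')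
      exact (DifferentiableAt.cpow (f := fun z => _ + _ * z) (g := fun _ => _) (by fun_prop)
        (by fun_prop) (Or.inl h)).differentiableWithinAt)

lemma sqrtOneAdd_apply_sq {b : ℂ} (hb : ‖b‖ ≤ 1) (z : closedDisc) :
    sqrtOneAdd b hb z ^ 2 = 1 + b * z :=
  cpow_nat_inv_pow _ two_ne_zero

/-- Every polynomial is a product of two elements of the disc algebra whose squared moduli agree
on the unit circle with the modulus of the polynomial. -/
lemma exists_mul_eq_aeval_coord (h : ℂ[X]) : ∃ f g : ↥discAlgebra, aeval coord h = f * g ∧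
    ∀ z : closedDisc, ‖(z : ℂ)‖ = 1 → ‖f z‖ ^ 2 = ‖h.eval (z : ℂ)‖ ∧
      ‖g z‖ ^ 2 = ‖h.eval (z : ℂ)‖ := by
  have hconst : ∀ a : ℂ, ∃ c : ↥discAlgebra, c * c = aeval coord (C a) ∧
      ∀ z, ‖c z‖ ^ 2 = ‖a‖ := by
    intro a
    obtain ⟨c, hc⟩ := IsAlgClosed.exists_pow_nat_eq a two_pos
    refine ⟨aeval coord (C c), by rw [← map_mul, ← C_mul, ← sq, hc], fun z => ?_⟩
    rw [aeval_coord_apply, eval_C, ← hc, norm_pow]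
  refine Submonoid.closure_induction (motive := fun h _ => ∃ f g : ↥discAlgebra,
    aeval coord h = f * g ∧ ∀ z : closedDisc, ‖(z : ℂ)‖ = 1 →
      ‖f z‖ ^ 2 = ‖h.eval (z : ℂ)‖ ∧ ‖g z‖ ^ 2 = ‖h.eval (z : ℂ)‖) ?_ ?_ ?_ (IsAlgClosed.splits h)
  · rintro _ (⟨a, rfl⟩ | ⟨a, rfl⟩)
    · obtain ⟨c, hc, hn⟩ := hconst a
      exact ⟨c, c, hc.symm, fun z _ => by simp [hn]⟩
    rcases lt_or_ge ‖a‖ 1 with ha | ha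
    · have hb : ‖conj a‖ < 1 := by simpa using ha
      set s := sqrtOneAdd (conj a) hb.le
      have hs : ∀ z : closedDisc, s z ^ 2 = 1 + conj a * z := sqrtOneAdd_apply_sq hb.le
      have hpos : ∀ z : ℂ, ‖z‖ ≤ 1 → 0 < (1 + conj a * z).re := fun z hz =>
        one_add_mul_re_pos ((mul_le_of_le_one_right (norm_nonneg _) hz).trans_lt hb)
      have hs0 : ∀ z : closedDisc, s z ≠ 0 := fun z h0 => by
        have h1 := hpos z (mem_closedBall_zero_iff.1 z.2)
        rw [← hs z, h0] at h1
        simp at h1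
      have hd : ∀ z : ℂ, ‖z‖ ≤ 1 →
          DifferentiableAt ℂ (fun z => (z + a) / (1 + conj a * z) ^ ((2 : ℕ) : ℂ)⁻¹) z := by
        intro z hz
        have h1 := hpos z hz
        refine DifferentiableAt.div (by fun_prop)
          (DifferentiableAt.cpow (f := fun z => _ + _ * z) (g := fun _ => _) (by fun_prop)
            (by fun_prop) (Or.inl h1)) ?_
        exact hs0 ⟨z, mem_closedBall_zero_iff.2 hz⟩
      set g := ofFun (fun z => (z + a) / (1 + conj a * z) ^ ((2 : ℕ) : ℂ)⁻¹)
        (fun z hz => (hd z (mem_closedBall_zero_iff.1 hz)).continuousAt.continuousWithinAt)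
        (fun z hz => (hd z (mem_ball_zero_iff.1 hz).le).differentiableWithinAt)
      have hg : ∀ z, g z = (z + a) / s z := fun z => rfl
      refine ⟨s, g, Subtype.ext (ContinuousMap.ext fun z => ?_), fun z hz => ?_⟩
      · rw [aeval_coord_apply, mul_apply, hg, mul_div_cancel₀ _ (hs0 z)]
        simp
      · have h1 : ‖(z : ℂ) + a‖ = ‖1 + conj a * z‖ := by
          have h2 : (1 : ℂ) + conj a * z = z * conj (z + a) := by
            rw [map_add, mul_add, mul_conj', hz]
            push_cast
            ring
          rw [h2, norm_mul, hz, one_mul, norm_conj]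
        have h3 : ‖s z‖ ^ 2 = ‖(z : ℂ) + a‖ := by rw [h1, ← hs z, norm_pow]
        have h4 : ‖s z‖ ≠ 0 := norm_ne_zero_iff.2 (hs0 z)
        have h5 : ‖g z‖ ^ 2 = ‖(z : ℂ) + a‖ := by
          rw [hg, norm_div, div_pow, h3, sq, mul_self_div_self]
        simpa using ⟨h3, h5⟩
    · have ha0 : a ≠ 0 := norm_pos_iff.1 (one_pos.trans_le ha)
      have hb : ‖a⁻¹‖ ≤ 1 := by rw [norm_inv]; exact inv_le_one_of_one_le₀ ha
      obtain ⟨c, hc, hn⟩ := hconst a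
      set s := sqrtOneAdd a⁻¹ hb
      have hs : ∀ z : closedDisc, s z ^ 2 = 1 + a⁻¹ * z := sqrtOneAdd_apply_sq hb
      have h1 : ∀ z : closedDisc, a * s z ^ 2 = z + a := fun z => by
        rw [hs]
        field_simp
        ring
      have h2 : ∀ z : closedDisc, ‖(c * s) z‖ ^ 2 = ‖(z : ℂ) + a‖ := fun z => by
        rw [mul_apply, norm_mul, mul_pow, hn, ← h1, norm_mul, norm_pow]
      refine ⟨c * s, c * s, ?_, fun z _ => by rw [eval_add, eval_X, eval_C]; exact ⟨h2 z, h2 z⟩⟩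
      rw [mul_mul_mul_comm, hc]
      refine Subtype.ext (ContinuousMap.ext fun z => ?_)
      rw [aeval_coord_apply, mul_apply, mul_apply, aeval_coord_apply, ← sq]
      simp [h1]
  · exact ⟨1, 1, by simp, fun z _ => by
      rw [eval_one]
      exact ⟨by change ‖(1 : ℂ)‖ ^ 2 = ‖(1 : ℂ)‖; simp, by change ‖(1 : ℂ)‖ ^ 2 = ‖(1 : ℂ)‖; simp⟩⟩
  · rintro p q _ _ ⟨f, g, hfg, hn⟩ ⟨f', g', hfg', hn'⟩
    refine ⟨f * f', g * g', by rw [map_mul, hfg, hfg', mul_mul_mul_comm], fun z hz => ?_⟩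
    simp only [mul_apply, norm_mul, mul_pow, eval_mul, hn z hz, hn' z hz, and_self]

end discAlgebra

lemma geom_sum_re_nonneg {r : ℝ} {n : ℕ} (hr : r ≤ 1) (hrn : r ^ n ≤ (1 - r) / 2) {w : ℂ}
    (hw : ‖w‖ ≤ r) : 0 ≤ (∑ k ∈ Finset.range n, w ^ k).re := by
  have hw0 := norm_nonneg w
  have h1 : 1 - r ≤ ‖1 - w‖ := by
    have := norm_sub_norm_le 1 w
    rw [norm_one] at this
    linarith
  rcases hr.eq_or_lt with rfl | hr1
  · norm_num at hrn
  have hpos : 0 < ‖1 - w‖ := by linarith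
  have h2 : conj (1 - w) * (1 - w ^ n) =
      ((‖1 - w‖ ^ 2 : ℝ) : ℂ) * ∑ k ∈ Finset.range n, w ^ k := by
    rw [← mul_neg_geom_sum, ← mul_assoc, conj_mul']
    push_cast
    rfl
  have h3 : ‖w ^ n * conj (1 - w)‖ ≤ ‖1 - w‖ ^ 2 / 2 := by
    rw [norm_mul, norm_pow, norm_conj]
    have : ‖w‖ ^ n ≤ ‖1 - w‖ / 2 := by
      refine (pow_le_pow_left₀ hw0 hw n).trans ?_
      linarith
    calc _ ≤ ‖1 - w‖ / 2 * ‖1 - w‖ := by gcongr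
      _ = _ := by ring
  have h4 := (re_le_norm _).trans h3
  have h5 : ‖1 - w‖ ^ 2 = 1 - 2 * w.re + ‖w‖ ^ 2 := by
    rw [← normSq_eq_norm_sq, ← normSq_eq_norm_sq, normSq_apply, normSq_apply]
    simp
    ring
  have h6 : ‖w‖ ^ 2 ≤ 1 := pow_le_one₀ hw0 (hw.trans hr)
  have h7 : 0 ≤ ‖1 - w‖ ^ 2 * (∑ k ∈ Finset.range n, w ^ k).re := by
    rw [← re_ofReal_mul, ← h2]
    have h8 : conj (1 - w) * (1 - w ^ n) = conj (1 - w) - w ^ n * conj (1 - w) := by ring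
    rw [h8, sub_re, conj_re, sub_re, one_re]
    linarith
  exact nonneg_of_mul_nonneg_right h7 (by positivity)

lemma integral_norm_le_of_forall_norm_integral_le {Ω : Type*} [TopologicalSpace Ω] [CompactSpace Ω]
    [MeasurableSpace Ω] [OpensMeasurableSpace Ω] {μ : Measure Ω} [IsFiniteMeasure μ]
    {h : Ω → ℂ} (hh : Continuous h) {M : ℝ}
    (H : ∀ u : Ω → ℝ, Measurable u → (∀ x, |u x| ≤ 1) → ‖∫ x, (u x : ℂ) * h x ∂μ‖ ≤ M) :
    ∫ x, ‖h x‖ ∂μ ≤ 2 * M := by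
  have hi : Integrable h μ := integrable_of_continuous hh
  have key : ∀ g : Ω → ℝ, Continuous g → ∃ u : Ω → ℝ, Measurable u ∧ (∀ x, |u x| ≤ 1) ∧
      ∀ x, u x * g x = |g x| := by
    intro g hg
    refine ⟨fun x => if 0 ≤ g x then 1 else -1,
      Measurable.ite (measurableSet_le measurable_const hg.measurable) measurable_const
        measurable_const, fun x => ?_, fun x => ?_⟩
    · dsimp only
      split_ifs <;> simp
    · dsimp only
      split_ifs with h0
      · rw [one_mul, abs_of_nonneg h0]
      · rw [abs_of_neg (not_le.1 h0)]
        ring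
  have hui : ∀ u : Ω → ℝ, Measurable u → (∀ x, |u x| ≤ 1) →
      Integrable (fun x => (u x : ℂ) * h x) μ := fun u hu hu1 =>
    hi.bdd_mul (c := 1) (measurable_ofReal.comp hu).aestronglyMeasurable
      (.of_forall fun x => by simpa using hu1 x)
  obtain ⟨u, hu, hu1, hug⟩ := key _ (continuous_re.comp hh)
  obtain ⟨v, hv, hv1, hvg⟩ := key _ (continuous_im.comp hh)
  have h1 : ∫ x, |(h x).re| ∂μ ≤ M := by
    refine le_trans (le_of_eq ?_) ((re_le_norm _).trans (H u hu hu1))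
    refine Eq.trans ?_ (integral_re (hui u hu hu1))
    exact integral_congr_ae (.of_forall fun x => by
      simpa [re_ofReal_mul] using (hug x).symm)
  have h2 : ∫ x, |(h x).im| ∂μ ≤ M := by
    refine le_trans (le_of_eq ?_) ((im_le_norm _).trans (H v hv hv1))
    refine Eq.trans ?_ (integral_im (hui v hv hv1))
    exact integral_congr_ae (.of_forall fun x => by
      simpa [im_ofReal_mul] using (hvg x).symm)
  have hre : Integrable (fun x => |(h x).re|) μ := integrable_of_continuous (by fun_prop)
  have him : Integrable (fun x => |(h x).im|) μ := integrable_of_continuous (by fun_prop)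
  calc _ ≤ ∫ x, |(h x).re| + |(h x).im| ∂μ :=
        integral_mono hi.norm (hre.add him) fun x => norm_le_abs_re_add_abs_im _
    _ = _ := integral_add hre him
    _ ≤ _ := by linarith

namespace IsDerivation

open discAlgebra

variable {D : ↥discAlgebra →L[ℂ] DADual}

/-- The dilated moment polynomials of a bounded derivation are bounded as functionals on bounded
real functions on the circle. -/
lemma norm_integral_mul_eval_le (hD : IsDerivation D) {r : ℝ} {n : ℕ} (hr0 : 0 ≤ r) (hr : r ≤ 1)
    (hrn : r ^ n ≤ (1 - r) / 2) {u : I → ℝ} (hu : Measurable u) (hu1 : ∀ x, |u x| ≤ 1) :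
    ‖∫ t, (u t : ℂ) * (∑ k ∈ Finset.range n, C (D (coord ^ k) 1 * r ^ k) * X ^ k).eval
      (circlePt t)‖ ≤ ‖D‖ * Real.exp 1 ^ 2 := by
  have hui : ∀ g : I → ℂ, Continuous g → Integrable fun t => (u t : ℂ) * g t := fun g hg =>
    (integrable_of_continuous hg).bdd_mul (c := 1) (measurable_ofReal.comp hu).aestronglyMeasurable
      (.of_forall fun x => by simpa using hu1 x)
  have hcp : ∀ k : ℕ, Continuous fun t => circlePt t ^ k := fun k => continuous_circlePt.pow k
  set c : ℕ → ℂ := fun k => ∫ t, (u t : ℂ) * circlePt t ^ k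
  have hsum : ∀ a : ℕ → ℂ, ∫ t, (u t : ℂ) * (∑ k ∈ Finset.range n, C (a k) * X ^ k).eval
      (circlePt t) = ∑ k ∈ Finset.range n, a k * c k := by
    intro a
    simp only [c, ← integral_const_mul]
    rw [← integral_finsetSum _ fun k _ => (hui _ (hcp k)).const_mul _]
    congr 1
    funext t
    rw [eval_finsetSum, Finset.mul_sum]
    refine Finset.sum_congr rfl fun k _ => ?_
    simp only [eval_mul, eval_C, eval_pow, eval_X]
    ring
  set P : ℂ[X] := ∑ k ∈ Finset.range n, C (r ^ k * c k) * X ^ k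
  have hP : D (aeval coord P) 1 = ∑ k ∈ Finset.range n, D (coord ^ k) 1 * r ^ k * c k := by
    have h1 : aeval coord P = ∑ k ∈ Finset.range n, ((r : ℂ) ^ k * c k) • coord ^ k := by
      simp only [P, _root_.map_sum, _root_.map_mul, aeval_C, map_pow, aeval_X, Algebra.smul_def]
    rw [h1, _root_.map_sum, _root_.sum_apply]
    refine Finset.sum_congr rfl fun k _ => ?_
    rw [map_smul, _root_.smul_apply, smul_eq_mul]
    ring
  rw [hsum, ← hP]
  refine hD.norm_map_apply_one_le fun z => ?_
  have hz : ‖(z : ℂ)‖ ≤ 1 := mem_closedBall_zero_iff.1 z.2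
  set q : ℂ[X] := ∑ k ∈ Finset.range n, C ((r * z : ℂ) ^ k) * X ^ k
  have hqc : Continuous fun t => q.eval (circlePt t) := q.continuous.comp continuous_circlePt
  have hq : ∀ t, 0 ≤ (q.eval (circlePt t)).re := by
    intro t
    have : q.eval (circlePt t) = ∑ k ∈ Finset.range n, ((r : ℂ) * z * circlePt t) ^ k := by
      simp only [q, eval_finsetSum, eval_mul, eval_C, eval_pow, eval_X, mul_pow]
    rw [this]
    refine geom_sum_re_nonneg hr hrn ?_
    rw [norm_mul, norm_mul, norm_circlePt, mul_one, norm_real, Real.norm_of_nonneg hr0]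
    exact mul_le_of_le_one_right hr0 hz
  have h1 : aeval coord P z = ∫ t, (u t : ℂ) * q.eval (circlePt t) := by
    rw [hsum, aeval_coord_apply, eval_finsetSum]
    refine Finset.sum_congr rfl fun k _ => ?_
    simp only [eval_mul, eval_C, eval_pow, eval_X, mul_pow]
    ring
  have h2 : ∫ t, (q.eval (circlePt t)).re ≤ 1 := by
    have h3 : ∫ t, q.eval (circlePt t) = if 0 ∈ Finset.range n then 1 else 0 := by
      have h4 := fun k => integral_circlePt k 0
      simp only [pow_zero, mul_one] at h4
      simp only [q, eval_finsetSum, eval_mul, eval_C, eval_pow, eval_X]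
      rw [integral_finsetSum _ fun k _ => (integrable_of_continuous (hcp k)).const_mul _]
      simp only [integral_const_mul, h4, mul_ite, mul_one, mul_zero, Finset.sum_ite_eq', pow_zero]
    have h5 : ∫ t, (q.eval (circlePt t)).re = (∫ t, q.eval (circlePt t)).re :=
      integral_re (integrable_of_continuous hqc)
    rw [h5, h3]
    split_ifs <;> simp
  have h6 : (aeval coord P z).re = ∫ t, u t * (q.eval (circlePt t)).re := by
    rw [h1]
    refine (integral_re (hui _ hqc)).symm.trans ?_
    exact integral_congr_ae (.of_forall fun t => by simp)
  rw [h6, ← Real.norm_eq_abs]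
  refine (norm_integral_le_of_norm_le (g := fun t => (q.eval (circlePt t)).re)
    (integrable_of_continuous (continuous_re.comp hqc)) (.of_forall fun t => ?_)).trans h2
  rw [norm_mul, Real.norm_of_nonneg (hq t)]
  exact mul_le_of_le_one_left (hq t) (hu1 t)

/-- The dilated moment polynomials of a bounded derivation are bounded in `L¹` of the circle. -/
lemma integral_norm_eval_le (hD : IsDerivation D) {r : ℝ} {n : ℕ} (hr0 : 0 ≤ r) (hr : r ≤ 1)
    (hrn : r ^ n ≤ (1 - r) / 2) :
    ∫ t, ‖(∑ k ∈ Finset.range n, C (D (coord ^ k) 1 * r ^ k) * X ^ k).eval (circlePt t)‖ ≤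
      2 * (‖D‖ * Real.exp 1 ^ 2) :=
  integral_norm_le_of_forall_norm_integral_le ((Polynomial.continuous _).comp continuous_circlePt)
    fun _ hu hu1 => hD.norm_integral_mul_eval_le hr0 hr hrn hu hu1

end IsDerivation

lemma isCompact_setOf_sum_norm_sq_le (R : ℝ) :
    IsCompact {α : ℕ → ℂ | ∀ m, ∑ i ∈ Finset.range m, ‖α i‖ ^ 2 ≤ R} := by
  refine (isCompact_univ_pi fun _ : ℕ => isCompact_closedBall (0 : ℂ) √R).of_isClosed_subset ?_ ?_
  · rw [Set.ofPred_forall]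
    exact isClosed_iInter fun m => isClosed_le (by fun_prop) continuous_const
  · intro α hα i _
    rw [mem_closedBall_zero_iff]
    refine Real.le_sqrt_of_sq_le (le_trans ?_ (hα (i + 1)))
    exact Finset.single_le_sum (f := fun i => ‖α i‖ ^ 2) (fun _ _ => by positivity)
      (Finset.self_mem_range_succ i)

/-- Limits of convolutions of sequences in a ball of `ℓ²` are convolutions of such sequences. -/
lemma exists_eq_sum_antidiagonal_of_tendsto {b : ℕ → ℂ} {R : ℝ} {α β : ℕ → ℕ → ℂ}
    (hα : ∀ n m, ∑ i ∈ Finset.range m, ‖α n i‖ ^ 2 ≤ R)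
    (hβ : ∀ n m, ∑ i ∈ Finset.range m, ‖β n i‖ ^ 2 ≤ R)
    (h : ∀ k, Filter.Tendsto (fun n => ∑ x ∈ Finset.HasAntidiagonal.antidiagonal k,
      α n x.1 * β n x.2) Filter.atTop (nhds (b k))) :
    ∃ α β : ℕ → ℂ, (∀ m, ∑ i ∈ Finset.range m, ‖α i‖ ^ 2 ≤ R) ∧
      (∀ m, ∑ i ∈ Finset.range m, ‖β i‖ ^ 2 ≤ R) ∧
      ∀ k, b k = ∑ x ∈ Finset.HasAntidiagonal.antidiagonal k, α x.1 * β x.2 := by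
  have hc := isCompact_setOf_sum_norm_sq_le R
  obtain ⟨⟨α', β'⟩, ⟨h1, h2⟩, φ, hφ, hlim⟩ :=
    (hc.prod hc).tendsto_subseq (x := fun n => (α n, β n)) fun n => ⟨hα n, hβ n⟩
  refine ⟨α', β', h1, h2, fun k => tendsto_nhds_unique ((h k).comp hφ.tendsto_atTop) ?_⟩
  have hcont : Continuous fun x : (ℕ → ℂ) × (ℕ → ℂ) =>
      ∑ y ∈ Finset.HasAntidiagonal.antidiagonal k, x.1 y.1 * x.2 y.2 := by fun_prop
  exact (hcont.tendsto (α', β')).comp hlim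

namespace IsDerivation

open discAlgebra

variable {D : ↥discAlgebra →L[ℂ] DADual}

/-- The moments of a bounded derivation are a convolution of two square-summable sequences. -/
lemma exists_map_coord_pow_eq_sum_antidiagonal (hD : IsDerivation D) :
    ∃ R : ℝ, ∃ α β : ℕ → ℂ, (∀ m, ∑ i ∈ Finset.range m, ‖α i‖ ^ 2 ≤ R) ∧
      (∀ m, ∑ i ∈ Finset.range m, ‖β i‖ ^ 2 ≤ R) ∧
      ∀ k, D (coord ^ k) 1 = ∑ x ∈ Finset.HasAntidiagonal.antidiagonal k, α x.1 * β x.2 := by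
  have hr : ∀ n : ℕ, ∃ r : ℝ, ∃ N : ℕ, 0 ≤ r ∧ r ≤ 1 ∧ 1 - 1 / ((n : ℝ) + 1) ≤ r ∧ n ≤ N ∧
      r ^ N ≤ (1 - r) / 2 := by
    intro n
    have h1 : 0 < 1 / ((n : ℝ) + 1) := by positivity
    have h2 : 1 / ((n : ℝ) + 1) ≤ 1 := by
      rw [div_le_one (by positivity)]
      linarith [(Nat.cast_nonneg n : (0 : ℝ) ≤ n)]
    obtain ⟨N, hN⟩ := exists_pow_lt_of_lt_one (y := 1 - 1 / ((n : ℝ) + 1))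
      (half_pos h1) (by linarith)
    refine ⟨1 - 1 / ((n : ℝ) + 1), max n N, by linarith, by linarith, le_rfl, le_max_left _ _, ?_⟩
    rw [sub_sub_cancel]
    exact (pow_le_pow_of_le_one (by linarith) (by linarith) (le_max_right n N)).trans hN.le
  choose r N hr0 hr1 hrn hnN hrN using hr
  set h : ℕ → ℂ[X] := fun n =>
    ∑ k ∈ Finset.range (N n), C (D (coord ^ k) 1 * (r n : ℂ) ^ k) * X ^ k
  choose f g hfg hn using fun n => exists_mul_eq_aeval_coord (h n)
  have hint := fun n => hD.integral_norm_eval_le (hr0 n) (hr1 n) (hrN n)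
  have hcirc : ∀ t, ‖(circ t : ℂ)‖ = 1 := norm_circlePt
  have hr_lim : Filter.Tendsto r Filter.atTop (nhds 1) := by
    refine tendsto_of_tendsto_of_tendsto_of_le_of_le ?_ tendsto_const_nhds hrn hr1
    simpa using (tendsto_one_div_add_atTop_nhds_zero_nat (𝕜 := ℝ)).const_sub 1
  refine ⟨2 * (‖D‖ * Real.exp 1 ^ 2), exists_eq_sum_antidiagonal_of_tendsto
    (α := fun n i => taylorCoeff i (f n)) (β := fun n i => taylorCoeff i (g n))
    (fun n m => (sum_norm_taylorCoeff_sq_le m (f n)).trans ?_)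
    (fun n m => (sum_norm_taylorCoeff_sq_le m (g n)).trans ?_) fun k => ?_⟩
  · simp only [(hn n _ (hcirc _)).1]
    exact hint n
  · simp only [(hn n _ (hcirc _)).2]
    exact hint n
  · simp only [← taylorCoeff_mul, ← hfg, taylorCoeff_aeval_coord]
    have h1 : Filter.Tendsto (fun n => D (coord ^ k) 1 * (r n : ℂ) ^ k) Filter.atTop
        (nhds (D (coord ^ k) 1)) := by
      simpa using (((continuous_ofReal.tendsto 1).comp hr_lim).pow k).const_mul (D (coord ^ k) 1)
    refine h1.congr' ?_
    filter_upwards [Filter.eventually_gt_atTop k] with n hkn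
    simp only [h, finsetSum_coeff, coeff_C_mul_X_pow]
    rw [Finset.sum_ite_eq, if_pos (Finset.mem_range.2 (hkn.trans_le (hnN n)))]

end IsDerivation

lemma primitivePairing_add (h : ℕ → ℂ) (G H : ℂ[X]) :
    primitivePairing h (G + H) = primitivePairing h G + primitivePairing h H := by
  have h1 : G.natDegree < G.natDegree + H.natDegree + 1 := by lia
  have h2 : H.natDegree < G.natDegree + H.natDegree + 1 := by lia
  have h3 : (G + H).natDegree < G.natDegree + H.natDegree + 1 :=
    (natDegree_add_le G H).trans_lt (by lia)
  rw [primitivePairing_eq_sum_range h h1, primitivePairing_eq_sum_range h h2,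
    primitivePairing_eq_sum_range h h3, ← Finset.sum_add_distrib]
  exact Finset.sum_congr rfl fun k _ => by rw [coeff_add, mul_add]

lemma primitivePairing_coeff_add (K L G : ℂ[X]) :
    primitivePairing (K + L).coeff G =
      primitivePairing K.coeff G + primitivePairing L.coeff G := by
  rw [primitivePairing, primitivePairing, primitivePairing, ← Finset.sum_add_distrib]
  exact Finset.sum_congr rfl fun k _ => by rw [coeff_add]; ring

/-- The polynomial with the first `n` terms of a sequence as coefficients. -/
def truncPoly (α : ℕ → ℂ) (n : ℕ) : ℂ[X] := ∑ k ∈ Finset.range n, C (α k) * X ^ k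

lemma coeff_truncPoly (α : ℕ → ℂ) (n i : ℕ) :
    (truncPoly α n).coeff i = if i < n then α i else 0 := by
  simp only [truncPoly, finsetSum_coeff, coeff_C_mul_X_pow, Finset.sum_ite_eq, Finset.mem_range]

lemma natDegree_truncPoly_le (α : ℕ → ℂ) (n : ℕ) : (truncPoly α n).natDegree ≤ n :=
  natDegree_le_iff_coeff_eq_zero.2 fun i hi => by rw [coeff_truncPoly, if_neg (by lia)]

lemma coeffSqSum_truncPoly (α : ℕ → ℂ) (n : ℕ) :
    coeffSqSum (truncPoly α n) = ∑ i ∈ Finset.range n, ‖α i‖ ^ 2 := by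
  rw [coeffSqSum_eq_sum_range (Nat.lt_succ_of_le (natDegree_truncPoly_le α n)),
    Finset.sum_range_succ, coeff_truncPoly, if_neg (lt_irrefl n)]
  simp only [norm_zero, ne_eq, two_ne_zero, not_false_eq_true, zero_pow, add_zero]
  exact Finset.sum_congr rfl fun i hi => by
    rw [coeff_truncPoly, if_pos (Finset.mem_range.1 hi)]

lemma coeffSqSum_truncPoly_sub (α : ℕ → ℂ) {m n : ℕ} (hmn : n ≤ m) :
    coeffSqSum (truncPoly α m - truncPoly α n) =
      ∑ i ∈ Finset.range m, ‖α i‖ ^ 2 - ∑ i ∈ Finset.range n, ‖α i‖ ^ 2 := by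
  have h1 := Nat.lt_succ_of_le (natDegree_truncPoly_le α m)
  have h2 : (truncPoly α n).natDegree < m + 1 := (natDegree_truncPoly_le α n).trans_lt (by lia)
  have h3 : (truncPoly α m - truncPoly α n).natDegree < m + 1 :=
    (natDegree_sub_le _ _).trans_lt (max_lt h1 h2)
  rw [← coeffSqSum_truncPoly, ← coeffSqSum_truncPoly, coeffSqSum_eq_sum_range h1,
    coeffSqSum_eq_sum_range h2, coeffSqSum_eq_sum_range h3, ← Finset.sum_sub_distrib]
  refine Finset.sum_congr rfl fun i _ => ?_
  rw [coeff_sub, coeff_truncPoly, coeff_truncPoly]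
  rcases lt_or_ge i n with hi | hi
  · rw [if_pos hi, if_pos (hi.trans_le hmn)]
    simp
  · rw [if_neg (not_lt.2 hi)]
    simp

lemma coeff_truncPoly_mul (α β : ℕ → ℂ) {k n : ℕ} (hk : k < n) :
    (truncPoly α n * truncPoly β n).coeff k =
      ∑ x ∈ Finset.HasAntidiagonal.antidiagonal k, α x.1 * β x.2 := by
  rw [coeff_mul]
  refine Finset.sum_congr rfl fun x hx => ?_
  have := Finset.HasAntidiagonal.mem_antidiagonal.1 hx
  rw [coeff_truncPoly, coeff_truncPoly, if_pos (by lia), if_pos (by lia)]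

lemma eventually_sum_range_sub_le {a : ℕ → ℝ} (ha : ∀ i, 0 ≤ a i) {R : ℝ}
    (hR : ∀ m, ∑ i ∈ Finset.range m, a i ≤ R) {δ : ℝ} (hδ : 0 < δ) :
    ∀ᶠ n in Filter.atTop, ∀ m,
      ∑ i ∈ Finset.range m, a i - ∑ i ∈ Finset.range n, a i ≤ δ := by
  have hs := summable_of_sum_range_le ha hR
  filter_upwards [hs.hasSum.tendsto_sum_nat.eventually_const_lt (sub_lt_self _ hδ)] with n hn m
  linarith [hs.sum_le_tsum (Finset.range m) fun i _ => ha i]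

/-- If a sequence is a convolution of two square-summable sequences, the associated pairing is
approximated by those of polynomials. -/
lemma exists_norm_primitivePairing_sub_le {b α β : ℕ → ℂ} {R : ℝ}
    (hα : ∀ m, ∑ i ∈ Finset.range m, ‖α i‖ ^ 2 ≤ R) (hβ : ∀ m, ∑ i ∈ Finset.range m, ‖β i‖ ^ 2 ≤ R)
    (hb : ∀ k, b k = ∑ x ∈ Finset.HasAntidiagonal.antidiagonal k, α x.1 * β x.2)
    {ε : ℝ} (hε : 0 < ε) : ∃ h : ℂ[X], ∀ (p q : ℂ[X]) (P Q : ℝ),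
      (∀ z : ℂ, ‖z‖ ≤ 1 → ‖p.eval z‖ ≤ P) → (∀ z : ℂ, ‖z‖ ≤ 1 → ‖q.eval z‖ ≤ Q) →
      ‖primitivePairing b (p.derivative * q) -
        primitivePairing h.coeff (p.derivative * q)‖ ≤ ε * P * Q := by
  have hs : 0 < ε / (8 * (√R + 1)) := by positivity
  set s := ε / (8 * (√R + 1))
  have hsR : 8 * s * √R ≤ ε := by
    have : s * (8 * (√R + 1)) = ε := div_mul_cancel₀ _ (by positivity)
    linarith
  obtain ⟨n, hnα, hnβ⟩ := ((eventually_sum_range_sub_le (fun i => by positivity) hα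
    (sq_pos_of_pos hs)).and (eventually_sum_range_sub_le (fun i => by positivity) hβ
    (sq_pos_of_pos hs))).exists
  refine ⟨truncPoly α n * truncPoly β n, fun p q P Q hP hQ => ?_⟩
  have hP0 : 0 ≤ P := (norm_nonneg _).trans (hP 0 (by simp))
  have hQ0 : 0 ≤ Q := (norm_nonneg _).trans (hQ 0 (by simp))
  set G := p.derivative * q with hG
  set m := n + G.natDegree + 2
  have hnm : n ≤ m := by lia
  have h1 : primitivePairing b G = primitivePairing (truncPoly α m * truncPoly β m).coeff G := by
    rw [primitivePairing_eq_sum_range b G.natDegree.lt_succ_self,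
      primitivePairing_eq_sum_range _ G.natDegree.lt_succ_self]
    refine Finset.sum_congr rfl fun k hk => ?_
    have := Finset.mem_range.1 hk
    rw [coeff_truncPoly_mul α β (by lia), hb]
  have h2 : truncPoly α m * truncPoly β m = (truncPoly α m - truncPoly α n) * truncPoly β m +
      (truncPoly α n * (truncPoly β m - truncPoly β n) + truncPoly α n * truncPoly β n) := by ring
  rw [h1, h2, primitivePairing_coeff_add, primitivePairing_coeff_add, ← add_assoc,
    add_sub_cancel_right]
  have hsα : √(coeffSqSum (truncPoly α m - truncPoly α n)) ≤ s := by
    rw [coeffSqSum_truncPoly_sub α hnm]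
    exact Real.sqrt_le_iff.2 ⟨hs.le, hnα m⟩
  have hsβ : √(coeffSqSum (truncPoly β m - truncPoly β n)) ≤ s := by
    rw [coeffSqSum_truncPoly_sub β hnm]
    exact Real.sqrt_le_iff.2 ⟨hs.le, hnβ m⟩
  have hRα : √(coeffSqSum (truncPoly α n)) ≤ √R :=
    Real.sqrt_le_sqrt ((coeffSqSum_truncPoly α n).trans_le (hα n))
  have hRβ : √(coeffSqSum (truncPoly β m)) ≤ √R :=
    Real.sqrt_le_sqrt ((coeffSqSum_truncPoly β m).trans_le (hβ m))
  calc _ ≤ 4 * s * √R * P * Q + 4 * √R * s * P * Q := by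
        refine norm_add_le_of_le ?_ ?_
        · refine (norm_primitivePairing_mul_le _ _ p q hP hQ).trans ?_
          gcongr
        · refine (norm_primitivePairing_mul_le _ _ p q hP hQ).trans ?_
          gcongr
    _ = 8 * s * √R * P * Q := by ring
    _ ≤ _ := by gcongr

namespace discAlgebra

/-- The finite-rank derivation with moments given by the coefficients of a polynomial. -/
def finiteRankDerivation (h : ℂ[X]) : ↥discAlgebra →L[ℂ] DADual :=
  ∑ k ∈ Finset.range (h.natDegree + 1), ∑ x ∈ Finset.HasAntidiagonal.antidiagonal k,
    (h.coeff (k + 1) / (k + 1) * (x.1 + 1)) • (taylorCoeff (x.1 + 1)).smulRight (taylorCoeff x.2)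

lemma finiteRankDerivation_apply (h : ℂ[X]) (f : ↥discAlgebra) :
    finiteRankDerivation h f = ∑ k ∈ Finset.range (h.natDegree + 1),
      ∑ x ∈ Finset.HasAntidiagonal.antidiagonal k,
        (h.coeff (k + 1) / (k + 1) * (x.1 + 1)) • taylorCoeff (x.1 + 1) f • taylorCoeff x.2 := by
  simp only [finiteRankDerivation, _root_.sum_apply, _root_.smul_apply,
    ContinuousLinearMap.smulRight_apply]

lemma finiteRankDerivation_aeval_coord (h p q : ℂ[X]) :
    finiteRankDerivation h (aeval coord p) (aeval coord q) =
      primitivePairing h.coeff (p.derivative * q) := by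
  rw [primitivePairing_eq_sum_range (n := h.natDegree + 1 + ((p.derivative * q).natDegree + 1)) _
    (by lia)]
  refine Eq.trans ?_ (Finset.sum_subset (Finset.range_mono (Nat.le_add_right _ _))
    fun k _ hk => ?_)
  · simp only [finiteRankDerivation_apply, _root_.sum_apply, _root_.smul_apply,
      taylorCoeff_aeval_coord, smul_eq_mul, coeff_mul, coeff_derivative, Finset.mul_sum]
    exact Finset.sum_congr rfl fun k _ => Finset.sum_congr rfl fun x _ => by ring
  · rw [Finset.mem_range] at hk
    rw [coeff_eq_zero_of_natDegree_lt (by lia), zero_div, zero_mul]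

lemma finiteDimensional_range_finiteRankDerivation (h : ℂ[X]) :
    FiniteDimensional ℂ
      (LinearMap.range (finiteRankDerivation h : ↥discAlgebra →ₗ[ℂ] DADual)) := by
  have := FiniteDimensional.span_of_finite ℂ
    ((Finset.range (h.natDegree + 1)).finite_toSet.image taylorCoeff)
  refine Submodule.finiteDimensional_of_le
    (S₂ := Submodule.span ℂ (taylorCoeff '' (Finset.range (h.natDegree + 1)))) ?_
  rintro _ ⟨f, rfl⟩
  rw [ContinuousLinearMap.coe_coe, finiteRankDerivation_apply]
  refine Submodule.sum_mem _ fun k hk => Submodule.sum_mem _ fun x hx => Submodule.smul_mem _ _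
    (Submodule.smul_mem _ _ (Submodule.subset_span ⟨x.2, ?_, rfl⟩))
  have h1 := Finset.HasAntidiagonal.mem_antidiagonal.1 hx
  have h2 := Finset.mem_range.1 hk
  exact Finset.mem_coe.2 (Finset.mem_range.2 (by lia))

lemma continuous_apply_apply (D : ↥discAlgebra →L[ℂ] DADual) {X : Type*} [TopologicalSpace X]
    {f g : X → ↥discAlgebra} (hf : Continuous f) (hg : Continuous g) :
    Continuous fun x => D (f x) (g x) :=
  (D.continuous.comp hf).clm_apply hg

lemma isDerivation_finiteRankDerivation (h : ℂ[X]) : IsDerivation (finiteRankDerivation h) := by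
  have h1 : Continuous fun x : ↥discAlgebra × ↥discAlgebra × ↥discAlgebra => x.1 := continuous_fst
  have h2 : Continuous fun x : ↥discAlgebra × ↥discAlgebra × ↥discAlgebra => x.2.1 :=
    continuous_fst.comp continuous_snd
  have h3 : Continuous fun x : ↥discAlgebra × ↥discAlgebra × ↥discAlgebra => x.2.2 :=
    continuous_snd.comp continuous_snd
  refine isClosed_property3 denseRange_aeval_coord
    (p := fun f g u => finiteRankDerivation h (f * g) u =
      finiteRankDerivation h g (f * u) + finiteRankDerivation h f (g * u))
    (isClosed_eq (continuous_apply_apply _ (h1.mul h2) h3)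
      ((continuous_apply_apply _ h2 (h1.mul h3)).add (continuous_apply_apply _ h1 (h2.mul h3))))
    fun p q u => ?_
  simp only [← _root_.map_mul, finiteRankDerivation_aeval_coord, ← primitivePairing_add]
  rw [derivative_mul]
  congr 1
  ring

end discAlgebra

namespace IsDerivation

open discAlgebra

variable {D : ↥discAlgebra →L[ℂ] DADual}

lemma map_coord_coord_pow (hD : IsDerivation D) (k : ℕ) :
    D coord (coord ^ k) = D (coord ^ (k + 1)) 1 / (k + 1) := by
  have h := hD.map_aeval coord 1 (X ^ (k + 1))
  have hk : (k : ℂ) + 1 ≠ 0 := by exact_mod_cast k.succ_ne_zero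
  have h2 : aeval coord (derivative (X ^ (k + 1) : ℂ[X])) * 1 = ((k : ℂ) + 1) • coord ^ k := by
    rw [derivative_X_pow, mul_one, _root_.map_mul, aeval_C, map_pow, aeval_X, Algebra.smul_def,
      Nat.add_sub_cancel]
    push_cast
    rfl
  rw [h2, map_pow, aeval_X, map_smul, smul_eq_mul] at h
  rw [h, mul_div_cancel_left₀ _ hk]

lemma map_aeval_coord_aeval_coord (hD : IsDerivation D) (p q : ℂ[X]) :
    D (aeval coord p) (aeval coord q) =
      primitivePairing (fun k => D (coord ^ k) 1) (p.derivative * q) := by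
  rw [hD.map_aeval, ← _root_.map_mul, aeval_eq_sum_range, _root_.map_sum,
    primitivePairing_eq_sum_range _ (Nat.lt_succ_self _)]
  refine Finset.sum_congr rfl fun k _ => ?_
  rw [map_smul, smul_eq_mul, hD.map_coord_coord_pow, mul_comm]

end IsDerivation

/-- Every bounded derivation from the disc algebra to its dual can be
approximated in the operator norm by finite-rank bounded derivations. -/
theorem derivation_approximable_by_finite_rank_derivations
    (D : ↥discAlgebra →L[ℂ] DADual) (hD : IsDerivation D) (ε : ℝ) (hε : 0 < ε) :
    ∃ D' : ↥discAlgebra →L[ℂ] DADual, IsDerivation D' ∧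
      FiniteDimensional ℂ (LinearMap.range (D' : ↥discAlgebra →ₗ[ℂ] DADual)) ∧
      ‖D - D'‖ < ε := by
  obtain ⟨R, α, β, hα, hβ, hb⟩ := hD.exists_map_coord_pow_eq_sum_antidiagonal
  obtain ⟨h, hh⟩ := exists_norm_primitivePairing_sub_le hα hβ hb (half_pos hε)
  refine ⟨discAlgebra.finiteRankDerivation h, discAlgebra.isDerivation_finiteRankDerivation h,
    discAlgebra.finiteDimensional_range_finiteRankDerivation h, ?_⟩
  refine (ContinuousLinearMap.opNorm_le_bound₂ _ (half_pos hε).le ?_).trans_lt (half_lt_self hε)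
  refine isClosed_property2 discAlgebra.denseRange_aeval_coord
    (p := fun f g => ‖(D - discAlgebra.finiteRankDerivation h) f g‖ ≤ ε / 2 * ‖f‖ * ‖g‖)
    (isClosed_le (discAlgebra.continuous_apply_apply _ continuous_fst continuous_snd).norm
      ((continuous_const.mul continuous_fst.norm).mul continuous_snd.norm)) fun p q => ?_
  rw [_root_.sub_apply, _root_.sub_apply, hD.map_aeval_coord_aeval_coord,
    discAlgebra.finiteRankDerivation_aeval_coord]
  exact hh p q _ _ (discAlgebra.norm_eval_le p) (discAlgebra.norm_eval_le q)

end
end
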